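/- Let Q be a quiver of ADE type with Coxeter number h, and let λ: I → ℂ be a weight with ν(λ) = -λ (i.e., λ_{ν(i)} = -λ_i for all i). Let A_λ be the quotient of the path algebra ℂQ̄ by the relation Σ_{a∈Q}[a,a*] = Σ_i λ_i e_i. Then the associated graded algebra of A_λ under the filtration by length of paths is the preprojective algebra A = Π_Q; in particular dim A_λ = dim A = r h(h+1)/6. -/

import Mathlib

open scoped BigOperators

/-- The data of a quiver `Q` (with vertex set `I` and arrow set `E`), to be assumed of
ADE type via `IsADE` below, together with the combinatorial invariants of the associated
root system: the exponents `m 0 ≤ m 1 ≤ ⋯ ≤ m (r-1)` (only the values `m i` for `i < r`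
are relevant), the Coxeter number `h`, and the involution `ν` of the vertex set induced
by the longest element `w₀` of the Weyl group (`w₀ (α_i) = -α_{ν i}`). -/
structure ADEQuiver where
  I : Type
  [fintypeI : Fintype I]
  [decEqI : DecidableEq I]
  E : Type
  [fintypeE : Fintype E]
  src : E → I
  tgt : E → I
  m : ℕ → ℕ
  h : ℕ
  nu : I → I

attribute [instance] ADEQuiver.fintypeI ADEQuiver.decEqI ADEQuiver.fintypeE

namespace ADEQuiver

variable (Q : ADEQuiver)

/-- the number of vertices of `Q` -/
def r : ℕ := Fintype.card Q.I

/-- The adjacency matrix of the double quiver `Q̄` (equivalently, of the underlying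
graph of `Q`): `C i j` is the number of arrows from `i` to `j` in `Q̄`. -/
def C : Matrix Q.I Q.I ℤ := fun i j =>
  ((Finset.univ.filter fun e => Q.src e = i ∧ Q.tgt e = j).card : ℤ) +
  ((Finset.univ.filter fun e => Q.src e = j ∧ Q.tgt e = i).card : ℤ)

/-- `Q` is a quiver of ADE type: its underlying graph is connected and the symmetrized
Cartan matrix `2·1 - C` is positive definite.  (A connected graph is a simply-laced
Dynkin diagram, i.e. of type Aₙ, Dₙ, E₆, E₇ or E₈, if and only if `2·1 - C ≻ 0`.) -/
def IsADE : Prop :=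
  (∀ i j : Q.I, Relation.ReflTransGen
      (fun a b => ∃ e, (Q.src e = a ∧ Q.tgt e = b) ∨ (Q.src e = b ∧ Q.tgt e = a)) i j) ∧
  ((2 : ℝ) • (1 : Matrix Q.I Q.I ℝ) - Q.C.map (Int.cast : ℤ → ℝ)).PosDef

/-- `m 0 ≤ ⋯ ≤ m (r - 1)` are the exponents of the root system attached to `Q`, and `h`
is its Coxeter number: the exponents are increasing positive integers with
`h = m_r + 1`, and the eigenvalues of the adjacency matrix `C` are `2 cos (m_i π / h)`
(expressed below as a factorization of the characteristic polynomial of `C` over `ℝ`). -/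
def ExponentsSpec : Prop :=
  (Q.C.map (Int.cast : ℤ → ℝ)).charpoly =
      ∏ i ∈ Finset.range Q.r,
        (Polynomial.X - Polynomial.C (2 * Real.cos (Q.m i * Real.pi / Q.h))) ∧
  (∀ i j : ℕ, i ≤ j → j < Q.r → Q.m i ≤ Q.m j) ∧
  (∀ i : ℕ, i < Q.r → 1 ≤ Q.m i) ∧
  1 ≤ Q.r ∧ Q.h = Q.m (Q.r - 1) + 1

/-- `ν` is the involution of `I` with `w₀ (α_i) = -α_{ν i}`: among the involutive
automorphisms of the underlying graph it is characterized by the fact that the number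
of vertices not fixed by it equals `2·#{i : m_i even}`. -/
def NuSpec : Prop :=
  Function.Involutive Q.nu ∧
  (∀ i j, Q.C (Q.nu i) (Q.nu j) = Q.C i j) ∧
  (Finset.univ.filter fun i => Q.nu i ≠ i).card =
    2 * ((Finset.range Q.r).filter fun i => Even (Q.m i)).card

/-- `r₋ = dim ker (P + 1)`: half the number of vertices not fixed by `ν`. -/
def rMinus : ℕ := (Finset.univ.filter fun i => Q.nu i ≠ i).card / 2

/-- `r₊ = dim ker (P - 1) = r - r₋`. -/
def rPlus : ℕ := Q.r - Q.rMinus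

/-- The dimension of the degree-`d` homogeneous component of the graded vector space `U`
with Hilbert series `∑_{i : m_i < h/2} t^{2 m_i}`. -/
def uDim (d : ℤ) : ℕ :=
  ((Finset.range Q.r).filter fun i => 2 * Q.m i < Q.h ∧ (2 * Q.m i : ℤ) = d).card

/-- `dim Y = r₊ - r₋ - #{i : m_i = h/2}` (`Y` sits in degree 0). -/
def yDim : ℕ :=
  Q.rPlus - Q.rMinus - ((Finset.range Q.r).filter fun i => 2 * Q.m i = Q.h).card

/-- `dim L = r₊ - r₋`, where `L = ⟨e_i | ν i = i⟩` (`L` sits in degree 0). -/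
def lDim : ℕ := Q.rPlus - Q.rMinus

end ADEQuiver

namespace ADEQuiver

variable (Q : ADEQuiver)

/-- The generators of the path algebra `ℂQ̄` of the double quiver: the trivial paths
`e_i` (`Sum.inl i`) and the arrows of `Q̄ = Q ∪ Q*` (`Sum.inr (Sum.inl a)` for `a ∈ Q`
and `Sum.inr (Sum.inr a)` for `a* ∈ Q*`). -/
abbrev Gen := Q.I ⊕ (Q.E ⊕ Q.E)

/-- source of an arrow of the double quiver `Q̄` -/
def dsrc : Q.E ⊕ Q.E → Q.I := Sum.elim Q.src Q.tgt

/-- target of an arrow of the double quiver `Q̄` -/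
def dtgt : Q.E ⊕ Q.E → Q.I := Sum.elim Q.tgt Q.src

/-- The defining relations of the deformed preprojective algebra
`A_λ = ℂQ̄ / (∑_{a ∈ Q} [a, a*] - ∑_i λ_i e_i)`: the presentation of the path algebra
`ℂQ̄` of the double quiver (the `e_i` are orthogonal idempotents summing to `1` and the
arrows are composable according to their endpoints), together with the deformed
preprojective relation `∑_{a ∈ Q} [a, a*] = ∑_i λ_i e_i`.  For `λ = 0` this presents
the preprojective algebra `A = Π_Q` itself. -/
inductive PathRel (lam : Q.I → ℂ) :
    FreeAlgebra ℂ Q.Gen → FreeAlgebra ℂ Q.Gen → Prop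
  | vertex_mul (i j : Q.I) :
      PathRel lam (FreeAlgebra.ι ℂ (Sum.inl i : Q.Gen) * FreeAlgebra.ι ℂ (Sum.inl j))
        (if i = j then FreeAlgebra.ι ℂ (Sum.inl i : Q.Gen) else 0)
  | sum_vertices :
      PathRel lam (∑ i : Q.I, FreeAlgebra.ι ℂ (Sum.inl i : Q.Gen)) 1
  | arr_src (x : Q.E ⊕ Q.E) :
      PathRel lam
        (FreeAlgebra.ι ℂ (Sum.inr x : Q.Gen) * FreeAlgebra.ι ℂ (Sum.inl (Q.dsrc x)))
        (FreeAlgebra.ι ℂ (Sum.inr x : Q.Gen))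
  | arr_tgt (x : Q.E ⊕ Q.E) :
      PathRel lam
        (FreeAlgebra.ι ℂ (Sum.inl (Q.dtgt x) : Q.Gen) * FreeAlgebra.ι ℂ (Sum.inr x))
        (FreeAlgebra.ι ℂ (Sum.inr x : Q.Gen))
  | preproj :
      PathRel lam
        (∑ a : Q.E,
          (FreeAlgebra.ι ℂ (Sum.inr (Sum.inl a) : Q.Gen) *
              FreeAlgebra.ι ℂ (Sum.inr (Sum.inr a)) -
            FreeAlgebra.ι ℂ (Sum.inr (Sum.inr a) : Q.Gen) *
              FreeAlgebra.ι ℂ (Sum.inr (Sum.inl a))))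
        (∑ i : Q.I, lam i • FreeAlgebra.ι ℂ (Sum.inl i : Q.Gen))

/-- The deformed preprojective algebra `A_λ`; for `λ = 0` this is the preprojective
algebra `A = Π_Q`. -/
abbrev Deformed (lam : Q.I → ℂ) := RingQuot (Q.PathRel lam)

/-- the images of the generators in `A_λ` -/
def gen (lam : Q.I → ℂ) (g : Q.Gen) : Q.Deformed lam :=
  RingQuot.mkAlgHom ℂ (Q.PathRel lam) (FreeAlgebra.ι ℂ g)

/-- the image in `A_λ` of a word in the generators -/
def wordVal (lam : Q.I → ℂ) (w : List Q.Gen) : Q.Deformed lam :=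
  (w.map (Q.gen lam)).prod

/-- the number of arrow-letters of a word (its path length) -/
def arrowCount (w : List Q.Gen) : ℕ := w.countP fun g => g.isRight

/-- The filtration of `A_λ` by length of paths: `filt lam n` is spanned by the images
of the words containing at most `n` arrows. -/
def filt (lam : Q.I → ℂ) (n : ℕ) : Submodule ℂ (Q.Deformed lam) :=
  Submodule.span ℂ {x | ∃ w : List Q.Gen, Q.arrowCount w ≤ n ∧ x = Q.wordVal lam w}

end ADEQuiver

open ADEQuiver

namespace DPA
open scoped BigOperators

/-- a family of elements satisfying the defining relations -/
structure Sat (Q : ADEQuiver) (lam : Q.I → ℂ) {B : Type*} [Ring B] [Algebra ℂ B]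
    (g : Q.Gen → B) : Prop where
  ee : ∀ i j, g (Sum.inl i) * g (Sum.inl j) = if i = j then g (Sum.inl i) else 0
  sum : ∑ i, g (Sum.inl i) = 1
  xs : ∀ x, g (Sum.inr x) * g (Sum.inl (Q.dsrc x)) = g (Sum.inr x)
  tx : ∀ x, g (Sum.inl (Q.dtgt x)) * g (Sum.inr x) = g (Sum.inr x)
  rel : ∑ a, (g (Sum.inr (Sum.inl a)) * g (Sum.inr (Sum.inr a)) -
      g (Sum.inr (Sum.inr a)) * g (Sum.inr (Sum.inl a))) = ∑ i, lam i • g (Sum.inl i)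

variable {Q : ADEQuiver} {lam : Q.I → ℂ}

theorem sat_gen (Q : ADEQuiver) (lam : Q.I → ℂ) : Sat Q lam (Q.gen lam) := by
  constructor
  · intro i j
    have := RingQuot.mkAlgHom_rel ℂ (PathRel.vertex_mul (lam := lam) i j)
    rw [map_mul] at this
    rw [gen, gen, this]
    split_ifs <;> simp
  · have := RingQuot.mkAlgHom_rel ℂ (PathRel.sum_vertices (Q := Q) (lam := lam))
    simpa [gen] using this
  · intro x
    have := RingQuot.mkAlgHom_rel ℂ (PathRel.arr_src (lam := lam) x)
    simpa [gen] using this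
  · intro x
    have := RingQuot.mkAlgHom_rel ℂ (PathRel.arr_tgt (lam := lam) x)
    simpa [gen] using this
  · have := RingQuot.mkAlgHom_rel ℂ (PathRel.preproj (Q := Q) (lam := lam))
    simpa [gen] using this

section lift
variable {B : Type*} [Ring B] [Algebra ℂ B] {g : Q.Gen → B}

theorem Sat.lift_aux (hs : Sat Q lam g) : ∀ ⦃x y⦄, Q.PathRel lam x y →
    FreeAlgebra.lift ℂ g x = FreeAlgebra.lift ℂ g y := by
  intro x y h
  induction h with
  | vertex_mul i j =>
    rw [map_mul, FreeAlgebra.lift_ι_apply, FreeAlgebra.lift_ι_apply, hs.ee]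
    split_ifs <;> simp
  | sum_vertices => simpa using hs.sum
  | arr_src x => simpa using hs.xs x
  | arr_tgt x => simpa using hs.tx x
  | preproj => simpa using hs.rel

/-- the algebra map out of the deformed preprojective algebra -/
noncomputable def Sat.lift (hs : Sat Q lam g) : Q.Deformed lam →ₐ[ℂ] B :=
  RingQuot.liftAlgHom ℂ ⟨FreeAlgebra.lift ℂ g, hs.lift_aux⟩

@[simp] theorem Sat.lift_gen (hs : Sat Q lam g) (x : Q.Gen) : hs.lift (Q.gen lam x) = g x := by
  simp [Sat.lift, gen]

theorem Sat.lift_word (hs : Sat Q lam g) (w : List Q.Gen) :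
    hs.lift (Q.wordVal lam w) = (w.map g).prod := by
  rw [wordVal, map_list_prod, List.map_map]
  congr 2
  ext x
  simp

theorem Sat.idem (hs : Sat Q lam g) (i : Q.I) :
    g (Sum.inl i) * g (Sum.inl i) = g (Sum.inl i) := by simp [hs.ee]

/-- the sign of an arrow -/
def eps {Q : ADEQuiver} : Q.E ⊕ Q.E → ℂ := Sum.elim (fun _ => 1) (fun _ => -1)

theorem Sat.rel2 (hs : Sat Q lam g) :
    ∑ x : Q.E ⊕ Q.E, eps x • (g (Sum.inr x) * g (Sum.inr x.swap)) = ∑ i, lam i • g (Sum.inl i) := by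
  rw [← hs.rel, Fintype.sum_sum_type, ← Finset.sum_add_distrib]
  refine Finset.sum_congr rfl fun a _ => ?_
  simp [eps, sub_eq_add_neg]

end lift

/-- induction principle: words span -/
theorem span_words (Q : ADEQuiver) (lam : Q.I → ℂ) :
    Submodule.span ℂ (Set.range (Q.wordVal lam)) = ⊤ := by
  rw [eq_top_iff]
  rintro x -
  obtain ⟨y, rfl⟩ := RingQuot.mkAlgHom_surjective ℂ (Q.PathRel lam) x
  induction y using FreeAlgebra.induction with
  | grade0 r =>
    rw [AlgHom.commutes, Algebra.algebraMap_eq_smul_one]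
    exact Submodule.smul_mem _ _ (Submodule.subset_span ⟨[], by simp [wordVal]⟩)
  | grade1 x => exact Submodule.subset_span ⟨[x], by simp [wordVal, gen]⟩
  | mul a b ha hb =>
    rw [map_mul]
    have := Submodule.mul_mem_mul ha hb
    rw [Submodule.span_mul_span] at this
    refine Submodule.span_mono ?_ this
    rintro _ ⟨_, ⟨u, rfl⟩, _, ⟨v, rfl⟩, rfl⟩
    exact ⟨u ++ v, by simp [wordVal]⟩
  | add a b ha hb => rw [map_add]; exact add_mem ha hb

theorem wordVal_cons (x : Q.Gen) (w : List Q.Gen) :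
    Q.wordVal lam (x :: w) = Q.gen lam x * Q.wordVal lam w := by simp [wordVal]

theorem wordVal_append (u w : List Q.Gen) :
    Q.wordVal lam (u ++ w) = Q.wordVal lam u * Q.wordVal lam w := by simp [wordVal]

/-- a linear map intertwining generators intertwines the actions -/
theorem intertwine {M N : Type*} [AddCommGroup M] [Module ℂ M] [AddCommGroup N] [Module ℂ N]
    {gM : Q.Gen → Module.End ℂ M} {gN : Q.Gen → Module.End ℂ N}
    (hM : Sat Q lam gM) (hN : Sat Q lam gN) (f : M →ₗ[ℂ] N)
    (hf : ∀ x m, f (gM x m) = gN x (f m)) (a : Q.Deformed lam) (m : M) :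
    f (hM.lift a m) = hN.lift a (f m) := by
  have ha : a ∈ Submodule.span ℂ (Set.range (Q.wordVal lam)) := by
    rw [span_words]; trivial
  induction ha using Submodule.span_induction generalizing m with
  | mem x hx =>
    obtain ⟨w, rfl⟩ := hx
    rw [Sat.lift_word, Sat.lift_word]
    induction w with
    | nil => simp
    | cons x w ih => simp [hf, ih]
  | zero => simp
  | add x y _ _ hx hy => simp [hx, hy]
  | smul c x _ hx => simp [hx]

theorem Sat.map {B B' : Type*} [Ring B] [Algebra ℂ B] [Ring B'] [Algebra ℂ B'] {g : Q.Gen → B}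
    (h : Sat Q lam g) (f : B →ₐ[ℂ] B') : Sat Q lam (fun x => f (g x)) := by
  constructor
  · intro i j; rw [← map_mul, h.ee]; split_ifs <;> simp
  · rw [← map_sum, h.sum, map_one]
  · intro x; rw [← map_mul, h.xs]
  · intro x; rw [← map_mul, h.tx]
  · simp only [← map_mul, ← map_sub, ← map_smul, ← map_sum, h.rel]

/-- left regular action -/
theorem sat_left (Q : ADEQuiver) (lam : Q.I → ℂ) :
    Sat Q lam (fun x => Algebra.lmul ℂ (Q.Deformed lam) (Q.gen lam x)) :=
  (sat_gen Q lam).map _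

end DPA

namespace DPA
open scoped BigOperators

/-! dimension of Hom between corners -/
section corner
variable {M N : Type*} [AddCommGroup M] [Module ℂ M] [AddCommGroup N] [Module ℂ N]

/-- maps concentrated between the images of two endomorphisms -/
def Z (b : Module.End ℂ M) (a : Module.End ℂ N) : Submodule ℂ (M →ₗ[ℂ] N) where
  carrier := {φ | a ∘ₗ φ ∘ₗ b = φ}
  zero_mem' := by simp
  add_mem' := by
    intro x y hx hy
    simp only [Set.mem_ofPred_eq] at *
    rw [LinearMap.add_comp, LinearMap.comp_add, hx, hy]
  smul_mem' := by
    intro c x hx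
    simp only [Set.mem_ofPred_eq] at *
    rw [LinearMap.smul_comp, LinearMap.comp_smul, hx]

theorem mem_Z {b : Module.End ℂ M} {a : Module.End ℂ N} {φ : M →ₗ[ℂ] N} :
    φ ∈ Z b a ↔ a ∘ₗ φ ∘ₗ b = φ := Iff.rfl

theorem idem_range {b : Module.End ℂ M} (hb : b * b = b) (m : LinearMap.range b) :
    b m = m := by
  obtain ⟨_, m, rfl⟩ := m
  exact LinearMap.congr_fun hb m

theorem finrank_Z [FiniteDimensional ℂ M] [FiniteDimensional ℂ N]
    {b : Module.End ℂ M} {a : Module.End ℂ N} (hb : b * b = b) (ha : a * a = a) :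
    Module.finrank ℂ (Z b a) =
      Module.finrank ℂ (LinearMap.range b) * Module.finrank ℂ (LinearMap.range a) := by
  rw [← Module.finrank_linearMap ℂ ℂ]
  refine LinearEquiv.finrank_eq (LinearEquiv.ofLinearMap
    { toFun := fun φ => a.rangeRestrict ∘ₗ φ.1 ∘ₗ (LinearMap.range b).subtype
      map_add' := ?_
      map_smul' := ?_ }
    { toFun := fun f => ⟨(LinearMap.range a).subtype ∘ₗ f ∘ₗ b.rangeRestrict, ?_⟩
      map_add' := ?_
      map_smul' := ?_ } ?_ ?_)
  · intro x y; ext; simp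
  · intro c x; ext; simp
  · rw [mem_Z]
    ext m
    have h1 : b.rangeRestrict (b m) = b.rangeRestrict m := by
      ext; exact LinearMap.congr_fun hb m
    simp [h1, idem_range ha]
  · intro x y; ext; simp
  · intro c x; ext; simp
  · ext f m
    have h1 : b.rangeRestrict (m : M) = m := by
      ext; exact idem_range hb m
    simp [h1, idem_range ha]
  · ext ⟨f, hf⟩ m
    have := LinearMap.congr_fun hf m
    simpa using this

theorem trace_nondeg [FiniteDimensional ℂ M] [FiniteDimensional ℂ N] (u : M →ₗ[ℂ] N)
    (h : ∀ φ : N →ₗ[ℂ] M, LinearMap.trace ℂ N (u ∘ₗ φ) = 0) : u = 0 := by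
  ext m
  rw [LinearMap.zero_apply, ← Module.forall_dual_apply_eq_zero_iff ℂ]
  intro f
  have := h (f.smulRight m)
  have e : u ∘ₗ (f.smulRight m) = f.smulRight (u m) := by ext; simp
  rw [e, LinearMap.trace_smulRight] at this
  exact this
end corner

variable {Q : ADEQuiver} {lam : Q.I → ℂ}
variable {M N : Type*} [AddCommGroup M] [Module ℂ M] [AddCommGroup N] [Module ℂ N]

/-- dimension vector -/
noncomputable def dv (g : Q.Gen → Module.End ℂ M) (i : Q.I) : ℕ :=
  Module.finrank ℂ (LinearMap.range (g (Sum.inl i)))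

/-- vertexwise maps -/
def X (gM : Q.Gen → Module.End ℂ M) (gN : Q.Gen → Module.End ℂ N) :
    Submodule ℂ (M →ₗ[ℂ] N) where
  carrier := {φ | ∀ i, φ ∘ₗ gM (Sum.inl i) = gN (Sum.inl i) ∘ₗ φ}
  zero_mem' := by simp
  add_mem' := by
    intro x y hx hy i
    rw [LinearMap.add_comp, LinearMap.comp_add, hx, hy]
  smul_mem' := by
    intro c x hx i
    rw [LinearMap.smul_comp, LinearMap.comp_smul, hx]

/-- module maps -/
def K (gM : Q.Gen → Module.End ℂ M) (gN : Q.Gen → Module.End ℂ N) :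
    Submodule ℂ (M →ₗ[ℂ] N) where
  carrier := {φ | ∀ i, φ ∘ₗ gM i = gN i ∘ₗ φ}
  zero_mem' := by simp
  add_mem' := by
    intro x y hx hy i
    rw [LinearMap.add_comp, LinearMap.comp_add, hx, hy]
  smul_mem' := by
    intro c x hx i
    rw [LinearMap.smul_comp, LinearMap.comp_smul, hx]

/-- arrowwise maps -/
def Y (gM : Q.Gen → Module.End ℂ M) (gN : Q.Gen → Module.End ℂ N) :
    Submodule ℂ (Q.E ⊕ Q.E → M →ₗ[ℂ] N) :=
  Submodule.pi Set.univ fun x => Z (gM (Sum.inl (Q.dsrc x))) (gN (Sum.inl (Q.dtgt x)))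

theorem mem_Y {gM : Q.Gen → Module.End ℂ M} {gN : Q.Gen → Module.End ℂ N} {ψ} :
    ψ ∈ Y gM gN ↔ ∀ x, gN (Sum.inl (Q.dtgt x)) ∘ₗ ψ x ∘ₗ gM (Sum.inl (Q.dsrc x)) = ψ x := by
  simp [Y, mem_Z]

theorem finrank_Y [FiniteDimensional ℂ M] [FiniteDimensional ℂ N]
    {gM : Q.Gen → Module.End ℂ M} {gN : Q.Gen → Module.End ℂ N}
    (hM : Sat Q lam gM) (hN : Sat Q lam gN) :
    Module.finrank ℂ (Y gM gN) = ∑ x, dv gM (Q.dsrc x) * dv gN (Q.dtgt x) := by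
  have e : (Y gM gN) ≃ₗ[ℂ] (∀ x, Z (gM (Sum.inl (Q.dsrc x))) (gN (Sum.inl (Q.dtgt x)))) :=
    { toFun := fun ψ x => ⟨ψ.1 x, ψ.2 x trivial⟩
      invFun := fun ψ => ⟨fun x => ψ x, fun x _ => (ψ x).2⟩
      map_add' := fun _ _ => rfl
      map_smul' := fun _ _ => rfl
      left_inv := fun _ => rfl
      right_inv := fun _ => rfl }
  rw [e.finrank_eq, Module.finrank_pi_fintype]
  refine Finset.sum_congr rfl fun x _ => ?_
  rw [finrank_Z (hM.idem _) (hN.idem _)]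
  rfl

/-- the projection onto vertexwise maps -/
noncomputable def px (gM : Q.Gen → Module.End ℂ M) (gN : Q.Gen → Module.End ℂ N) (φ : M →ₗ[ℂ] N) :
    M →ₗ[ℂ] N := ∑ i, gN (Sum.inl i) ∘ₗ φ ∘ₗ gM (Sum.inl i)

section
variable {gM : Q.Gen → Module.End ℂ M} {gN : Q.Gen → Module.End ℂ N}

theorem Sat.ee_apply (hM : Sat Q lam gM) (i j : Q.I) (m : M) :
    gM (Sum.inl i) (gM (Sum.inl j) m) = if i = j then gM (Sum.inl i) m else 0 := by
  have := LinearMap.congr_fun (hM.ee i j) m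
  rw [Module.End.mul_apply] at this
  rw [this]; split_ifs <;> simp

theorem Sat.sum_apply (hM : Sat Q lam gM) (m : M) :
    ∑ i, gM (Sum.inl i) m = m := by
  have := LinearMap.congr_fun hM.sum m
  simpa [LinearMap.sum_apply] using this

theorem px_mem (hM : Sat Q lam gM) (hN : Sat Q lam gN) (φ : M →ₗ[ℂ] N) : px gM gN φ ∈ X gM gN := by
  intro i
  ext m
  simp [px, LinearMap.sum_apply, hM.ee_apply, hN.ee_apply, apply_ite]

theorem mem_X_apply {φ : M →ₗ[ℂ] N} (h : φ ∈ X gM gN) (i : Q.I) (m : M) :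
    φ (gM (Sum.inl i) m) = gN (Sum.inl i) (φ m) := LinearMap.congr_fun (h i) m

theorem finrank_X [FiniteDimensional ℂ M] [FiniteDimensional ℂ N]
    (hM : Sat Q lam gM) (hN : Sat Q lam gN) :
    Module.finrank ℂ (X gM gN) = ∑ i, dv gM i * dv gN i := by
  have e : (X gM gN) ≃ₗ[ℂ] (∀ i, Z (gM (Sum.inl i)) (gN (Sum.inl i))) :=
    { toFun := fun φ i => ⟨φ.1 ∘ₗ gM (Sum.inl i), by
        rw [mem_Z]; ext m
        simp [← mem_X_apply φ.2, hM.ee_apply]⟩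
      invFun := fun ψ => ⟨px gM gN (∑ i, (ψ i).1), px_mem hM hN _⟩
      map_add' := fun _ _ => by ext; simp
      map_smul' := fun _ _ => by ext; simp
      left_inv := by
        rintro ⟨φ, hφ⟩
        ext m
        simp [px, LinearMap.sum_apply, hM.ee_apply, ← mem_X_apply hφ, ← map_sum, hM.sum_apply,
          apply_ite]
      right_inv := by
        intro ψ
        ext i m
        have hψ : ∀ j m, (ψ j).1 m = gN (Sum.inl j) ((ψ j).1 (gM (Sum.inl j) m)) := fun j m =>
          (LinearMap.congr_fun (ψ j).2 m).symm
        have h2 : ∀ j m, (ψ j).1 (gM (Sum.inl i) m) = if i = j then (ψ j).1 m else 0 := by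
          intro j m
          rw [hψ, hM.ee_apply]
          by_cases hij : i = j
          · subst hij; simp [← hψ]
          · simp [hij, Ne.symm hij]
        have h3 : ∀ m, gN (Sum.inl i) ((ψ i).1 m) = (ψ i).1 m := by
          intro m; rw [hψ, hN.ee_apply]; simp
        simp [px, LinearMap.sum_apply, hM.ee_apply, h2, h3, apply_ite] }
  rw [e.finrank_eq, Module.finrank_pi_fintype]
  refine Finset.sum_congr rfl fun x _ => ?_
  rw [finrank_Z (hM.idem _) (hN.idem _)]
  rfl
end

/-- first differential -/
def d0 (gM : Q.Gen → Module.End ℂ M) (gN : Q.Gen → Module.End ℂ N) :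
    (M →ₗ[ℂ] N) →ₗ[ℂ] (Q.E ⊕ Q.E → M →ₗ[ℂ] N) where
  toFun φ x := φ ∘ₗ gM (Sum.inr x) - gN (Sum.inr x) ∘ₗ φ
  map_add' a b := by ext; simp; abel
  map_smul' c a := by ext; simp [smul_sub]

/-- second differential -/
noncomputable def d1 (gM : Q.Gen → Module.End ℂ M) (gN : Q.Gen → Module.End ℂ N) :
    (Q.E ⊕ Q.E → M →ₗ[ℂ] N) →ₗ[ℂ] (M →ₗ[ℂ] N) where
  toFun ψ := ∑ x, eps x • (ψ x ∘ₗ gM (Sum.inr x.swap) + gN (Sum.inr x) ∘ₗ ψ x.swap)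
  map_add' a b := by
    rw [← Finset.sum_add_distrib]
    refine Finset.sum_congr rfl fun x _ => ?_
    rw [← smul_add]
    congr 1
    ext; simp; abel
  map_smul' c a := by
    rw [RingHom.id_apply, Finset.smul_sum]
    refine Finset.sum_congr rfl fun x _ => ?_
    rw [smul_comm]
    congr 1
    ext; simp

end DPA

namespace DPA
set_option linter.unusedSimpArgs false
set_option linter.unusedVariables false
open scoped BigOperators

variable {Q : ADEQuiver} {lam : Q.I → ℂ}
variable {M N : Type*} [AddCommGroup M] [Module ℂ M] [AddCommGroup N] [Module ℂ N]
variable {gM : Q.Gen → Module.End ℂ M} {gN : Q.Gen → Module.End ℂ N}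

theorem dsrc_swap (x : Q.E ⊕ Q.E) : Q.dsrc x.swap = Q.dtgt x := by cases x <;> rfl
theorem dtgt_swap (x : Q.E ⊕ Q.E) : Q.dtgt x.swap = Q.dsrc x := by cases x <;> rfl
theorem eps_swap (x : Q.E ⊕ Q.E) : eps x.swap = - eps x := by cases x <;> simp [eps]
theorem eps_ne (x : Q.E ⊕ Q.E) : eps x ≠ 0 := by cases x <;> simp [eps]

theorem Sat.xs_apply (hM : Sat Q lam gM) (x) (m : M) :
    gM (Sum.inr x) (gM (Sum.inl (Q.dsrc x)) m) = gM (Sum.inr x) m := LinearMap.congr_fun (hM.xs x) m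
theorem Sat.tx_apply (hM : Sat Q lam gM) (x) (m : M) :
    gM (Sum.inl (Q.dtgt x)) (gM (Sum.inr x) m) = gM (Sum.inr x) m := LinearMap.congr_fun (hM.tx x) m

theorem d0_mem (hM : Sat Q lam gM) (hN : Sat Q lam gN) {φ : M →ₗ[ℂ] N} (h : φ ∈ X gM gN) :
    d0 gM gN φ ∈ Y gM gN := by
  rw [mem_Y]
  intro x
  ext m
  simp only [d0, LinearMap.coe_mk, AddHom.coe_mk, LinearMap.comp_apply, LinearMap.sub_apply,
    map_sub, hM.xs_apply, hN.tx_apply, ← mem_X_apply h, hM.tx_apply]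
  rw [mem_X_apply h, hN.xs_apply]

theorem Z_le_X (hM : Sat Q lam gM) (hN : Sat Q lam gN) (i : Q.I) :
    Z (gM (Sum.inl i)) (gN (Sum.inl i)) ≤ X gM gN := by
  intro φ hφ j
  rw [mem_Z] at hφ
  rw [← hφ]
  ext m
  simp only [LinearMap.comp_apply, hM.ee_apply, hN.ee_apply]
  by_cases h : i = j
  · subst h; simp
  · simp [h, Ne.symm h]

theorem d1_mem (hM : Sat Q lam gM) (hN : Sat Q lam gN) {ψ} (h : ψ ∈ Y gM gN) :
    d1 gM gN ψ ∈ X gM gN := by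
  rw [mem_Y] at h
  have h' : ∀ x m, gN (Sum.inl (Q.dtgt x)) (ψ x (gM (Sum.inl (Q.dsrc x)) m)) = ψ x m :=
    fun x m => LinearMap.congr_fun (h x) m
  have h1 : ∀ x m, gN (Sum.inl (Q.dtgt x)) (ψ x m) = ψ x m := fun x m => by
    rw [← h', hN.ee_apply]; simp
  have h2 : ∀ x m, ψ x (gM (Sum.inl (Q.dsrc x)) m) = ψ x m := fun x m => by
    rw [← h', hM.ee_apply, ← h' x m]; simp
  refine Submodule.sum_mem _ fun x _ => Submodule.smul_mem _ _ (Z_le_X hM hN (Q.dtgt x) ?_)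
  rw [mem_Z]
  ext m
  have a1 := hM.xs_apply x.swap m
  have a2 := h2 x.swap m
  rw [dsrc_swap] at a1 a2
  simp [a1, a2, h1, hN.tx_apply]

theorem d1_d0 (hM : Sat Q lam gM) (hN : Sat Q lam gN) {φ : M →ₗ[ℂ] N} (h : φ ∈ X gM gN) :
    d1 gM gN (d0 gM gN φ) = 0 := by
  have e : d1 gM gN (d0 gM gN φ) =
      φ ∘ₗ (∑ x : Q.E ⊕ Q.E, eps x • (gM (Sum.inr x) * gM (Sum.inr x.swap))) -
      (∑ x : Q.E ⊕ Q.E, eps x • (gN (Sum.inr x) * gN (Sum.inr x.swap))) ∘ₗ φ := by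
    ext m
    simp only [d1, d0, LinearMap.coe_mk, AddHom.coe_mk, LinearMap.comp_apply, LinearMap.sub_apply,
      LinearMap.sum_apply, LinearMap.smul_apply, map_sum, map_smul, Module.End.mul_apply,
      LinearMap.add_apply, map_sub, Sum.swap_swap]
    rw [← Finset.sum_sub_distrib]
    refine Finset.sum_congr rfl fun x _ => ?_
    rw [← smul_sub]
    congr 1
    abel
  rw [e, hM.rel2, hN.rel2]
  ext m
  simp [mem_X_apply h]

theorem X_inf_ker (hM : Sat Q lam gM) (hN : Sat Q lam gN) :
    X gM gN ⊓ LinearMap.ker (d0 gM gN) = K gM gN := by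
  ext φ
  constructor
  · rintro ⟨h1, h2⟩ (i | x)
    · exact h1 i
    · have := congr_fun (LinearMap.mem_ker.1 h2) x
      exact sub_eq_zero.1 this
  · intro h
    refine ⟨fun i => h _, LinearMap.mem_ker.2 ?_⟩
    funext x
    exact sub_eq_zero.2 (h _)

theorem adj [FiniteDimensional ℂ M] [FiniteDimensional ℂ N] (ψ) (φ : N →ₗ[ℂ] M) :
    LinearMap.trace ℂ N (d1 gM gN ψ ∘ₗ φ) =
      - ∑ x, eps x * LinearMap.trace ℂ N (ψ x ∘ₗ d0 gN gM φ x.swap) := by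
  have e : d1 gM gN ψ ∘ₗ φ = ∑ x, eps x • (ψ x ∘ₗ gM (Sum.inr x.swap) ∘ₗ φ) +
      ∑ x, eps x • (gN (Sum.inr x) ∘ₗ ψ x.swap ∘ₗ φ) := by
    rw [← Finset.sum_add_distrib]
    ext m
    simp [d1, LinearMap.sum_apply]
  have e2 : ∑ x, eps x • (gN (Sum.inr x) ∘ₗ ψ x.swap ∘ₗ φ) =
      ∑ x, - (eps x • (gN (Sum.inr x.swap) ∘ₗ ψ x ∘ₗ φ)) := by
    refine Fintype.sum_equiv (Equiv.sumComm _ _) _ _ fun x => ?_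
    change _ = - (eps x.swap • (gN (Sum.inr x.swap.swap) ∘ₗ ψ x.swap ∘ₗ φ))
    rw [eps_swap, Sum.swap_swap]; simp
  rw [e, e2, ← Finset.sum_add_distrib, map_sum, ← Finset.sum_neg_distrib]
  refine Finset.sum_congr rfl fun x _ => ?_
  have e3 : LinearMap.trace ℂ N (gN (Sum.inr x.swap) ∘ₗ ψ x ∘ₗ φ) =
      LinearMap.trace ℂ N (ψ x ∘ₗ φ ∘ₗ gN (Sum.inr x.swap)) := by
    rw [LinearMap.trace_comp_comm']; rfl
  simp only [map_add, map_neg, map_smul, e3, d0, LinearMap.coe_mk, AddHom.coe_mk,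
    LinearMap.comp_sub, map_sub, smul_eq_mul]
  ring

theorem nondegX [FiniteDimensional ℂ M] [FiniteDimensional ℂ N]
    (hM : Sat Q lam gM) (hN : Sat Q lam gN) {u : M →ₗ[ℂ] N} (hu : u ∈ X gM gN)
    (h : ∀ φ ∈ X gN gM, LinearMap.trace ℂ N (u ∘ₗ φ) = 0) : u = 0 := by
  refine trace_nondeg u fun φ => ?_
  rw [← h _ (px_mem hN hM φ)]
  have e : u ∘ₗ px gN gM φ = ∑ i, gN (Sum.inl i) ∘ₗ (u ∘ₗ φ ∘ₗ gN (Sum.inl i)) := by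
    ext m; simp [px, mem_X_apply hu]
  rw [e, map_sum]
  have e2 : u ∘ₗ φ = (u ∘ₗ φ) * ∑ i, gN (Sum.inl i) := by rw [hN.sum, mul_one]
  rw [e2, Finset.mul_sum, map_sum]
  refine Finset.sum_congr rfl fun i _ => ?_
  rw [LinearMap.trace_comp_comm']
  congr 1
  ext m
  simp [hN.ee_apply]

theorem nondegY [FiniteDimensional ℂ M] [FiniteDimensional ℂ N]
    (hM : Sat Q lam gM) (hN : Sat Q lam gN) {ψ' : Q.E ⊕ Q.E → N →ₗ[ℂ] M} (hu : ψ' ∈ Y gN gM)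
    (h : ∀ ψ ∈ Y gM gN, ∑ x, eps x * LinearMap.trace ℂ N (ψ x ∘ₗ ψ' x.swap) = 0) : ψ' = 0 := by
  classical
  rw [mem_Y] at hu
  have key : ∀ x : Q.E ⊕ Q.E, ψ' x.swap = 0 := by
    intro x
    refine trace_nondeg _ fun φ => ?_
    let φ' := gN (Sum.inl (Q.dtgt x)) ∘ₗ φ ∘ₗ gM (Sum.inl (Q.dsrc x))
    have h1 := h (Pi.single x φ') (by
      rw [mem_Y]
      intro y
      by_cases hy : y = x
      · subst hy
        ext m
        simp [φ', hM.ee_apply, hN.ee_apply]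
      · simp [hy])
    rw [Finset.sum_eq_single x] at h1
    · rw [Pi.single_eq_same, mul_eq_zero] at h1
      replace h1 := h1.resolve_left (eps_ne x)
      rw [LinearMap.trace_comp_comm', ← h1]
      have h2 := hu x.swap
      rw [dtgt_swap, dsrc_swap] at h2
      conv_lhs => rw [← h2]
      rw [← LinearMap.comp_assoc, ← LinearMap.comp_assoc, LinearMap.trace_comp_comm']
      rfl
    · intro y _ hy
      simp [hy]
    · simp
  funext x
  simpa using key x.swap

theorem rank_d1 [FiniteDimensional ℂ M] [FiniteDimensional ℂ N]
    (hM : Sat Q lam gM) (hN : Sat Q lam gN) :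
    Module.finrank ℂ ((Y gM gN).map (d1 gM gN)) + Module.finrank ℂ (K gN gM) =
      ∑ i, dv gM i * dv gN i := by
  set U := (Y gM gN).map (d1 gM gN) with hU
  let Θ : U →ₗ[ℂ] Module.Dual ℂ (X gN gM) :=
    { toFun := fun u => (LinearMap.trace ℂ N) ∘ₗ (LinearMap.llcomp ℂ N M N u.1) ∘ₗ (X gN gM).subtype
      map_add' := by intro x y; ext φ; simp
      map_smul' := by intro x y; ext φ; simp }
  have hΘ : ∀ u φ, Θ u φ = LinearMap.trace ℂ N (u.1 ∘ₗ φ.1) := fun _ _ => rfl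
  have inj : Function.Injective Θ := by
    rw [injective_iff_map_eq_zero]
    rintro ⟨u, hu⟩ h0
    have hX : u ∈ X gM gN := by
      obtain ⟨ψ, hψ, rfl⟩ := hu
      exact d1_mem hM hN hψ
    have := nondegX hM hN hX (fun φ hφ => by rw [← hΘ ⟨u, hu⟩ ⟨φ, hφ⟩, h0]; rfl)
    exact Subtype.ext this
  have h1 := Subspace.finrank_add_finrank_dualCoannihilator_eq (LinearMap.range Θ)
  rw [LinearMap.finrank_range_of_inj inj, finrank_X hN hM] at h1
  have h2 : Module.finrank ℂ ((LinearMap.range Θ).dualCoannihilator) =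
      Module.finrank ℂ (K gN gM) := by
    have e : ((LinearMap.range Θ).dualCoannihilator).map (X gN gM).subtype = K gN gM := by
      rw [← X_inf_ker hN hM]
      ext φ
      constructor
      · rintro ⟨φ, hφ, rfl⟩
        refine ⟨φ.2, LinearMap.mem_ker.2 ?_⟩
        apply nondegY hM hN (d0_mem hN hM φ.2)
        intro ψ hψ
        have h3 := (Submodule.mem_dualCoannihilator _).1 hφ _
          (LinearMap.mem_range_self Θ ⟨_, Submodule.mem_map_of_mem hψ⟩)
        rw [hΘ, adj] at h3
        exact neg_eq_zero.1 h3
      · rintro ⟨h3, h4⟩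
        refine ⟨⟨φ, h3⟩, ?_, rfl⟩
        rw [SetLike.mem_coe, Submodule.mem_dualCoannihilator]
        rintro _ ⟨⟨_, ψ, hψ, rfl⟩, rfl⟩
        rw [hΘ, adj, LinearMap.mem_ker.1 h4]
        simp
    rw [← e, Submodule.finrank_map_subtype_eq]
  rw [h2] at h1
  rw [h1]
  exact Finset.sum_congr rfl fun i _ => mul_comm _ _

theorem finrank_split {V W : Type*} [AddCommGroup V] [Module ℂ V] [AddCommGroup W] [Module ℂ W]
    [FiniteDimensional ℂ V] (S : Submodule ℂ V) (f : V →ₗ[ℂ] W) :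
    Module.finrank ℂ (S.map f) + Module.finrank ℂ (S ⊓ LinearMap.ker f : Submodule ℂ V) =
      Module.finrank ℂ S := by
  rw [← LinearMap.finrank_range_add_finrank_ker (f.domRestrict S)]
  congr 1
  · rw [LinearMap.range_domRestrict]
  · rw [LinearMap.ker_domRestrict, ← Submodule.finrank_map_subtype_eq,
      Submodule.map_comap_subtype]

theorem cb_aux [FiniteDimensional ℂ M] [FiniteDimensional ℂ N]
    (hM : Sat Q lam gM) (hN : Sat Q lam gN) :
    2 * ∑ i, dv gM i * dv gN i + Module.finrank ℂ
        (Y gM gN ⊓ LinearMap.ker (d1 gM gN) : Submodule ℂ _) =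
      ∑ x, dv gM (Q.dsrc x) * dv gN (Q.dtgt x) + Module.finrank ℂ (K gM gN) +
        Module.finrank ℂ (K gN gM) + Module.finrank ℂ ((X gM gN).map (d0 gM gN)) := by
  have h1 := rank_d1 hM hN
  have h2 := finrank_split (Y gM gN) (d1 gM gN)
  have h3 := finrank_split (X gM gN) (d0 gM gN)
  rw [X_inf_ker hM hN, finrank_X hM hN] at h3
  rw [finrank_Y hM hN] at h2
  omega

theorem cb_le [FiniteDimensional ℂ M] [FiniteDimensional ℂ N]
    (hM : Sat Q lam gM) (hN : Sat Q lam gN) :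
    2 * ∑ i, dv gM i * dv gN i ≤
      ∑ x, dv gM (Q.dsrc x) * dv gN (Q.dtgt x) + Module.finrank ℂ (K gM gN) +
        Module.finrank ℂ (K gN gM) := by
  have h1 := cb_aux hM hN
  have h2 : Module.finrank ℂ ((X gM gN).map (d0 gM gN)) ≤ Module.finrank ℂ
        (Y gM gN ⊓ LinearMap.ker (d1 gM gN) : Submodule ℂ _) := by
    apply Submodule.finrank_mono
    rintro _ ⟨φ, hφ, rfl⟩
    exact ⟨d0_mem hM hN hφ, d1_d0 hM hN hφ⟩
  omega

theorem sat_ext (hM : Sat Q lam gM) (hN : Sat Q lam gN) {ψ} (h : ψ ∈ Y gM gN)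
    (h1 : d1 gM gN ψ = 0) :
    Sat Q lam (fun x : Q.Gen => (LinearMap.prodMap (gN x) (gM x) +
      LinearMap.inl ℂ N M ∘ₗ (Sum.elim 0 ψ x : M →ₗ[ℂ] N) ∘ₗ LinearMap.snd ℂ N M :
        Module.End ℂ (N × M))) := by
  rw [mem_Y] at h
  have h' : ∀ x m, gN (Sum.inl (Q.dtgt x)) (ψ x (gM (Sum.inl (Q.dsrc x)) m)) = ψ x m :=
    fun x m => LinearMap.congr_fun (h x) m
  have h3 : ∀ x m, gN (Sum.inl (Q.dtgt x)) (ψ x m) = ψ x m := fun x m => by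
    rw [← h', hN.ee_apply]; simp
  have h2 : ∀ x m, ψ x (gM (Sum.inl (Q.dsrc x)) m) = ψ x m := fun x m => by
    rw [← h', hM.ee_apply, ← h' x m]; simp
  constructor
  · intro i j
    ext m <;> by_cases hij : i = j <;> simp [hM.ee_apply, hN.ee_apply, hij]
  · ext m <;> simp [LinearMap.sum_apply, Prod.fst_sum, Prod.snd_sum, hM.sum_apply, hN.sum_apply]
  · intro x
    ext m <;> simp [h2, hM.xs_apply, hN.xs_apply]
  · intro x
    ext m <;> simp [h3, hM.tx_apply, hN.tx_apply]
  · have r1 := hM.rel2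
    have r2 := hN.rel2
    have r3 := h1
    simp only [d1, LinearMap.coe_mk, AddHom.coe_mk] at r3
    rw [Fintype.sum_sum_type] at r1 r2 r3
    ext m
    · have := LinearMap.congr_fun r2 m
      simp [LinearMap.sum_apply, eps, Prod.fst_sum] at this ⊢
      rw [← this]; simp [Finset.sum_sub_distrib, sub_eq_add_neg]
    · simp [LinearMap.sum_apply, Prod.snd_sum]
    · have := LinearMap.congr_fun r3 m
      simp [LinearMap.sum_apply, eps, Prod.fst_sum] at this ⊢
      rw [← this]; simp [Finset.sum_sub_distrib, Finset.sum_add_distrib]; abel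
    · have := LinearMap.congr_fun r1 m
      simp [LinearMap.sum_apply, eps, Prod.snd_sum] at this ⊢
      rw [← this]; simp [Finset.sum_sub_distrib, sub_eq_add_neg]

/-- equality in the Crawley-Boevey formula for modules with a cyclic splitting -/
theorem cb_eq [FiniteDimensional ℂ M] [FiniteDimensional ℂ N]
    (hM : Sat Q lam gM) (hN : Sat Q lam gN) (c : M →ₗ[ℂ] Q.Deformed lam) (m0 : M)
    (hc : ∀ x m, c (gM x m) = Q.gen lam x * c m) (hm : ∀ m, hM.lift (c m) m0 = m) :
    2 * ∑ i, dv gM i * dv gN i =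
      ∑ x, dv gM (Q.dsrc x) * dv gN (Q.dtgt x) + Module.finrank ℂ (K gM gN) +
        Module.finrank ℂ (K gN gM) := by
  have h1 := cb_aux hM hN
  have h2 : (X gM gN).map (d0 gM gN) = 
        (Y gM gN ⊓ LinearMap.ker (d1 gM gN) : Submodule ℂ _) := by
    apply le_antisymm
    · rintro _ ⟨φ, hφ, rfl⟩
      exact ⟨d0_mem hM hN hφ, d1_d0 hM hN hφ⟩
    · rintro ψ ⟨hψ, hψ1⟩
      have hE := sat_ext hM hN hψ hψ1
      set gE := (fun x : Q.Gen => (LinearMap.prodMap (gN x) (gM x) +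
        LinearMap.inl ℂ N M ∘ₗ (Sum.elim 0 ψ x : M →ₗ[ℂ] N) ∘ₗ LinearMap.snd ℂ N M :
        Module.End ℂ (N × M))) with hgE
      have hsnd : ∀ a v, (hE.lift a v).2 = hM.lift a v.2 := by
        intro a v
        exact intertwine hE hM (LinearMap.snd ℂ N M) (by intro x m; simp [hgE]) a v
      let φ : M →ₗ[ℂ] N := LinearMap.fst ℂ N M ∘ₗ (LinearMap.applyₗ ((0, m0) : N × M)) ∘ₗ
        hE.lift.toLinearMap ∘ₗ c
      have hφ : ∀ m, φ m = (hE.lift (c m) (0, m0)).1 := fun _ => rfl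
      have hx : ∀ x m, φ (gM x m) = gN x (φ m) + (Sum.elim 0 ψ x : M →ₗ[ℂ] N) m := by
        intro x m
        rw [hφ, hc, map_mul, Sat.lift_gen, Module.End.mul_apply]
        have : (hE.lift (c m) (0, m0)).2 = m := by rw [hsnd, hm]
        simp [hgE, this, hφ]
      refine ⟨φ, fun i => ?_, ?_⟩
      · ext m; simpa using hx (Sum.inl i) m
      · funext x; ext m
        have := hx (Sum.inr x) m
        simp [d0, this]
  rw [h2] at h1
  omega

end DPA

namespace DPA
set_option linter.unusedSimpArgs false
set_option linter.unusedVariables false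
open scoped BigOperators

variable {Q : ADEQuiver} {lam : Q.I → ℂ}

theorem sumC_aux {R : Type*} [CommRing R] (s t : Q.E → Q.I) (u v : Q.I → R) :
    ∑ a, u (s a) * v (t a) =
    ∑ i, ∑ j, (((Finset.univ.filter fun e => s e = i ∧ t e = j).card : ℤ) : R) * (u i * v j) := by
  simp only [Finset.card_filter, Nat.cast_sum, Int.cast_sum, Finset.sum_mul]
  have : ∀ i, ∑ j, ∑ a, (((if s a = i ∧ t a = j then 1 else 0 : ℕ) : ℤ) : R) * (u i * v j) =
      ∑ a, ∑ j, (((if s a = i ∧ t a = j then 1 else 0 : ℕ) : ℤ) : R) * (u i * v j) :=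
    fun i => Finset.sum_comm
  simp only [this]
  rw [Finset.sum_comm]
  refine Finset.sum_congr rfl fun a _ => ?_
  rw [Finset.sum_eq_single (s a), Finset.sum_eq_single (t a)]
  · simp
  · intro j _ hj; simp [Ne.symm hj]
  · simp
  · intro j _ hj; simp [Ne.symm hj]
  · simp

theorem sumC {R : Type*} [CommRing R] (u v : Q.I → R) :
    ∑ x, u (Q.dsrc x) * v (Q.dtgt x) = ∑ i, ∑ j, (Q.C i j : R) * (u i * v j) := by
  rw [Fintype.sum_sum_type]
  change ∑ a, u (Q.src a) * v (Q.tgt a) + ∑ a, u (Q.tgt a) * v (Q.src a) = _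
  rw [sumC_aux Q.src Q.tgt, sumC_aux Q.tgt Q.src, ← Finset.sum_add_distrib]
  refine Finset.sum_congr rfl fun i _ => ?_
  rw [← Finset.sum_add_distrib]
  refine Finset.sum_congr rfl fun j _ => ?_
  rw [C, ← add_mul]
  push_cast
  simp only [and_comm]

theorem C_symm (i j : Q.I) : Q.C i j = Q.C j i := by
  rw [C, C, add_comm]

section fd
variable {M N : Type*} [AddCommGroup M] [Module ℂ M] [AddCommGroup N] [Module ℂ N]
variable {gM : Q.Gen → Module.End ℂ M} {gN : Q.Gen → Module.End ℂ N}

theorem trace_e [FiniteDimensional ℂ M] (hM : Sat Q lam gM) (i : Q.I) :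
    LinearMap.trace ℂ M (gM (Sum.inl i)) = dv gM i :=
  (LinearMap.IsIdempotentElem.isProj_range _ (hM.idem i)).trace

theorem dim_eq_sum [FiniteDimensional ℂ M] (hM : Sat Q lam gM) :
    Module.finrank ℂ M = ∑ i, dv gM i := by
  have h := congrArg (LinearMap.trace ℂ M) hM.sum
  rw [map_sum, LinearMap.trace_one] at h
  simp only [trace_e hM] at h
  exact_mod_cast h.symm

theorem lam_dv [FiniteDimensional ℂ M] (hM : Sat Q lam gM) :
    ∑ i, lam i * (dv gM i : ℂ) = 0 := by
  have h := congrArg (LinearMap.trace ℂ M) hM.rel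
  rw [map_sum, map_sum] at h
  simp only [map_smul, trace_e hM, smul_eq_mul] at h
  rw [← h]
  refine Finset.sum_eq_zero fun a _ => ?_
  rw [map_sub, LinearMap.trace_mul_comm, sub_self]

theorem K_le [FiniteDimensional ℂ N] (hM : Sat Q lam gM) (hN : Sat Q lam gN) (m0 : M)
    (h : ∀ m, ∃ a, hM.lift a m0 = m) : Module.finrank ℂ (K gM gN) ≤ Module.finrank ℂ N := by
  refine LinearMap.finrank_le_finrank_of_injective
    (f := (LinearMap.applyₗ m0) ∘ₗ (K gM gN).subtype) ?_
  rw [injective_iff_map_eq_zero]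
  rintro ⟨φ, hφ⟩ h0
  ext m
  obtain ⟨a, rfl⟩ := h m
  have h0' : φ m0 = 0 := h0
  have := intertwine hM hN φ (fun x m => LinearMap.congr_fun (hφ x) m) a m0
  simp [this, h0']
end fd

/-- the rho vector -/
theorem exists_rho (hADE : Q.IsADE) : ∃ ρ : Q.I → ℝ, ∀ i, 2 * ρ i - ∑ j, (Q.C i j : ℝ) * ρ j = 1 := by
  have h := hADE.2.isUnit
  rw [Matrix.isUnit_iff_isUnit_det] at h
  refine ⟨((2 : ℝ) • (1 : Matrix Q.I Q.I ℝ) - Q.C.map (Int.cast : ℤ → ℝ))⁻¹.mulVec (fun _ => 1), ?_⟩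
  intro i
  have h2 := congr_fun (congrArg (fun A => Matrix.mulVec A (fun _ => (1 : ℝ)))
    (Matrix.mul_nonsing_inv _ h)) i
  simp only [← Matrix.mulVec_mulVec, Matrix.one_mulVec] at h2
  rw [Matrix.sub_mulVec, Matrix.smul_mulVec, Matrix.one_mulVec] at h2
  exact h2

/-- the real Cartan form is nonnegative -/
theorem form_nonneg (hADE : Q.IsADE) (x : Q.I → ℝ) :
    0 ≤ 2 * ∑ i, x i * x i - ∑ i, ∑ j, (Q.C i j : ℝ) * (x i * x j) := by
  have h := hADE.2.posSemidef.dotProduct_mulVec_nonneg x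
  rw [Matrix.sub_mulVec, Matrix.smul_mulVec, Matrix.one_mulVec] at h
  refine h.trans (le_of_eq ?_)
  simp only [dotProduct, Matrix.mulVec, Pi.star_apply, star_trivial, Pi.sub_apply, Pi.smul_apply,
    smul_eq_mul, Matrix.map_apply, mul_sub, Finset.sum_sub_distrib, Finset.mul_sum]
  congr 1
  · exact Finset.sum_congr rfl fun i _ => by ring
  · exact Finset.sum_congr rfl fun i _ => Finset.sum_congr rfl fun j _ => by ring

theorem form_pos (hADE : Q.IsADE) (x : Q.I → ℝ) (hx : x ≠ 0) :
    0 < 2 * ∑ i, x i * x i - ∑ i, ∑ j, (Q.C i j : ℝ) * (x i * x j) := by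
  have h := hADE.2.dotProduct_mulVec_pos hx
  rw [Matrix.sub_mulVec, Matrix.smul_mulVec, Matrix.one_mulVec] at h
  refine h.trans_le (le_of_eq ?_)
  simp only [dotProduct, Matrix.mulVec, Pi.star_apply, star_trivial, Pi.sub_apply, Pi.smul_apply,
    smul_eq_mul, Matrix.map_apply, mul_sub, Finset.sum_sub_distrib, Finset.mul_sum]
  congr 1
  · exact Finset.sum_congr rfl fun i _ => by ring
  · exact Finset.sum_congr rfl fun i _ => Finset.sum_congr rfl fun j _ => by ring

/-- dimension bound for cyclic modules -/
theorem cyclic_bound (hADE : Q.IsADE) : ∃ D : ℕ, ∀ (lam : Q.I → ℂ) (M : Type) [AddCommGroup M]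
    [Module ℂ M] [FiniteDimensional ℂ M] (gM : Q.Gen → Module.End ℂ M) (hM : Sat Q lam gM) (m0 : M),
    (∀ m, ∃ a, hM.lift a m0 = m) → Module.finrank ℂ M ≤ D := by
  obtain ⟨ρ, hρ⟩ := exists_rho hADE
  refine ⟨⌊2 * ∑ i, ρ i⌋₊, ?_⟩
  intro lam M _ _ _ gM hM m0 h
  apply Nat.le_floor
  have h1 := cb_le hM hM
  have h2 := K_le hM hM m0 h
  have h3 := dim_eq_sum hM
  set m : Q.I → ℝ := fun i => (dv gM i : ℝ) with hm
  have h1' : 2 * ∑ i, m i * m i ≤ ∑ i, ∑ j, (Q.C i j : ℝ) * (m i * m j) + 2 * ∑ i, m i := by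
    rw [← sumC]
    have : 2 * ∑ i, dv gM i * dv gM i ≤
      ∑ x, dv gM (Q.dsrc x) * dv gM (Q.dtgt x) + 2 * ∑ i, dv gM i := by omega
    simp only [hm]
    exact_mod_cast this
  have h4 : (Module.finrank ℂ M : ℝ) = ∑ i, m i := by rw [h3]; push_cast; rfl
  rw [h4]
  have h5 := form_nonneg hADE (fun i => m i - 2 * ρ i)
  have e1 : ∀ u : Q.I → ℝ, ∑ i, ∑ j, (Q.C i j : ℝ) * (u i * ρ j) = ∑ i, u i * (2 * ρ i - 1) := by
    intro u
    refine Finset.sum_congr rfl fun i _ => ?_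
    have : ∑ j, (Q.C i j : ℝ) * (u i * ρ j) = u i * ∑ j, (Q.C i j : ℝ) * ρ j := by
      rw [Finset.mul_sum]; exact Finset.sum_congr rfl fun j _ => by ring
    rw [this]
    have := hρ i
    rw [show ∑ j, (Q.C i j : ℝ) * ρ j = 2 * ρ i - 1 by linarith]
  have e2 : ∑ i, ∑ j, (Q.C i j : ℝ) * (ρ i * m j) = ∑ i, m i * (2 * ρ i - 1) := by
    rw [← e1, Finset.sum_comm]
    refine Finset.sum_congr rfl fun i _ => Finset.sum_congr rfl fun j _ => ?_
    rw [C_symm j i]; ring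
  have e3 : ∑ i, ∑ j, (Q.C i j : ℝ) * ((m i - 2 * ρ i) * (m j - 2 * ρ j)) =
      ∑ i, ∑ j, (Q.C i j : ℝ) * (m i * m j) - 4 * ∑ i, m i * (2 * ρ i - 1) +
        4 * ∑ i, ρ i * (2 * ρ i - 1) := by
    rw [← e1 ρ]
    have : ∑ i, ∑ j, (Q.C i j : ℝ) * ((m i - 2 * ρ i) * (m j - 2 * ρ j)) =
      ∑ i, ∑ j, (Q.C i j : ℝ) * (m i * m j) - 2 * ∑ i, ∑ j, (Q.C i j : ℝ) * (ρ i * m j)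
      - 2 * ∑ i, ∑ j, (Q.C i j : ℝ) * (m i * ρ j) +
        4 * ∑ i, ∑ j, (Q.C i j : ℝ) * (ρ i * ρ j) := by
      simp only [Finset.mul_sum, ← Finset.sum_add_distrib, ← Finset.sum_sub_distrib]
      exact Finset.sum_congr rfl fun i _ => Finset.sum_congr rfl fun j _ => by ring
    rw [this, e2, e1 m]; ring
  have e4 : ∑ i, (m i - 2 * ρ i) * (m i - 2 * ρ i) =
      ∑ i, m i * m i - 4 * ∑ i, m i * ρ i + 4 * ∑ i, ρ i * ρ i := by
    simp only [Finset.mul_sum, ← Finset.sum_add_distrib, ← Finset.sum_sub_distrib]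
    exact Finset.sum_congr rfl fun i _ => by ring
  have e5 : ∀ u : Q.I → ℝ, ∑ i, u i * (2 * ρ i - 1) = 2 * ∑ i, u i * ρ i - ∑ i, u i := by
    intro u
    rw [Finset.mul_sum, ← Finset.sum_sub_distrib]
    exact Finset.sum_congr rfl fun i _ => by ring
  simp only [e3, e4, e5] at h5
  linarith

end DPA

namespace DPA
set_option linter.unusedSimpArgs false
set_option linter.unusedVariables false
open scoped BigOperators

variable {Q : ADEQuiver} {lam : Q.I → ℂ}

section transfer
variable {M N : Type*} [AddCommGroup M] [Module ℂ M] [AddCommGroup N] [Module ℂ N]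
variable {gM : Q.Gen → Module.End ℂ M} {gN : Q.Gen → Module.End ℂ N}

theorem Sat.of_surj (hM : Sat Q lam gM) (f : M →ₗ[ℂ] N) (hs : Function.Surjective f)
    (hf : ∀ x m, f (gM x m) = gN x (f m)) : Sat Q lam gN := by
  constructor
  · intro i j
    ext n; obtain ⟨m, rfl⟩ := hs n
    have := hM.ee_apply i j m
    rw [Module.End.mul_apply, ← hf, ← hf, this]
    split_ifs <;> simp [hf]
  · ext n; obtain ⟨m, rfl⟩ := hs n
    simp only [LinearMap.sum_apply, ← hf, ← map_sum, hM.sum_apply]; simp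
  · intro x; ext n; obtain ⟨m, rfl⟩ := hs n
    simp only [Module.End.mul_apply, ← hf, hM.xs_apply]
  · intro x; ext n; obtain ⟨m, rfl⟩ := hs n
    simp only [Module.End.mul_apply, ← hf, hM.tx_apply]
  · ext n; obtain ⟨m, rfl⟩ := hs n
    have := LinearMap.congr_fun hM.rel m
    simp only [LinearMap.sum_apply, LinearMap.sub_apply, LinearMap.smul_apply,
      Module.End.mul_apply] at this
    simp only [LinearMap.sum_apply, LinearMap.sub_apply, LinearMap.smul_apply,
      Module.End.mul_apply, ← hf, ← map_sum, ← map_sub, ← map_smul, this]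

theorem Sat.of_inj (hN : Sat Q lam gN) (f : M →ₗ[ℂ] N) (hs : Function.Injective f)
    (hf : ∀ x m, f (gM x m) = gN x (f m)) : Sat Q lam gM := by
  constructor
  · intro i j
    ext m; apply hs
    have := hN.ee_apply i j (f m)
    rw [Module.End.mul_apply, hf, hf, this]
    split_ifs <;> simp [hf]
  · ext m; apply hs
    simp only [LinearMap.sum_apply, hf, map_sum, hN.sum_apply]; simp
  · intro x; ext m; apply hs
    simp only [Module.End.mul_apply, hf, hN.xs_apply]
  · intro x; ext m; apply hs
    simp only [Module.End.mul_apply, hf, hN.tx_apply]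
  · ext m; apply hs
    have := LinearMap.congr_fun hN.rel (f m)
    simp only [LinearMap.sum_apply, LinearMap.sub_apply, LinearMap.smul_apply,
      Module.End.mul_apply] at this
    simp only [LinearMap.sum_apply, LinearMap.sub_apply, LinearMap.smul_apply,
      Module.End.mul_apply, hf, map_sum, map_sub, map_smul, this]
end transfer

@[simp] theorem ac_nil : Q.arrowCount [] = 0 := rfl
@[simp] theorem ac_inl (i : Q.I) (w : List Q.Gen) :
    Q.arrowCount (Sum.inl i :: w) = Q.arrowCount w := by simp [arrowCount]
@[simp] theorem ac_inr (x : Q.E ⊕ Q.E) (w : List Q.Gen) :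
    Q.arrowCount (Sum.inr x :: w) = Q.arrowCount w + 1 := by
  rw [arrowCount, List.countP_cons_of_pos (by rfl)]; rfl
@[simp] theorem ac_append (u w : List Q.Gen) :
    Q.arrowCount (u ++ w) = Q.arrowCount u + Q.arrowCount w := by simp [arrowCount]

theorem ac_cons_le (g : Q.Gen) (w : List Q.Gen) : Q.arrowCount w ≤ Q.arrowCount (g :: w) := by
  cases g <;> simp

theorem exists_suffix (w : List Q.Gen) (k : ℕ) (hk : k ≤ Q.arrowCount w) :
    ∃ u v, w = u ++ v ∧ Q.arrowCount v = k := by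
  induction w with
  | nil => exact ⟨[], [], rfl, by simp at hk; simp [hk]⟩
  | cons g w ih =>
    by_cases h : k ≤ Q.arrowCount w
    · obtain ⟨u, v, rfl, hv⟩ := ih h
      exact ⟨g :: u, v, rfl, hv⟩
    · refine ⟨[], g :: w, rfl, ?_⟩
      rcases g with i | x
      · simp at hk ⊢; omega
      · simp at hk ⊢; omega

/-- span of the reduced words -/
noncomputable def V (Q : ADEQuiver) (lam : Q.I → ℂ) : ℕ → Submodule ℂ (Q.Deformed lam)
  | 0 => Submodule.span ℂ (Set.range fun i => Q.gen lam (Sum.inl i))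
  | n + 1 => V Q lam n ⊔ ⨆ x : Q.E ⊕ Q.E, (V Q lam n).map (Algebra.lmul ℂ _ (Q.gen lam (Sum.inr x)))

theorem V_fg (n : ℕ) : (V Q lam n).FG := by
  induction n with
  | zero => exact Submodule.fg_span (Set.finite_range _)
  | succ n ih =>
    refine Submodule.FG.sup ih ?_
    exact Submodule.fg_iSup _ fun x => ih.map _

theorem V_e (n : ℕ) (i : Q.I) (v) (hv : v ∈ V Q lam n) : Q.gen lam (Sum.inl i) * v ∈ V Q lam n := by
  have h : V Q lam n ≤ (V Q lam n).comap (Algebra.lmul ℂ _ (Q.gen lam (Sum.inl i))) := by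
    induction n generalizing v with
    | zero =>
      rw [V, Submodule.span_le]
      rintro _ ⟨j, rfl⟩
      simp only [SetLike.mem_coe, Submodule.mem_comap, Algebra.coe_lmul_eq_mul, LinearMap.mul_apply',
        (sat_gen Q lam).ee]
      split_ifs
      · exact Submodule.subset_span ⟨i, rfl⟩
      · exact zero_mem _
    | succ n ih =>
      rw [V, sup_le_iff]
      constructor
      · intro v hv
        exact Submodule.mem_sup_left (ih v hv hv)
      · refine iSup_le fun x => ?_
        rintro _ ⟨v, hv, rfl⟩
        simp only [Submodule.mem_comap, Algebra.coe_lmul_eq_mul, LinearMap.mul_apply']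
        rw [← (sat_gen Q lam).tx, ← mul_assoc, ← mul_assoc, (sat_gen Q lam).ee]
        split_ifs with hi
        · rw [hi, (sat_gen Q lam).tx]
          refine Submodule.mem_sup_right (Submodule.mem_iSup_of_mem x ⟨v, hv, rfl⟩)
        · simp
  exact h hv

theorem V_mono : Monotone (V Q lam) := monotone_nat_of_le_succ fun n => le_sup_left

theorem word_mem_V (w : List Q.Gen) : Q.wordVal lam w ∈ V Q lam (Q.arrowCount w) := by
  induction w with
  | nil =>
    rw [wordVal, List.map_nil, List.prod_nil, ← (sat_gen Q lam).sum]
    exact Submodule.sum_mem _ fun i _ => Submodule.subset_span ⟨i, rfl⟩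
  | cons g w ih =>
    rw [wordVal_cons]
    rcases g with i | x
    · simpa using V_e _ i _ ih
    · rw [ac_inr, V]
      exact Submodule.mem_sup_right (Submodule.mem_iSup_of_mem x ⟨_, ih, rfl⟩)

theorem filt_le_V (n : ℕ) : Q.filt lam n ≤ V Q lam n := by
  rw [filt, Submodule.span_le]
  rintro _ ⟨w, hw, rfl⟩
  exact V_mono hw (word_mem_V w)

instance filt_fd (n : ℕ) : FiniteDimensional ℂ (Q.filt lam n) := by
  have : FiniteDimensional ℂ (V Q lam n) := Module.Finite.iff_fg.2 (V_fg n)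
  exact Submodule.finiteDimensional_of_le (filt_le_V n)

/-- words with many arrows -/
def Lsub (Q : ADEQuiver) (lam : Q.I → ℂ) (n : ℕ) : Submodule ℂ (Q.Deformed lam) :=
  Submodule.span ℂ {x | ∃ w : List Q.Gen, n ≤ Q.arrowCount w ∧ x = Q.wordVal lam w}

theorem Lsub_anti (n : ℕ) : Lsub Q lam (n + 1) ≤ Lsub Q lam n :=
  Submodule.span_mono (by rintro _ ⟨w, hw, rfl⟩; exact ⟨w, by omega, rfl⟩)

theorem Lsub_stable (n : ℕ) (g : Q.Gen) :
    Lsub Q lam n ≤ (Lsub Q lam n).comap (Algebra.lmul ℂ _ (Q.gen lam g)) := by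
  rw [Lsub, Submodule.span_le]
  rintro _ ⟨w, hw, rfl⟩
  exact Submodule.subset_span ⟨g :: w, hw.trans (ac_cons_le _ _), by simp [wordVal]⟩

theorem filt_sup_Lsub (n : ℕ) : Q.filt lam n ⊔ Lsub Q lam n = ⊤ := by
  rw [eq_top_iff, ← span_words, Submodule.span_le]
  rintro _ ⟨w, rfl⟩
  rcases le_total (Q.arrowCount w) n with h | h
  · exact Submodule.mem_sup_left (Submodule.subset_span ⟨w, h, rfl⟩)
  · exact Submodule.mem_sup_right (Submodule.subset_span ⟨w, h, rfl⟩)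

instance quot_fd (n : ℕ) : FiniteDimensional ℂ (Q.Deformed lam ⧸ Lsub Q lam n) := by
  refine Module.Finite.of_surjective ((Lsub Q lam n).mkQ ∘ₗ (Q.filt lam n).subtype) ?_
  intro y
  obtain ⟨y, rfl⟩ := Submodule.mkQ_surjective _ y
  have hy : y ∈ Q.filt lam n ⊔ Lsub Q lam n := by rw [filt_sup_Lsub]; trivial
  obtain ⟨a, ha, b, hb, rfl⟩ := Submodule.mem_sup.1 hy
  refine ⟨⟨a, ha⟩, ?_⟩
  have hb' : (Lsub Q lam n).mkQ b = 0 := by simpa using hb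
  rw [map_add, hb', add_zero]; rfl

theorem left_lift (a b : Q.Deformed lam) : (sat_left Q lam).lift a b = a * b := by
  have ha : a ∈ Submodule.span ℂ (Set.range (Q.wordVal lam)) := by
    rw [span_words]; trivial
  induction ha using Submodule.span_induction generalizing b with
  | mem x hx =>
    obtain ⟨w, rfl⟩ := hx
    rw [Sat.lift_word]
    induction w with
    | nil => simp [wordVal]
    | cons x w ih =>
      rw [List.map_cons, List.prod_cons, Module.End.mul_apply, ih, wordVal_cons, mul_assoc]; rfl
  | zero => simp
  | add x y _ _ hx hy => rw [map_add, LinearMap.add_apply, hx, hy, add_mul]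
  | smul c x _ hx => rw [map_smul, LinearMap.smul_apply, hx, smul_mul_assoc]

theorem quot_bound (hADE : Q.IsADE) : ∃ D : ℕ, ∀ n,
    Module.finrank ℂ (Q.Deformed lam ⧸ Lsub Q lam n) ≤ D := by
  obtain ⟨D, hD⟩ := cyclic_bound hADE
  refine ⟨D, fun n => ?_⟩
  let gM : Q.Gen → Module.End ℂ (Q.Deformed lam ⧸ Lsub Q lam n) := fun g =>
    (Lsub Q lam n).mapQ (Lsub Q lam n) (Algebra.lmul ℂ _ (Q.gen lam g)) (Lsub_stable n g)
  have hf : ∀ x m, (Lsub Q lam n).mkQ (Algebra.lmul ℂ _ (Q.gen lam x) m) =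
    gM x ((Lsub Q lam n).mkQ m) := fun x m => rfl
  have hM : Sat Q lam gM := (sat_left Q lam).of_surj (Lsub Q lam n).mkQ
    (Submodule.mkQ_surjective _) hf
  refine hD lam _ gM hM ((Lsub Q lam n).mkQ 1) fun m => ?_
  obtain ⟨m, rfl⟩ := Submodule.mkQ_surjective _ m
  refine ⟨m, ?_⟩
  rw [← intertwine (sat_left Q lam) hM (Lsub Q lam n).mkQ hf, left_lift, mul_one]

theorem exists_stable (hADE : Q.IsADE) : ∃ n, Lsub Q lam n = Lsub Q lam (n + 1) := by
  obtain ⟨D, hD⟩ := quot_bound (lam := lam) hADE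
  by_contra! hne
  have key : ∀ n, n ≤ Module.finrank ℂ (Q.Deformed lam ⧸ Lsub Q lam n) := by
    intro n
    induction n with
    | zero => simp
    | succ n ih =>
      refine Nat.succ_le_of_lt (ih.trans_lt ?_)
      let f := Submodule.factor (Lsub_anti (Q := Q) (lam := lam) n)
      have hs : Function.Surjective f := Submodule.factor_surjective _
      by_contra! hle
      have heq := le_antisymm hle (LinearMap.finrank_le_finrank_of_surjective hs)
      have hinj := (LinearMap.injective_iff_surjective_of_finrank_eq_finrank heq).2 hs
      apply hne n
      refine le_antisymm (fun x hx => ?_) (Lsub_anti n)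
      have : f ((Lsub Q lam (n + 1)).mkQ x) = 0 := by
        simpa [f] using hx
      have := hinj (this.trans (map_zero f).symm)
      simpa using this
  have := (key (D + 1)).trans (hD (D + 1))
  omega

/-- the family of generators with a formal degree variable -/
noncomputable def zgen {B : Type*} [Ring B] [Algebra ℂ B] (g : Q.Gen → B) : Q.Gen → Polynomial B :=
  Sum.elim (fun i => Polynomial.C (g (Sum.inl i)))
    (fun x => Polynomial.C (g (Sum.inr x)) * Polynomial.X)

theorem zgen_word {B : Type*} [Ring B] [Algebra ℂ B] (g : Q.Gen → B) (w : List Q.Gen) :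
    (w.map (zgen g)).prod = Polynomial.C (w.map g).prod * Polynomial.X ^ (Q.arrowCount w) := by
  induction w with
  | nil => simp
  | cons x w ih =>
    rw [List.map_cons, List.prod_cons, ih, List.map_cons, List.prod_cons]
    rcases x with i | x
    · simp [zgen, mul_assoc]
    · simp only [zgen, Sum.elim_inr, map_mul, ac_inr, pow_succ']
      rw [mul_assoc, mul_assoc, ← mul_assoc Polynomial.X, Polynomial.X_mul_C, mul_assoc]

theorem sat_zgen {B : Type*} [Ring B] [Algebra ℂ B] {g : Q.Gen → B} (h : Sat Q 0 g) :
    Sat Q 0 (zgen g) := by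
  constructor
  · intro i j
    simp only [zgen, Sum.elim_inl, ← map_mul, h.ee]; split_ifs <;> simp
  · simp only [zgen, Sum.elim_inl, ← map_sum, h.sum, map_one]
  · intro x
    simp only [zgen, Sum.elim_inl, Sum.elim_inr]
    rw [mul_assoc, Polynomial.X_mul_C, ← mul_assoc, ← map_mul, h.xs]
  · intro x
    simp only [zgen, Sum.elim_inl, Sum.elim_inr]
    rw [← mul_assoc, ← map_mul, h.tx]
  · have e : ∀ x y : Q.E ⊕ Q.E, zgen g (Sum.inr x) * zgen g (Sum.inr y) =
        Polynomial.C (g (Sum.inr x) * g (Sum.inr y)) * Polynomial.X ^ 2 := by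
      intro x y
      simpa using zgen_word g [Sum.inr x, Sum.inr y]
    simp only [e, ← sub_mul, ← map_sub, ← Finset.sum_mul, ← map_sum, h.rel]
    simp

/-- degree projection on the preprojective algebra -/
noncomputable def deg (Q : ADEQuiver) (n : ℕ) : Q.Deformed 0 →ₗ[ℂ] Q.Deformed 0 where
  toFun a := ((sat_zgen (sat_gen Q 0)).lift a).coeff n
  map_add' := by simp
  map_smul' := by simp

theorem deg_word (n : ℕ) (w : List Q.Gen) :
    deg Q n (Q.wordVal 0 w) = if Q.arrowCount w = n then Q.wordVal 0 w else 0 := by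
  change ((sat_zgen (sat_gen Q 0)).lift _).coeff n = _
  rw [Sat.lift_word, zgen_word, Polynomial.coeff_C_mul, Polynomial.coeff_X_pow]
  by_cases h : Q.arrowCount w = n
  · simp [h, wordVal]
  · simp [h, Ne.symm h]

/-- long words vanish in the preprojective algebra -/
theorem long_zero (hADE : Q.IsADE) : ∃ n, ∀ w, n ≤ Q.arrowCount w → Q.wordVal 0 w = 0 := by
  obtain ⟨n, hn⟩ := exists_stable (lam := 0) hADE
  refine ⟨n, fun w hw => ?_⟩
  obtain ⟨u, v, rfl, hv⟩ := exists_suffix w n hw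
  have hv' : Q.wordVal 0 v ∈ Lsub Q 0 (n + 1) := by
    rw [← hn]; exact Submodule.subset_span ⟨v, hv.ge, rfl⟩
  have : Lsub Q 0 (n + 1) ≤ LinearMap.ker (deg Q n) := by
    rw [Lsub, Submodule.span_le]
    rintro _ ⟨w, hw, rfl⟩
    simp only [SetLike.mem_coe, LinearMap.mem_ker, deg_word]
    rw [if_neg (by omega)]
  have h2 := LinearMap.mem_ker.1 (this hv')
  rw [deg_word, if_pos hv] at h2
  rw [wordVal_append, h2, mul_zero]

theorem filt_top (hADE : Q.IsADE) : ∃ n, Q.filt 0 n = ⊤ := by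
  obtain ⟨n, hn⟩ := long_zero hADE
  refine ⟨n, ?_⟩
  rw [← filt_sup_Lsub (lam := 0) n, eq_comm, sup_eq_left, Lsub, Submodule.span_le]
  rintro _ ⟨w, hw, rfl⟩
  rw [hn w hw]
  exact zero_mem _

theorem fd_zero (hADE : Q.IsADE) : FiniteDimensional ℂ (Q.Deformed 0) := by
  obtain ⟨n, hn⟩ := filt_top hADE
  have : FiniteDimensional ℂ (Q.filt 0 n) := inferInstance
  rw [hn] at this
  exact Module.Finite.of_surjective (⊤ : Submodule ℂ (Q.Deformed 0)).subtype (fun x => ⟨⟨x, trivial⟩, rfl⟩)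

end DPA

namespace DPA
set_option linter.unusedSimpArgs false
set_option linter.unusedVariables false
open scoped BigOperators

theorem ringquot_ideal {A : Type*} [Ring A] [Algebra ℂ A] (r : A → A → Prop) (J : Submodule ℂ A)
    (hl : ∀ a, ∀ f ∈ J, a * f ∈ J) (hr : ∀ a, ∀ f ∈ J, f * a ∈ J) (hJ : ∀ x y, r x y → x - y ∈ J)
    (f : A) (hf : RingQuot.mkAlgHom ℂ r f = 0) : f ∈ J := by
  have h1 : RingQuot.mkRingHom r f = RingQuot.mkRingHom r 0 := by
    have := RingHom.congr_fun (RingQuot.mkAlgHom_coe ℂ r) f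
    rw [map_zero, ← this]; exact hf
  have h2 : Quot.mk (RingQuot.Rel r) f = Quot.mk (RingQuot.Rel r) 0 := by
    simpa [RingQuot.mkRingHom_def] using h1
  have h3 := Quot.eqvGen_exact h2
  have key : ∀ x y, Relation.EqvGen (RingQuot.Rel r) x y → x - y ∈ J := by
    intro x y h
    induction h with
    | rel x y h =>
      induction h with
      | of h => exact hJ _ _ h
      | add_left _ ih => simpa using ih
      | mul_left _ ih => rw [← sub_mul]; exact hr _ _ ih
      | mul_right _ ih => rw [← mul_sub]; exact hl _ _ ih
    | refl => simp
    | symm x y _ ih => rw [← neg_sub]; exact neg_mem ih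
    | trans x y z _ _ h1 h2 => rw [← sub_add_sub_cancel x y z]; exact add_mem h1 h2
  simpa using key _ _ h3

theorem free_span (Y : Type*) :
    Submodule.span ℂ (Set.range fun w : List Y => (w.map (FreeAlgebra.ι ℂ)).prod) = ⊤ := by
  rw [eq_top_iff]
  rintro y -
  induction y using FreeAlgebra.induction with
  | grade0 r =>
    rw [Algebra.algebraMap_eq_smul_one]
    exact Submodule.smul_mem _ _ (Submodule.subset_span ⟨[], by simp⟩)
  | grade1 x => exact Submodule.subset_span ⟨[x], by simp⟩
  | mul a b ha hb =>
    have := Submodule.mul_mem_mul ha hb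
    rw [Submodule.span_mul_span] at this
    refine Submodule.span_mono ?_ this
    rintro _ ⟨_, ⟨u, rfl⟩, _, ⟨v, rfl⟩, rfl⟩
    exact ⟨u ++ v, by simp⟩
  | add a b ha hb => exact add_mem ha hb

theorem lift_free_word {Y B : Type*} [Ring B] [Algebra ℂ B] (g : Y → B) (w : List Y) :
    FreeAlgebra.lift ℂ g (w.map (FreeAlgebra.ι ℂ)).prod = (w.map g).prod := by
  rw [map_list_prod, List.map_map]
  congr 2
  ext x; simp

variable {Q : ADEQuiver} {lam : Q.I → ℂ}

/-- the relations of the path algebra -/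
structure PreSat (Q : ADEQuiver) {B : Type*} [Ring B] [Algebra ℂ B]
    (g : Q.Gen → B) : Prop where
  ee : ∀ i j, g (Sum.inl i) * g (Sum.inl j) = if i = j then g (Sum.inl i) else 0
  sum : ∑ i, g (Sum.inl i) = 1
  xs : ∀ x, g (Sum.inr x) * g (Sum.inl (Q.dsrc x)) = g (Sum.inr x)
  tx : ∀ x, g (Sum.inl (Q.dtgt x)) * g (Sum.inr x) = g (Sum.inr x)

section red
variable {B : Type*} [Ring B] [Algebra ℂ B] {g : Q.Gen → B}

theorem Sat.pre (h : Sat Q lam g) : PreSat Q g := ⟨h.ee, h.sum, h.xs, h.tx⟩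

/-- the preprojective element -/
def mu (g : Q.Gen → B) : B := ∑ a, (g (Sum.inr (Sum.inl a)) * g (Sum.inr (Sum.inr a)) -
      g (Sum.inr (Sum.inr a)) * g (Sum.inr (Sum.inl a)))

theorem PreSat.zgen (h : PreSat Q g) : PreSat Q (zgen g) := by
  constructor
  · intro i j
    simp only [DPA.zgen, Sum.elim_inl, ← map_mul, h.ee]; split_ifs <;> simp
  · simp only [DPA.zgen, Sum.elim_inl, ← map_sum, h.sum, map_one]
  · intro x
    simp only [DPA.zgen, Sum.elim_inl, Sum.elim_inr]
    rw [mul_assoc, Polynomial.X_mul_C, ← mul_assoc, ← map_mul, h.xs]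
  · intro x
    simp only [DPA.zgen, Sum.elim_inl, Sum.elim_inr]
    rw [← mul_assoc, ← map_mul, h.tx]

theorem mu_zgen (g : Q.Gen → B) : mu (zgen g) = Polynomial.C (mu g) * Polynomial.X ^ 2 := by
  have e : ∀ x y : Q.E ⊕ Q.E, zgen g (Sum.inr x) * zgen g (Sum.inr y) =
        Polynomial.C (g (Sum.inr x) * g (Sum.inr y)) * Polynomial.X ^ 2 := by
      intro x y
      simpa using zgen_word g [Sum.inr x, Sum.inr y]
  simp only [mu, e, ← sub_mul, ← map_sub, ← Finset.sum_mul, ← map_sum]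

/-- an ideal-like submodule containing all consequences of the relations -/
theorem consequence (h : PreSat Q g) (J : Submodule ℂ B)
    (hl : ∀ a : FreeAlgebra ℂ Q.Gen, ∀ f ∈ J, FreeAlgebra.lift ℂ g a * f ∈ J)
    (hr : ∀ a : FreeAlgebra ℂ Q.Gen, ∀ f ∈ J, f * FreeAlgebra.lift ℂ g a ∈ J)
    (hJ : mu g - ∑ i, lam i • g (Sum.inl i) ∈ J)
    (f : FreeAlgebra ℂ Q.Gen) (hf : RingQuot.mkAlgHom ℂ (Q.PathRel lam) f = 0) :
    FreeAlgebra.lift ℂ g f ∈ J := by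
  have := ringquot_ideal (Q.PathRel lam) (J.comap (FreeAlgebra.lift ℂ g).toLinearMap)
    (by intro a f hf; simpa using hl a _ hf) (by intro a f hf; simpa using hr a _ hf) ?_ f hf
  · simpa using this
  · intro x y hxy
    simp only [Submodule.mem_comap, AlgHom.toLinearMap_apply, map_sub]
    induction hxy with
    | vertex_mul i j =>
      rw [map_mul, FreeAlgebra.lift_ι_apply, FreeAlgebra.lift_ι_apply, h.ee]
      split_ifs <;> simp
    | sum_vertices => simp [h.sum]
    | arr_src x => simp [h.xs]
    | arr_tgt x => simp [h.tx]
    | preproj => simpa [mu] using hJ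

variable (Pc : Submonoid B)

/-- filtration with scalars -/
def F (g : Q.Gen → B) (n : ℕ) : Submodule ℂ B :=
  Submodule.span ℂ {x | ∃ p ∈ Pc, ∃ w : List Q.Gen, Q.arrowCount w ≤ n ∧ x = p * (w.map g).prod}

/-- shifted filtration -/
def G (g : Q.Gen → B) : ℕ → Submodule ℂ B
  | 0 => ⊥
  | n + 1 => F Pc g n

variable {Pc}

theorem F_mul (hc : ∀ p ∈ Pc, ∀ b : B, b * p = p * b) {i j : ℕ} {a b : B} (ha : a ∈ F Pc g i) (hb : b ∈ F Pc g j) :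
    a * b ∈ F Pc g (i + j) := by
  have := Submodule.mul_mem_mul ha hb
  rw [F, F, Submodule.span_mul_span] at this
  refine Submodule.span_mono ?_ this
  rintro _ ⟨_, ⟨p, hp, u, hu, rfl⟩, _, ⟨q, hq, v, hv, rfl⟩, rfl⟩
  refine ⟨p * q, mul_mem hp hq, u ++ v, by simp; omega, ?_⟩
  simp only [List.map_append, List.prod_append]
  rw [mul_assoc, ← mul_assoc _ q, hc q hq]
  simp only [mul_assoc]

theorem F_G (hc : ∀ p ∈ Pc, ∀ b : B, b * p = p * b) {i j : ℕ} {a b : B} (ha : a ∈ F Pc g i) (hb : b ∈ G Pc g j) :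
    a * b ∈ G Pc g (i + j) := by
  cases j with
  | zero => simp only [G, Submodule.mem_bot] at hb; simp [hb]
  | succ j => exact F_mul hc ha hb

theorem G_F (hc : ∀ p ∈ Pc, ∀ b : B, b * p = p * b) {i j : ℕ} {a b : B} (ha : a ∈ G Pc g i) (hb : b ∈ F Pc g j) :
    a * b ∈ G Pc g (i + j) := by
  cases i with
  | zero => simp only [G, Submodule.mem_bot] at ha; simp [ha]
  | succ i => rw [Nat.succ_add]; exact F_mul hc ha hb

theorem coeff_free (f : FreeAlgebra ℂ Q.Gen) (n : ℕ) :
    (FreeAlgebra.lift ℂ (zgen g) f).coeff n ∈ F Pc g n := by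
  have hf : f ∈ Submodule.span ℂ
    (Set.range fun w : List Q.Gen => (w.map (FreeAlgebra.ι ℂ)).prod) := by rw [free_span]; trivial
  induction hf using Submodule.span_induction with
  | mem x hx =>
    obtain ⟨w, rfl⟩ := hx
    simp only [lift_free_word, zgen_word, Polynomial.coeff_C_mul, Polynomial.coeff_X_pow]
    split_ifs with h
    · refine Submodule.subset_span ⟨1, one_mem _, w, h.ge, by simp⟩
    · simp
  | zero => simp
  | add x y _ _ hx hy => rw [map_add, Polynomial.coeff_add]; exact add_mem hx hy
  | smul c x _ hx => rw [map_smul, Polynomial.coeff_smul]; exact Submodule.smul_mem _ _ hx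

theorem reduction (hc : ∀ p ∈ Pc, ∀ b : B, b * p = p * b) 
    (h : PreSat Q g) (hmu : mu g ∈ F Pc g 0) (f : FreeAlgebra ℂ Q.Gen)
    (hf : RingQuot.mkAlgHom ℂ (Q.PathRel 0) f = 0) (n : ℕ) :
    (FreeAlgebra.lift ℂ (zgen g) f).coeff n ∈ G Pc g n := by
  let J : Submodule ℂ (Polynomial B) :=
    { carrier := {p | ∀ n, p.coeff n ∈ G Pc g n}
      zero_mem' := by intro n; simp
      add_mem' := by intro p q hp hq n; rw [Polynomial.coeff_add]; exact add_mem (hp n) (hq n)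
      smul_mem' := by
        intro c p hp n; rw [Polynomial.coeff_smul]; exact Submodule.smul_mem _ _ (hp n) }
  have := consequence (lam := 0) h.zgen J ?_ ?_ ?_ f hf
  · exact this n
  · intro a f hf n
    rw [Polynomial.coeff_mul]
    refine Submodule.sum_mem _ fun ij hij => ?_
    rw [Finset.HasAntidiagonal.mem_antidiagonal] at hij
    rw [← hij]
    exact F_G hc (coeff_free a _) (hf _)
  · intro a f hf n
    rw [Polynomial.coeff_mul]
    refine Submodule.sum_mem _ fun ij hij => ?_
    rw [Finset.HasAntidiagonal.mem_antidiagonal] at hij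
    rw [← hij]
    exact G_F hc (hf _) (coeff_free a _)
  · intro n
    simp only [Pi.zero_apply, zero_smul, Finset.sum_const_zero, sub_zero, mu_zgen,
      Polynomial.coeff_C_mul, Polynomial.coeff_X_pow]
    split_ifs with h2
    · subst h2
      rw [mul_one]
      refine Submodule.span_mono ?_ hmu
      rintro _ ⟨p, hp, w, hw, rfl⟩
      exact ⟨p, hp, w, by omega, rfl⟩
    · simp
end red

/-- a homogeneous basis of words of the preprojective algebra -/
theorem exists_basis (Q : ADEQuiver) : ∃ S : Set (List Q.Gen), LinearIndepOn ℂ (Q.wordVal 0) S ∧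
    ∀ w, Q.wordVal 0 w ∈ Submodule.span ℂ
      (Q.wordVal 0 '' {u ∈ S | Q.arrowCount u = Q.arrowCount w}) := by
  have h : ∀ n, ∃ T : Set (List Q.Gen), T ⊆ {w | Q.arrowCount w = n} ∧
      LinearIndepOn ℂ (Q.wordVal 0) T ∧
      Q.wordVal 0 '' {w | Q.arrowCount w = n} ⊆ Submodule.span ℂ (Q.wordVal 0 '' T) := by
    intro n
    obtain ⟨T, h1, h2, h3, h4⟩ := exists_linearIndepOn_extension
      (linearIndepOn_empty ℂ (Q.wordVal 0)) (Set.empty_subset {w | Q.arrowCount w = n})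
    exact ⟨T, h1, h4, h3⟩
  choose T h1 h2 h3 using h
  have hST : ∀ n, {u ∈ ⋃ n, T n | Q.arrowCount u = n} = T n := by
    intro n
    ext u
    constructor
    · rintro ⟨hu, hn⟩
      obtain ⟨k, hk⟩ := Set.mem_iUnion.1 hu
      have : Q.arrowCount u = k := h1 k hk
      rw [← hn, this]; exact hk
    · intro hu
      exact ⟨Set.mem_iUnion.2 ⟨n, hu⟩, h1 n hu⟩
  refine ⟨⋃ n, T n, ?_, fun w => ?_⟩
  · rw [linearIndepOn_iff']
    intro s c hs h0 i hi
    classical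
    have h5 := congrArg (deg Q (Q.arrowCount i)) h0
    simp only [map_sum, map_smul, deg_word, map_zero, smul_ite, smul_zero] at h5
    rw [← Finset.sum_filter] at h5
    refine (linearIndepOn_iff'.1 (h2 (Q.arrowCount i))) _ c ?_ h5 i (by simp [hi])
    intro u hu
    rw [Finset.mem_coe, Finset.mem_filter] at hu
    rw [← hST]
    exact ⟨hs hu.1, hu.2⟩
  · rw [hST]
    exact h3 _ ⟨w, rfl, rfl⟩

/-- any word in a scalar-filtered algebra is a combination of basis words -/
theorem F_le {B : Type*} [Ring B] [Algebra ℂ B] {g : Q.Gen → B} {Pc : Submonoid B}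
    (hc : ∀ p ∈ Pc, ∀ b : B, b * p = p * b) (h : PreSat Q g) (hmu : mu g ∈ F Pc g 0)
    {S : Set (List Q.Gen)} (hS : ∀ w, Q.wordVal 0 w ∈ Submodule.span ℂ
      (Q.wordVal 0 '' {u ∈ S | Q.arrowCount u = Q.arrowCount w})) (n : ℕ) :
    F Pc g n ≤ Submodule.span ℂ {x | ∃ p ∈ Pc, ∃ w ∈ S, Q.arrowCount w ≤ n ∧
      x = p * (w.map g).prod} := by
  induction n using Nat.strong_induction_on with
  | _ n ih =>
  rw [F, Submodule.span_le]
  rintro _ ⟨p, hp, w, hw, rfl⟩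
  set Sp := Submodule.span ℂ {x | ∃ p ∈ Pc, ∃ w ∈ S, Q.arrowCount w ≤ n ∧
      x = p * (w.map g).prod} with hSp
  have hpS : ∀ p ∈ Pc, ∀ x ∈ Sp, p * x ∈ Sp := by
    intro p hp x hx
    induction hx using Submodule.span_induction with
    | mem x hx =>
      obtain ⟨q, hq, w, hw, hwn, rfl⟩ := hx
      exact Submodule.subset_span ⟨p * q, mul_mem hp hq, w, hw, hwn, by rw [mul_assoc]⟩
    | zero => simp
    | add x y _ _ hx hy => rw [mul_add]; exact add_mem hx hy
    | smul c x _ hx => rw [mul_smul_comm]; exact Submodule.smul_mem _ _ hx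
  apply hpS p hp
  obtain ⟨c, hcS, hcw⟩ := Finsupp.mem_span_image_iff_linearCombination ℂ |>.1 (hS w)
  let f : FreeAlgebra ℂ Q.Gen := (w.map (FreeAlgebra.ι ℂ)).prod -
    c.sum fun u a => a • (u.map (FreeAlgebra.ι ℂ)).prod
  have hf : RingQuot.mkAlgHom ℂ (Q.PathRel 0) f = 0 := by
    have e : ∀ u : List Q.Gen, RingQuot.mkAlgHom ℂ (Q.PathRel 0) (u.map (FreeAlgebra.ι ℂ)).prod =
        Q.wordVal 0 u := by
      intro u
      rw [map_list_prod, List.map_map]; rfl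
    simp only [f, map_sub, map_finsuppSum, map_smul, e]
    rw [← hcw, Finsupp.linearCombination_apply, sub_self]
  have hr := reduction hc h hmu f hf (Q.arrowCount w)
  have e2 : (FreeAlgebra.lift ℂ (zgen g) f).coeff (Q.arrowCount w) =
      (w.map g).prod - c.sum fun u a => a • (u.map g).prod := by
    simp only [f, map_sub, map_finsuppSum, map_smul, lift_free_word, zgen_word]
    rw [Polynomial.coeff_sub, Finsupp.sum, Polynomial.finsetSum_coeff, Finsupp.sum]
    congr 1
    · simp
    · refine Finset.sum_congr rfl fun u hu => ?_
      have := (hcS hu).2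
      simp [this]
  rw [e2] at hr
  rw [← sub_add_cancel (w.map g).prod (c.sum fun u a => a • (u.map g).prod)]
  refine add_mem ?_ ?_
  · revert hr
    generalize (w.map g).prod - (c.sum fun u a => a • (u.map g).prod) = y
    intro hr
    cases hk : Q.arrowCount w with
    | zero => rw [hk] at hr; simp only [G, Submodule.mem_bot] at hr; rw [hr]; exact zero_mem _
    | succ k =>
      rw [hk] at hr
      refine Submodule.span_mono ?_ (ih k (by omega) hr)
      rintro _ ⟨p, hp, w', hw', hwk, rfl⟩
      exact ⟨p, hp, w', hw', by omega, rfl⟩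
  · refine Submodule.sum_mem _ fun u hu => Submodule.smul_mem _ _ (Submodule.subset_span ?_)
    have := hcS hu
    exact ⟨1, one_mem _, u, this.1, by rw [this.2]; exact hw, by simp⟩

end DPA

namespace DPA
set_option linter.unusedSimpArgs false
set_option linter.unusedVariables false
set_option linter.style.haveILetI false
open scoped BigOperators

variable {Q : ADEQuiver}

/-- a finite homogeneous word basis of the preprojective algebra -/
structure WB (Q : ADEQuiver) (S : Finset (List Q.Gen)) : Prop where
  li : LinearIndepOn ℂ (Q.wordVal 0) (S : Set (List Q.Gen))
  sp : ∀ w, Q.wordVal 0 w ∈ Submodule.span ℂ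
      (Q.wordVal 0 '' {u ∈ (S : Set (List Q.Gen)) | Q.arrowCount u = Q.arrowCount w})

theorem exists_WB (hADE : Q.IsADE) : ∃ S, WB Q S := by
  obtain ⟨S, h1, h2⟩ := exists_basis Q
  haveI := fd_zero hADE
  have hf : S.Finite := by
    have := LinearIndependent.finite h1
    exact Set.toFinite S
  refine ⟨hf.toFinset, ?_, ?_⟩
  · simpa using h1
  · simpa using h2

theorem mu_gen (lam : Q.I → ℂ) : mu (Q.gen lam) = ∑ i, lam i • Q.gen lam (Sum.inl i) :=
  (sat_gen Q lam).rel

theorem WB.filt_eq {S : Finset (List Q.Gen)} (h : WB Q S) (lam : Q.I → ℂ) (n : ℕ) :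
    Q.filt lam n = Submodule.span ℂ (Set.range fun u : {u // u ∈ S ∧ Q.arrowCount u ≤ n} =>
      Q.wordVal lam u.1) := by
  apply le_antisymm
  · have hmu : mu (Q.gen lam) ∈ F (⊥ : Submonoid (Q.Deformed lam)) (Q.gen lam) 0 := by
      rw [mu_gen]
      refine Submodule.sum_mem _ fun i _ => Submodule.smul_mem _ _ (Submodule.subset_span ?_)
      exact ⟨1, one_mem _, [Sum.inl i], by simp, by simp⟩
    have := F_le (Pc := ⊥) (by intro p hp b; rw [Submonoid.mem_bot.1 hp]; simp)
      (sat_gen Q lam).pre hmu h.sp n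
    refine le_trans ?_ (this.trans ?_)
    · refine Submodule.span_mono ?_
      rintro _ ⟨w, hw, rfl⟩
      exact ⟨1, one_mem _, w, hw, by rw [one_mul]; rfl⟩
    · refine Submodule.span_mono ?_
      rintro _ ⟨p, hp, w, hw, hn, rfl⟩
      refine ⟨⟨w, hw, hn⟩, ?_⟩
      rw [Submonoid.mem_bot.1 hp, one_mul]; rfl
  · refine Submodule.span_mono ?_
    rintro _ ⟨⟨w, hw, hn⟩, rfl⟩
    exact ⟨w, hn, rfl⟩

theorem WB.top {S : Finset (List Q.Gen)} (h : WB Q S) (lam : Q.I → ℂ) :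
    ⊤ ≤ Submodule.span ℂ (Set.range fun u : {u // u ∈ S} => Q.wordVal lam u.1) := by
  rw [← span_words Q lam, Submodule.span_le]
  rintro _ ⟨w, rfl⟩
  have : Q.wordVal lam w ∈ Q.filt lam (Q.arrowCount w) := Submodule.subset_span ⟨w, le_rfl, rfl⟩
  rw [h.filt_eq] at this
  refine Submodule.span_mono ?_ this
  rintro _ ⟨⟨w, hw, hn⟩, rfl⟩
  exact ⟨⟨w, hw⟩, rfl⟩

theorem fd_all (hADE : Q.IsADE) (lam : Q.I → ℂ) : FiniteDimensional ℂ (Q.Deformed lam) := by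
  obtain ⟨S, h⟩ := exists_WB hADE
  have h1 := h.top lam
  rw [top_le_iff] at h1
  exact Module.Finite.of_fg_top (h1 ▸ Submodule.fg_span (Set.finite_range _))

theorem WB.li_iff {S : Finset (List Q.Gen)} (h : WB Q S) (lam : Q.I → ℂ) :
    LinearIndepOn ℂ (Q.wordVal lam) (S : Set (List Q.Gen)) ↔
      Module.finrank ℂ (Q.Deformed lam) = S.card := by
  constructor
  · intro hl
    have b := finrank_span_eq_card (R := ℂ) hl
    have h1 := h.top lam
    rw [top_le_iff] at h1
    have e : Module.finrank ℂ (Q.Deformed lam) = Module.finrank ℂ (⊤ : Submodule ℂ (Q.Deformed lam)) :=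
      finrank_top ℂ _ |>.symm
    rw [e, ← h1]
    exact b.trans (by simp)
  · intro hd
    exact linearIndependent_of_top_le_span_of_card_eq_finrank (h.top lam) (by simp [hd])

theorem WB.card {S : Finset (List Q.Gen)} (h : WB Q S) :
    Module.finrank ℂ (Q.Deformed 0) = S.card := (h.li_iff 0).1 h.li

theorem filt_eq_of_dim (hADE : Q.IsADE) (lam : Q.I → ℂ)
    (hd : Module.finrank ℂ (Q.Deformed lam) = Module.finrank ℂ (Q.Deformed 0)) (n : ℕ) :
    Module.finrank ℂ (Q.filt lam n) = Module.finrank ℂ (Q.filt 0 n) := by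
  obtain ⟨S, h⟩ := exists_WB hADE
  haveI : Finite {u // u ∈ S ∧ Q.arrowCount u ≤ n} :=
    Finite.of_injective (β := {u // u ∈ S}) (fun u => ⟨u.1, u.2.1⟩)
      (by intro a b hab; ext1; simpa using hab)
  haveI := Fintype.ofFinite {u // u ∈ S ∧ Q.arrowCount u ≤ n}
  have key : ∀ l : Q.I → ℂ, LinearIndepOn ℂ (Q.wordVal l) (S : Set (List Q.Gen)) →
      Module.finrank ℂ (Q.filt l n) = Fintype.card {u // u ∈ S ∧ Q.arrowCount u ≤ n} := by
    intro l hl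
    rw [h.filt_eq]
    refine finrank_span_eq_card ?_
    exact LinearIndependent.comp hl (fun u : {u // u ∈ S ∧ Q.arrowCount u ≤ n} =>
      (⟨u.1, u.2.1⟩ : {u // u ∈ (S : Set (List Q.Gen))}))
      (by intro a b hab; ext1; simpa using hab)
  rw [key lam ((h.li_iff lam).2 (hd.trans h.card)), key 0 h.li]

section semi
variable (L : Q.I → Polynomial ℂ)

/-- the product of the fibres -/
abbrev Fib := ∀ s : ℂ, Q.Deformed (fun i => (L i).eval s)

/-- polynomial scalars -/
def PS (p : Polynomial ℂ) : Fib L := fun s => algebraMap ℂ _ (p.eval s)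

/-- generators of the family -/
def fg (x : Q.Gen) : Fib L := fun s => Q.gen _ x

theorem PS_mul (p q : Polynomial ℂ) : PS L (p * q) = PS L p * PS L q := by
  ext s; simp [PS]

theorem PS_comm (p : Polynomial ℂ) (b : Fib L) : b * PS L p = PS L p * b := by
  ext s; simp only [Pi.mul_apply, PS]; exact (Algebra.commutes _ _).symm

/-- submonoid of scalars -/
def PSm : Submonoid (Fib L) where
  carrier := Set.range (PS L)
  one_mem' := ⟨1, by ext s; simp [PS]⟩
  mul_mem' := by
    rintro _ _ ⟨p, rfl⟩ ⟨q, rfl⟩; exact ⟨p * q, PS_mul L p q⟩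

theorem fg_word (w : List Q.Gen) (s : ℂ) : (w.map (fg L)).prod s = Q.wordVal _ w := by
  induction w with
  | nil => rfl
  | cons x w ih =>
    rw [List.map_cons, List.prod_cons, Pi.mul_apply, ih, wordVal_cons]; rfl

theorem fg_pre : PreSat Q (fg L) := by
  constructor
  · intro i j; ext s
    have := (sat_gen Q fun i => (L i).eval s).ee i j
    rw [Pi.mul_apply]
    refine this.trans ?_
    split_ifs <;> rfl
  · ext s
    have := (sat_gen Q fun i => (L i).eval s).sum
    rw [Finset.sum_apply]
    exact this
  · intro x; ext s; exact (sat_gen Q fun i => (L i).eval s).xs x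
  · intro x; ext s; exact (sat_gen Q fun i => (L i).eval s).tx x

theorem fg_mu : mu (fg L) = ∑ i, PS L (L i) * fg L (Sum.inl i) := by
  ext s
  have := mu_gen (Q := Q) (fun i => (L i).eval s)
  rw [mu, Finset.sum_apply, Finset.sum_apply]
  refine this.trans ?_
  refine Finset.sum_congr rfl fun i _ => ?_
  rw [Pi.mul_apply, PS, ← Algebra.smul_def]; rfl

theorem PS_smul (p : Polynomial ℂ) (c : ℂ) (b : Fib L) :
    c • (PS L p * b) = PS L (Polynomial.C c * p) * b := by
  ext s; simp only [Pi.smul_apply, Pi.mul_apply, PS, Polynomial.eval_mul, Polynomial.eval_C,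
    map_mul, mul_assoc, Algebra.smul_def]

theorem PS_add (p q : Polynomial ℂ) : PS L (p + q) = PS L p + PS L q := by
  ext s; simp [PS]

theorem semicont (hADE : Q.IsADE)
    (hinf : Set.Infinite {s : ℂ | Module.finrank ℂ (Q.Deformed (fun i => (L i).eval s)) =
      Module.finrank ℂ (Q.Deformed 0)}) :
    Module.finrank ℂ (Q.Deformed (fun i => (L i).eval 0)) = Module.finrank ℂ (Q.Deformed 0) := by
  obtain ⟨S, h⟩ := exists_WB hADE
  rw [h.card, ← h.li_iff, linearIndepOn_finset_iff]
  rw [h.card] at hinf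
  simp only [← h.li_iff] at hinf
  intro c hc
  let f : FreeAlgebra ℂ Q.Gen := ∑ u ∈ S, c u • (u.map (FreeAlgebra.ι ℂ)).prod
  have hf : RingQuot.mkAlgHom ℂ (Q.PathRel (fun i => (L i).eval 0)) f = 0 := by
    have e : ∀ u : List Q.Gen, RingQuot.mkAlgHom ℂ (Q.PathRel (fun i => (L i).eval 0))
        (u.map (FreeAlgebra.ι ℂ)).prod = Q.wordVal (fun i => (L i).eval 0) u := by
      intro u
      rw [map_list_prod, List.map_map]; rfl
    simp only [f, map_sum, map_smul, e]
    exact hc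
  let J : Submodule ℂ (Fib L) := Submodule.span ℂ
    {x | ∃ p : Polynomial ℂ, p.eval 0 = 0 ∧ ∃ w : List Q.Gen, x = PS L p * (w.map (fg L)).prod}
  have hl : ∀ a : FreeAlgebra ℂ Q.Gen, ∀ f ∈ J, FreeAlgebra.lift ℂ (fg L) a * f ∈ J := by
    intro a f hf
    have ha : a ∈ Submodule.span ℂ
      (Set.range fun w : List Q.Gen => (w.map (FreeAlgebra.ι ℂ)).prod) := by rw [free_span]; trivial
    induction ha using Submodule.span_induction with
    | mem x hx =>
      obtain ⟨w, rfl⟩ := hx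
      rw [lift_free_word]
      induction hf using Submodule.span_induction with
      | mem y hy =>
        obtain ⟨p, hp, v, rfl⟩ := hy
        refine Submodule.subset_span ⟨p, hp, w ++ v, ?_⟩
        rw [← mul_assoc, PS_comm, mul_assoc, List.map_append, List.prod_append]
      | zero => simp
      | add x y _ _ hx hy => rw [mul_add]; exact add_mem hx hy
      | smul c x _ hx => rw [mul_smul_comm]; exact Submodule.smul_mem _ _ hx
    | zero => simp
    | add x y _ _ hx hy => rw [map_add, add_mul]; exact add_mem hx hy
    | smul c x _ hx => rw [map_smul, smul_mul_assoc]; exact Submodule.smul_mem _ _ hx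
  have hr : ∀ a : FreeAlgebra ℂ Q.Gen, ∀ f ∈ J, f * FreeAlgebra.lift ℂ (fg L) a ∈ J := by
    intro a f hf
    have ha : a ∈ Submodule.span ℂ
      (Set.range fun w : List Q.Gen => (w.map (FreeAlgebra.ι ℂ)).prod) := by rw [free_span]; trivial
    induction ha using Submodule.span_induction with
    | mem x hx =>
      obtain ⟨w, rfl⟩ := hx
      rw [lift_free_word]
      induction hf using Submodule.span_induction with
      | mem y hy =>
        obtain ⟨p, hp, v, rfl⟩ := hy
        refine Submodule.subset_span ⟨p, hp, v ++ w, ?_⟩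
        rw [mul_assoc, List.map_append, List.prod_append]
      | zero => simp
      | add x y _ _ hx hy => rw [add_mul]; exact add_mem hx hy
      | smul c x _ hx => rw [smul_mul_assoc]; exact Submodule.smul_mem _ _ hx
    | zero => simp
    | add x y _ _ hx hy => rw [map_add, mul_add]; exact add_mem hx hy
    | smul c x _ hx => rw [map_smul, mul_smul_comm]; exact Submodule.smul_mem _ _ hx
  have hJ : mu (fg L) - ∑ i, (L i).eval 0 • fg L (Sum.inl i) ∈ J := by
    rw [fg_mu, ← Finset.sum_sub_distrib]
    refine Submodule.sum_mem _ fun i _ => Submodule.subset_span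
      ⟨L i - Polynomial.C ((L i).eval 0), by simp, [Sum.inl i], ?_⟩
    ext s
    simp only [List.map_cons, List.map_nil, List.prod_cons, List.prod_nil, mul_one, Pi.sub_apply,
      Pi.mul_apply, Pi.smul_apply, PS, Polynomial.eval_sub, Polynomial.eval_C, map_sub, sub_mul,
      Algebra.smul_def]
    rfl
  have hfJ := consequence (lam := fun i => (L i).eval 0) (fg_pre L) J hl hr hJ f hf
  have hmu : mu (fg L) ∈ F (PSm L) (fg L) 0 := by
    rw [fg_mu]
    exact Submodule.sum_mem _ fun i _ => Submodule.subset_span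
      ⟨_, ⟨L i, rfl⟩, [Sum.inl i], by simp, by simp⟩
  have hF := F_le (Pc := PSm L) (by rintro _ ⟨p, rfl⟩ b; exact PS_comm L p b) (fg_pre L) hmu h.sp
  have hrep : ∀ x ∈ J, ∃ p : List Q.Gen → Polynomial ℂ, (∀ u, (p u).eval 0 = 0) ∧
      x = ∑ u ∈ S, PS L (p u) * (u.map (fg L)).prod := by
    have hadd : ∀ x y : Fib L, (∃ p : List Q.Gen → Polynomial ℂ, (∀ u, (p u).eval 0 = 0) ∧
      x = ∑ u ∈ S, PS L (p u) * (u.map (fg L)).prod) → (∃ p : List Q.Gen → Polynomial ℂ, (∀ u, (p u).eval 0 = 0) ∧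
      y = ∑ u ∈ S, PS L (p u) * (u.map (fg L)).prod) → (∃ p : List Q.Gen → Polynomial ℂ, (∀ u, (p u).eval 0 = 0) ∧
      x + y = ∑ u ∈ S, PS L (p u) * (u.map (fg L)).prod) := by
      rintro x y ⟨p, hp, rfl⟩ ⟨q, hq, rfl⟩
      refine ⟨fun u => p u + q u, fun u => by simp [hp, hq], ?_⟩
      simp only [PS_add, add_mul, Finset.sum_add_distrib]
    have hsmul : ∀ (c : ℂ) (x : Fib L), (∃ p : List Q.Gen → Polynomial ℂ, (∀ u, (p u).eval 0 = 0) ∧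
      x = ∑ u ∈ S, PS L (p u) * (u.map (fg L)).prod) → (∃ p : List Q.Gen → Polynomial ℂ, (∀ u, (p u).eval 0 = 0) ∧
      c • x = ∑ u ∈ S, PS L (p u) * (u.map (fg L)).prod) := by
      rintro c x ⟨p, hp, rfl⟩
      refine ⟨fun u => Polynomial.C c * p u, fun u => by simp [hp], ?_⟩
      rw [Finset.smul_sum]
      exact Finset.sum_congr rfl fun u _ => PS_smul L _ _ _
    have hz : ∃ p : List Q.Gen → Polynomial ℂ, (∀ u, (p u).eval 0 = 0) ∧
      (0 : Fib L) = ∑ u ∈ S, PS L (p u) * (u.map (fg L)).prod := by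
      refine ⟨fun u => 0, fun u => by simp, ?_⟩
      symm
      refine Finset.sum_eq_zero fun u _ => ?_
      ext s; simp [PS]
    intro x hx
    induction hx using Submodule.span_induction with
    | mem x hx =>
      obtain ⟨p, hp, w, rfl⟩ := hx
      have hw : (w.map (fg L)).prod ∈ F (PSm L) (fg L) (Q.arrowCount w) :=
        Submodule.subset_span ⟨1, one_mem _, w, le_rfl, by rw [one_mul]⟩
      have hw2 := hF _ hw
      revert hw2
      generalize (w.map (fg L)).prod = y0
      intro hw2
      induction hw2 using Submodule.span_induction with
      | mem y hy =>
        obtain ⟨_, ⟨q, rfl⟩, u, hu, _, rfl⟩ := hy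
        classical
        refine ⟨fun v => if v = u then p * q else 0, ?_, ?_⟩
        · intro v; dsimp only; split_ifs <;> simp [hp]
        · rw [Finset.sum_eq_single u]
          · simp only [if_true]
            rw [PS_mul, mul_assoc]
          · intro b _ hb
            dsimp only; rw [if_neg hb]; ext s; simp [PS]
          · intro hh; exact absurd hu hh
      | zero => rw [mul_zero]; exact hz
      | add x y _ _ hx hy => rw [mul_add]; exact hadd _ _ hx hy
      | smul c x _ hx => rw [mul_smul_comm]; exact hsmul _ _ hx
    | zero => exact hz
    | add x y _ _ hx hy => exact hadd _ _ hx hy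
    | smul c x _ hx => exact hsmul _ _ hx
  obtain ⟨p, hp0, hp⟩ := hrep _ hfJ
  have hev : ∀ s, LinearIndepOn ℂ (Q.wordVal (fun i => (L i).eval s)) (S : Set (List Q.Gen)) →
      ∀ u ∈ S, (p u).eval s = c u := by
    intro s hs u hu
    have h1 := congrFun hp s
    simp only [f, map_sum, map_smul, lift_free_word, Finset.sum_apply, Pi.smul_apply, Pi.mul_apply,
      fg_word, PS, ← Algebra.smul_def] at h1
    rw [← sub_eq_zero, ← Finset.sum_sub_distrib] at h1
    have := linearIndepOn_finset_iff.1 hs (fun x => c x - (p x).eval s)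
      (by rw [← h1]; exact Finset.sum_congr rfl fun x _ => by rw [sub_smul]) u hu
    exact (sub_eq_zero.1 this).symm
  intro u hu
  have hpc : p u - Polynomial.C (c u) = 0 := by
    refine Polynomial.eq_zero_of_infinite_isRoot _ (hinf.mono ?_)
    intro s hs
    simp [Polynomial.IsRoot, hev s hs u hu]
  have := congrArg (Polynomial.eval 0) hpc
  simp only [Polynomial.eval_sub, hp0, Polynomial.eval_C, Polynomial.eval_zero, zero_sub,
    neg_eq_zero] at this
  exact this
end semi
end DPA

namespace DPA
set_option linter.unusedSimpArgs false
set_option linter.unusedVariables false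
set_option linter.style.haveILetI false
open scoped BigOperators

variable {Q : ADEQuiver} {lam : Q.I → ℂ}

section gen
variable {B : Type*} [Ring B] [Algebra ℂ B] {g : Q.Gen → B}

/-- the projective `A e_a` -/
def Pm (g : Q.Gen → B) (a : Q.I) : Submodule ℂ B where
  carrier := {x | x * g (Sum.inl a) = x}
  zero_mem' := by simp
  add_mem' := by intro x y hx hy; exact (add_mul _ _ _).trans (congrArg₂ _ hx hy)
  smul_mem' := by intro c x hx; exact (smul_mul_assoc _ _ _).trans (congrArg _ hx)

theorem mem_Pm {a : Q.I} {x : B} : x ∈ Pm g a ↔ x * g (Sum.inl a) = x := Iff.rfl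

/-- the action -/
def gP (g : Q.Gen → B) (a : Q.I) (x : Q.Gen) : Module.End ℂ (Pm g a) :=
  (Algebra.lmul ℂ B (g x)).restrict (by
    intro y hy
    rw [mem_Pm] at hy ⊢
    simp only [Algebra.coe_lmul_eq_mul, LinearMap.mul_apply_apply]
    rw [mul_assoc, hy])

theorem gP_apply (a : Q.I) (x : Q.Gen) (m : Pm g a) : (gP g a x m : B) = g x * m := rfl

theorem sat_gP (hs : Sat Q lam g) (a : Q.I) : Sat Q lam (gP g a) :=
  Sat.of_inj (hs.map (Algebra.lmul ℂ B)) (Pm g a).subtype (Submodule.subtype_injective _)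
    (fun x m => rfl)

theorem gP_lift (hs : Sat Q lam g) (a : Q.I) (y : Q.Deformed lam) (m : Pm g a) :
    ((sat_gP hs a).lift y m : B) = hs.lift y * m := by
  have ha : y ∈ Submodule.span ℂ (Set.range (Q.wordVal lam)) := by
    rw [span_words]; trivial
  induction ha using Submodule.span_induction generalizing m with
  | mem x hx =>
    obtain ⟨w, rfl⟩ := hx
    rw [Sat.lift_word, Sat.lift_word]
    induction w with
    | nil => simp [wordVal]
    | cons x w ih =>
      rw [List.map_cons, List.prod_cons, Module.End.mul_apply, gP_apply, ih, List.map_cons,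
        List.prod_cons, mul_assoc]
  | zero => simp
  | add x y _ _ hx hy => rw [map_add, LinearMap.add_apply, Submodule.coe_add, hx, hy, map_add, add_mul]
  | smul c x _ hx => rw [map_smul, LinearMap.smul_apply, Submodule.coe_smul, hx, map_smul, smul_mul_assoc]

/-- the generator -/
def eP (hs : Sat Q lam g) (a : Q.I) : Pm g a := ⟨g (Sum.inl a), hs.idem a⟩

/-- `e_i A e_a` -/
def U (g : Q.Gen → B) (i a : Q.I) : Submodule ℂ B where
  carrier := {x | g (Sum.inl i) * x = x ∧ x * g (Sum.inl a) = x}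
  zero_mem' := by simp
  add_mem' := by
    rintro x y ⟨hx, hx'⟩ ⟨hy, hy'⟩; constructor
    · rw [mul_add, hx, hy]
    · rw [add_mul, hx', hy']
  smul_mem' := by
    rintro c x ⟨hx, hx'⟩; constructor
    · rw [mul_smul_comm, hx]
    · rw [smul_mul_assoc, hx']

theorem dv_gP (hs : Sat Q lam g) (i a : Q.I) : dv (gP g a) i = Module.finrank ℂ (U g i a) := by
  have : (LinearMap.range (gP g a (Sum.inl i))).map (Pm g a).subtype = U g i a := by
    ext x
    constructor
    · rintro ⟨_, ⟨y, rfl⟩, rfl⟩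
      refine ⟨?_, ?_⟩
      · simp only [Submodule.subtype_apply, gP_apply]; rw [← mul_assoc, hs.idem i]
      · exact (gP g a (Sum.inl i) y).2
    · rintro ⟨h1, h2⟩
      refine ⟨gP g a (Sum.inl i) ⟨x, h2⟩, ⟨_, rfl⟩, ?_⟩
      exact h1
  rw [dv, ← this]
  exact (LinearEquiv.finrank_eq (Submodule.equivMapOfInjective _ (Submodule.subtype_injective _) _))

theorem U_mono {g' : Q.Gen → B} [FiniteDimensional ℂ B] (f : B →ₗ[ℂ] B) (hf : Function.Injective f)
    (i a : Q.I) (h : ∀ x ∈ U g i a, f x ∈ U g a i) :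
    Module.finrank ℂ (U g i a) ≤ Module.finrank ℂ (U g a i) := by
  have h2 := Submodule.finrank_mono ((Submodule.map_le_iff_le_comap (f := f) (p := U g i a) (q := U g a i)).2 h)
  rwa [← LinearEquiv.finrank_eq (Submodule.equivMapOfInjective f hf _)] at h2

variable {N : Type*} [AddCommGroup N] [Module ℂ N] {gN : Q.Gen → Module.End ℂ N}

/-- homomorphisms out of a projective -/
theorem K_gP (hs : Sat Q lam g) (c : B →ₗ[ℂ] Q.Deformed lam) (hcl : ∀ b, hs.lift (c b) = b)
    (hcg : ∀ x b, c (g x * b) = Q.gen lam x * c b) (hc1 : c 1 = 1) (hN : Sat Q lam gN)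
    (a : Q.I) :
    Module.finrank ℂ (K (gP g a) gN) = dv gN a := by
  let ev : K (gP g a) gN →ₗ[ℂ] N := (LinearMap.applyₗ (eP hs a)) ∘ₗ (K (gP g a) gN).subtype
  have hK : ∀ φ : K (gP g a) gN, ∀ x m, φ.1 (gP g a x m) = gN x (φ.1 m) := fun φ x m =>
    LinearMap.congr_fun (φ.2 x) m
  have hinj : Function.Injective ev := by
    rw [injective_iff_map_eq_zero]
    rintro φ h0
    ext m
    have h1 : (sat_gP hs a).lift (c m) (eP hs a) = m := by
      ext
      rw [gP_lift hs, hcl]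
      exact m.2
    have h2 := intertwine (sat_gP hs a) hN φ.1 (hK φ) (c m) (eP hs a)
    rw [h1] at h2
    have h3 : φ.1 (eP hs a) = 0 := h0
    rw [h2, h3]; simp
  rw [← LinearMap.finrank_range_of_inj hinj, dv]
  have : LinearMap.range ev = LinearMap.range (gN (Sum.inl a)) := by
    ext n
    constructor
    · rintro ⟨φ, rfl⟩
      refine ⟨φ.1 (eP hs a), ?_⟩
      rw [← hK]
      have : gP g a (Sum.inl a) (eP hs a) = eP hs a := by
        ext; rw [gP_apply]; exact hs.idem a
      rw [this]; rfl
    · rintro ⟨n, rfl⟩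
      let φ : Pm g a →ₗ[ℂ] N :=
        { toFun := fun m => hN.lift (c m) (gN (Sum.inl a) n)
          map_add' := by intro x y; simp
          map_smul' := by intro r x; simp }
      refine ⟨⟨φ, fun x => ?_⟩, ?_⟩
      · ext m
        change hN.lift (c (g x * m)) _ = gN x (hN.lift (c m) _)
        rw [hcg, map_mul, Module.End.mul_apply, Sat.lift_gen]
      · change hN.lift (c (g (Sum.inl a))) _ = _
        rw [← mul_one (g (Sum.inl a)), hcg, hc1, mul_one, Sat.lift_gen, hN.ee_apply, if_pos rfl]
  rw [this]

theorem cb_gP [FiniteDimensional ℂ B] [FiniteDimensional ℂ N] (hs : Sat Q lam g)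
    (c : B →ₗ[ℂ] Q.Deformed lam) (hcl : ∀ b, hs.lift (c b) = b)
    (hcg : ∀ x b, c (g x * b) = Q.gen lam x * c b) (hc1 : c 1 = 1) (hN : Sat Q lam gN)
    (a : Q.I) :
    2 * ∑ i, (Module.finrank ℂ (U g i a) : ℤ) * dv gN i =
      ∑ i, ∑ j, Q.C i j * ((Module.finrank ℂ (U g i a) : ℤ) * dv gN j) +
        dv gN a + Module.finrank ℂ (K gN (gP g a)) := by
  have := cb_eq (sat_gP hs a) hN (c ∘ₗ (Pm g a).subtype) (eP hs a) (fun x m => hcg x m) ?_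
  · rw [K_gP hs c hcl hcg hc1 hN] at this
    have h2 := congrArg (Nat.cast : ℕ → ℤ) this
    push_cast at h2
    rw [sumC (fun i => (dv (gP g a) i : ℤ)) (fun i => (dv gN i : ℤ))] at h2
    simp only [dv_gP hs] at h2
    simpa using h2
  · intro m
    ext
    rw [gP_lift]
    change hs.lift (c m) * _ = _
    rw [hcl]
    exact m.2

theorem cb_quad [FiniteDimensional ℂ B] (hs : Sat Q lam g)
    (c : B →ₗ[ℂ] Q.Deformed lam) (hcl : ∀ b, hs.lift (c b) = b)
    (hcg : ∀ x b, c (g x * b) = Q.gen lam x * c b) (hc1 : c 1 = 1)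
    (a b : Q.I) :
    2 * ∑ i, (Module.finrank ℂ (U g i a) : ℤ) * Module.finrank ℂ (U g i b) =
      ∑ i, ∑ j, Q.C i j * ((Module.finrank ℂ (U g i a) : ℤ) * Module.finrank ℂ (U g j b)) +
        Module.finrank ℂ (U g a b) + Module.finrank ℂ (U g b a) := by
  have h := cb_gP hs c hcl hcg hc1 (sat_gP hs b) a
  rw [K_gP hs c hcl hcg hc1 (sat_gP hs a) b] at h
  simpa only [dv_gP hs] using h

theorem cb_ge [FiniteDimensional ℂ B] [FiniteDimensional ℂ N] (hs : Sat Q lam g)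
    (c : B →ₗ[ℂ] Q.Deformed lam) (hcl : ∀ b, hs.lift (c b) = b)
    (hcg : ∀ x b, c (g x * b) = Q.gen lam x * c b) (hc1 : c 1 = 1) (hN : Sat Q lam gN)
    (a : Q.I) :
    (dv gN a : ℤ) ≤ 2 * ∑ i, (Module.finrank ℂ (U g i a) : ℤ) * dv gN i -
      ∑ i, ∑ j, Q.C i j * ((Module.finrank ℂ (U g i a) : ℤ) * dv gN j) := by
  have := cb_gP hs c hcl hcg hc1 hN a
  have h2 : (0 : ℤ) ≤ Module.finrank ℂ (K gN (gP g a)) := Int.natCast_nonneg _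
  linarith

theorem cb_lam [FiniteDimensional ℂ B] (hs : Sat Q lam g) (a : Q.I) :
    ∑ i, lam i * (Module.finrank ℂ (U g i a) : ℂ) = 0 := by
  have := lam_dv (sat_gP hs a)
  simpa only [dv_gP hs] using this

theorem cb_total [FiniteDimensional ℂ B] (hs : Sat Q lam g) :
    Module.finrank ℂ B = ∑ a, ∑ i, Module.finrank ℂ (U g i a) := by
  have h1 : ∀ a, Module.finrank ℂ (Pm g a) = ∑ i, Module.finrank ℂ (U g i a) := by
    intro a
    rw [dim_eq_sum (sat_gP hs a)]
    simp only [dv_gP hs]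
  simp only [← h1]
  have h2 : ∑ a, LinearMap.mulRight ℂ (g (Sum.inl a)) = (1 : Module.End ℂ B) := by
    ext x
    rw [LinearMap.sum_apply]
    simp only [LinearMap.mulRight_apply]
    rw [← Finset.mul_sum, hs.sum, mul_one]; rfl
  have h3 : ∀ a, LinearMap.trace ℂ B (LinearMap.mulRight ℂ (g (Sum.inl a))) =
      Module.finrank ℂ (Pm g a) := by
    intro a
    have : LinearMap.IsProj (Pm g a) (LinearMap.mulRight ℂ (g (Sum.inl a))) := by
      constructor
      · intro x; rw [LinearMap.mulRight_apply, mem_Pm, mul_assoc, hs.idem a]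
      · intro x hx; rw [LinearMap.mulRight_apply]; exact hx
    exact this.trace
  have h := congrArg (LinearMap.trace ℂ B) h2
  rw [map_sum, LinearMap.trace_one] at h
  simp only [h3] at h
  exact_mod_cast h.symm
end gen

/-- the anti-involution on generators -/
def gop (lam : Q.I → ℂ) : Q.Gen → (Q.Deformed lam)ᵐᵒᵖ
  | Sum.inl i => MulOpposite.op (Q.gen lam (Sum.inl i))
  | Sum.inr x => MulOpposite.op (Q.gen lam (Sum.inr x.swap))

theorem sat_gop (lam : Q.I → ℂ) : Sat Q lam (gop lam) := by
  have hs := sat_gen Q lam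
  constructor
  · intro i j
    simp only [gop, ← MulOpposite.op_mul, hs.ee]
    by_cases h : i = j
    · simp [h]
    · simp [h, Ne.symm h]
  · have := congrArg (MulOpposite.opAddEquiv) hs.sum
    rw [map_sum] at this
    exact this
  · intro x
    simp only [gop, ← MulOpposite.op_mul]
    rw [← dtgt_swap, hs.tx]
  · intro x
    simp only [gop, ← MulOpposite.op_mul]
    rw [← dsrc_swap, hs.xs]
  · simp only [gop, ← MulOpposite.op_mul, ← MulOpposite.op_sub, Sum.swap_inl, Sum.swap_inr, ← MulOpposite.op_smul]
    have := congrArg (MulOpposite.opAddEquiv) hs.rel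
    rw [map_sum, map_sum] at this
    exact this

/-- the anti-involution -/
noncomputable def th (lam : Q.I → ℂ) : Q.Deformed lam →ₗ[ℂ] Q.Deformed lam :=
  (MulOpposite.opLinearEquiv ℂ).symm.toLinearMap ∘ₗ (sat_gop lam).lift.toLinearMap

theorem th_mul (x y : Q.Deformed lam) : th lam (x * y) = th lam y * th lam x := by
  simp [th]

theorem th_inl (i : Q.I) : th lam (Q.gen lam (Sum.inl i)) = Q.gen lam (Sum.inl i) := by
  simp [th, Sat.lift_gen, gop]

theorem th_inr (x) : th lam (Q.gen lam (Sum.inr x)) = Q.gen lam (Sum.inr x.swap) := by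
  simp [th, Sat.lift_gen, gop]

theorem th_th (x : Q.Deformed lam) : th lam (th lam x) = x := by
  have hx : x ∈ Submodule.span ℂ (Set.range (Q.wordVal lam)) := by
    rw [span_words]; trivial
  induction hx using Submodule.span_induction with
  | mem x hx =>
    obtain ⟨w, rfl⟩ := hx
    induction w with
    | nil => simp [wordVal, th]
    | cons a w ih =>
      rw [wordVal_cons, th_mul, th_mul, ih]
      congr 1
      cases a with
      | inl i => rw [th_inl, th_inl]
      | inr x => rw [th_inr, th_inr, Sum.swap_swap]
  | zero => simp
  | add x y _ _ hx hy => rw [map_add, map_add, hx, hy]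
  | smul c x _ hx => rw [map_smul, map_smul, hx]


/-- the dimension matrix -/
noncomputable def H (lam : Q.I → ℂ) (i a : Q.I) : ℕ := Module.finrank ℂ (U (Q.gen lam) i a)

theorem H_le (hADE : Q.IsADE) (i a : Q.I) : H lam i a ≤ H lam a i := by
  haveI := fd_all hADE lam
  have hinj : Function.Injective (th lam) := Function.LeftInverse.injective (g := th lam) th_th
  refine U_mono (g' := Q.gen lam) (th lam) hinj i a ?_
  rintro x ⟨h1, h2⟩
  constructor
  · conv_rhs => rw [← h2, th_mul, th_inl]
  · conv_rhs => rw [← h1, th_mul, th_inl]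

theorem H_symm (hADE : Q.IsADE) (i a : Q.I) : H lam i a = H lam a i :=
  le_antisymm (H_le hADE i a) (H_le hADE a i)


theorem lift_self (y : Q.Deformed lam) : (sat_gen Q lam).lift y = y := by
  have ha : y ∈ Submodule.span ℂ (Set.range (Q.wordVal lam)) := by
    rw [span_words]; trivial
  induction ha using Submodule.span_induction with
  | mem x hx =>
    obtain ⟨w, rfl⟩ := hx
    rw [Sat.lift_word]; rfl
  | zero => simp
  | add x y _ _ hx hy => rw [map_add, hx, hy]
  | smul c x _ hx => rw [map_smul, hx]

theorem H_quad (hADE : Q.IsADE) (a b : Q.I) :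
    2 * ∑ i, (H lam i a : ℤ) * H lam i b -
      ∑ i, ∑ j, Q.C i j * ((H lam i a : ℤ) * H lam j b) = 2 * H lam a b := by
  haveI := fd_all hADE lam
  have h : 2 * ∑ i, (H lam i a : ℤ) * (H lam i b : ℕ) =
      ∑ i, ∑ j, Q.C i j * ((H lam i a : ℤ) * (H lam j b : ℕ)) +
        (H lam a b : ℕ) + (H lam b a : ℕ) :=
    cb_quad (sat_gen Q lam) LinearMap.id (fun b => lift_self b) (fun x b => rfl) rfl a b
  rw [H_symm hADE b a] at h
  linarith

theorem H_ge (hADE : Q.IsADE) {N : Type*} [AddCommGroup N] [Module ℂ N] [FiniteDimensional ℂ N]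
    {gN : Q.Gen → Module.End ℂ N} (hN : Sat Q lam gN) (a : Q.I) :
    (dv gN a : ℤ) ≤ 2 * ∑ i, (H lam i a : ℤ) * dv gN i -
      ∑ i, ∑ j, Q.C i j * ((H lam i a : ℤ) * dv gN j) := by
  haveI := fd_all hADE lam
  exact cb_ge (sat_gen Q lam) LinearMap.id (fun b => lift_self b) (fun x b => rfl) rfl hN a

theorem H_lam (hADE : Q.IsADE) (a : Q.I) : ∑ i, lam i * (H lam i a : ℂ) = 0 := by
  haveI := fd_all hADE lam
  exact cb_lam (sat_gen Q lam) a

theorem H_total (hADE : Q.IsADE) :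
    Module.finrank ℂ (Q.Deformed lam) = ∑ a, ∑ i, H lam i a := by
  haveI := fd_all hADE lam
  exact cb_total (sat_gen Q lam)
end DPA

namespace DPA
set_option linter.unusedSimpArgs false
set_option linter.unusedVariables false
set_option linter.style.haveILetI false
open scoped BigOperators

variable {Q : ADEQuiver} {lam : Q.I → ℂ}

/-- elementary matrix possibly outside the index set -/
def em (S : Finset Q.I) (s t : Q.I) (c : ℂ) : Matrix S S ℂ :=
  fun p q => if p.1 = t ∧ q.1 = s then c else 0

theorem em_mul (S : Finset Q.I) (s t s' t' : Q.I) (c c' : ℂ) :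
    em S s t c * em S s' t' c' = if s = t' ∧ s ∈ S then em S s' t (c * c') else 0 := by
  ext p q
  rw [Matrix.mul_apply]
  by_cases hs : s ∈ S
  · rw [Finset.sum_eq_single ⟨s, hs⟩]
    · have e3 : ∀ (P : Prop) [Decidable P] (A : Matrix S S ℂ), (if P then A else 0) p q =
            if P then A p q else 0 := by
          intro P _ A; split_ifs <;> rfl
      rw [e3]
      have hs2 := hs
      by_cases h1 : s = t' <;> [rw [h1] at hs2; skip] <;> by_cases h2 : p.1 = t <;> by_cases h3 : q.1 = s' <;>
        simp [em, h1, h2, h3, hs, hs2]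
    · intro r _ hr
      have : r.1 ≠ s := fun h => hr (Subtype.ext h)
      simp [em, this]
    · simp
  · rw [if_neg (by tauto)]
    refine Finset.sum_eq_zero fun r _ => ?_
    have : r.1 ≠ s := fun h => hs (h ▸ r.2)
    simp [em, this]

theorem em_not (S : Finset Q.I) (s t : Q.I) (c : ℂ) (h : s ∉ S ∨ t ∉ S) : em S s t c = 0 := by
  ext p q
  rw [em, if_neg]; · rfl
  rintro ⟨h1, h2⟩
  rcases h with h | h
  · exact h (h2 ▸ q.2)
  · exact h (h1 ▸ p.2)

/-- thin modules -/
theorem thin (S : Finset Q.I) (w : Q.I → Q.I → ℂ) (hw : ∀ i j, w i j = - w j i)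
    (h : ∀ i ∈ S, ∑ j ∈ S, (Q.C i j : ℂ) * w i j = lam i) :
    ∃ g : Q.Gen → Module.End ℂ (S → ℂ), Sat Q lam g ∧ ∀ i, dv g i = if i ∈ S then 1 else 0 := by
  let th : Q.E ⊕ Q.E → ℂ := Sum.elim (fun _ => 1) (fun a => w (Q.tgt a) (Q.src a))
  let g : Q.Gen → Matrix S S ℂ := Sum.elim (fun i => em S i i 1)
    (fun x => em S (Q.dsrc x) (Q.dtgt x) (th x))
  have hg : Sat Q lam g := by
    constructor
    · intro i j
      simp only [g, Sum.elim_inl, em_mul]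
      by_cases hij : i = j
      · subst hij
        by_cases hi : i ∈ S
        · simp [hi]
        · simp [hi, em_not S i i 1 (Or.inl hi)]
      · simp [hij]
    · ext p q
      rw [Matrix.sum_apply]
      simp only [g, Sum.elim_inl, em]
      by_cases hpq : p = q
      · subst hpq; simp
      · have : p.1 ≠ q.1 := fun h => hpq (Subtype.ext h)
        rw [Matrix.one_apply_ne hpq]
        refine Finset.sum_eq_zero fun i _ => if_neg ?_
        rintro ⟨rfl, h2⟩; exact this h2.symm
    · intro x
      simp only [g, Sum.elim_inl, Sum.elim_inr, em_mul, mul_one, true_and]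
      split_ifs with hx
      · rfl
      · rw [em_not _ _ _ _ (Or.inl hx)]
    · intro x
      simp only [g, Sum.elim_inl, Sum.elim_inr, em_mul, one_mul, true_and]
      split_ifs with hx
      · rfl
      · rw [em_not _ _ _ _ (Or.inr hx)]
    · simp only [g, Sum.elim_inl, Sum.elim_inr, em_mul, dsrc, dtgt, th, true_and, one_mul, mul_one]
      ext p q
      rw [Matrix.sum_apply, Matrix.sum_apply]
      by_cases hpq : p = q
      · subst hpq
        have hR : ∑ i, (lam i • em S i i 1) p p = lam p := by
          rw [Finset.sum_eq_single p.1]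
          · simp [em]
          · intro b _ hb
            simp [em, hb.symm]
          · simp
        rw [hR, ← h p.1 p.2]
        have := sumC (Q := Q) (R := ℂ) (fun i => if i = p.1 then 1 else 0)
          (fun j => if j ∈ S then w p.1 j else 0)
        simp only [ite_mul, one_mul, zero_mul, mul_ite, mul_zero, Finset.sum_ite_irrel,
          Finset.sum_const_zero, Finset.sum_ite_eq', Finset.sum_ite_eq, Finset.mem_univ, if_true] at this
        rw [Fintype.sum_sum_type] at this
        simp only [dsrc, dtgt, Sum.elim_inl, Sum.elim_inr] at this
        have e2 : ∑ j ∈ S, (Q.C p.1 j : ℂ) * w p.1 j =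
            ∑ j, if j ∈ S then (Q.C p.1 j : ℂ) * w p.1 j else 0 := by
          rw [Finset.sum_ite_mem, Finset.univ_inter]
        have e5 : ∑ x, ∑ y, (if y ∈ S then if x = p.1 then (Q.C x y : ℂ) * w p.1 y else 0 else 0) =
            ∑ j, if j ∈ S then (Q.C p.1 j : ℂ) * w p.1 j else 0 := by
          rw [Finset.sum_comm]
          refine Finset.sum_congr rfl fun j _ => ?_
          split_ifs <;> simp
        rw [e5] at this
        rw [e2, ← this, ← Finset.sum_add_distrib]
        refine Finset.sum_congr rfl fun a _ => ?_
        rw [Matrix.sub_apply]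
        have e3 : ∀ (P : Prop) [Decidable P] (A : Matrix S S ℂ), (if P then A else 0) p p =
            if P then A p p else 0 := by
          intro P _ A; split_ifs <;> rfl
        rw [e3, e3]
        simp only [em, and_self]
        have e4 : ∀ a, (p : Q.I) = a ↔ a = p := fun a => eq_comm
        simp only [e4]
        by_cases h1 : Q.src a = p.1
        · by_cases h2 : Q.tgt a = p.1
          · have h0 : w p.1 p.1 = 0 := self_eq_neg.1 (hw _ _)
            simp [h1, h2, h0]
          · simp only [h1, h2, if_true, if_false, ite_self, zero_sub, add_zero]
            rw [hw]; split_ifs <;> simp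
        · by_cases h2 : Q.tgt a = p.1
          · simp [h1, h2]
          · simp [h1, h2]
      · have hne : p.1 ≠ q.1 := fun h => hpq (Subtype.ext h)
        rw [Finset.sum_eq_zero, Finset.sum_eq_zero]
        · intro i _
          simp only [Matrix.smul_apply, em]
          rw [if_neg]; · simp
          rintro ⟨rfl, h2⟩; exact hne h2.symm
        · intro a _
          rw [Matrix.sub_apply]
          have e3 : ∀ (P : Prop) [Decidable P] (i : Q.I) (c : ℂ), (if P then em S i i c else 0) p q = 0 := by
            intro P _ i c; split_ifs
            · rw [em, if_neg]
              rintro ⟨h1, h2⟩; exact hne (h1.trans h2.symm)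
            · rfl
          rw [e3, e3, sub_zero]
  have hM := hg.map (Matrix.toLinAlgEquiv' (R := ℂ) (n := S)).toAlgHom
  refine ⟨_, hM, fun i => ?_⟩
  have ht := trace_e hM i
  have : LinearMap.trace ℂ (S → ℂ) ((Matrix.toLinAlgEquiv' (R := ℂ) (n := S)).toAlgHom (g (Sum.inl i))) =
      ((if i ∈ S then 1 else 0 : ℕ) : ℂ) := by
    change LinearMap.trace ℂ (S → ℂ) (Matrix.toLin' (g (Sum.inl i))) = _
    rw [Matrix.trace_toLin'_eq, Matrix.trace]
    simp only [g, Sum.elim_inl, Matrix.diag, em, and_self]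
    by_cases hi : i ∈ S
    · rw [Finset.sum_eq_single ⟨i, hi⟩]
      · simp [hi]
      · intro r _ hr
        exact if_neg fun h => hr (Subtype.ext h)
      · simp
    · rw [Finset.sum_eq_zero]
      · simp [hi]
      · intro r _
        exact if_neg fun h : r.1 = i => hi (h ▸ r.2)
  rw [this] at ht
  exact_mod_cast ht.symm

theorem thin_ge (hADE : Q.IsADE) (S : Finset Q.I) (w : Q.I → Q.I → ℂ) (hw : ∀ i j, w i j = - w j i)
    (h : ∀ i ∈ S, ∑ j ∈ S, (Q.C i j : ℂ) * w i j = lam i) (a : Q.I) :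
    (if a ∈ S then 1 else 0 : ℤ) ≤ ∑ j ∈ S, (2 * (H lam j a : ℤ) - ∑ i, Q.C i j * (H lam i a : ℤ)) := by
  obtain ⟨g, hg, hd⟩ := thin (lam := lam) S w hw h
  have := H_ge hADE hg a
  simp only [hd, Nat.cast_ite, Nat.cast_one, Nat.cast_zero, mul_ite, mul_one, mul_zero] at this
  refine this.trans (le_of_eq ?_)
  rw [Finset.sum_sub_distrib, Finset.mul_sum, Finset.sum_comm (s := S)]
  simp only [Finset.sum_ite_mem, Finset.univ_inter, ← Finset.mul_sum]

end DPA

namespace DPA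
set_option linter.unusedSimpArgs false
set_option linter.unusedVariables false
set_option linter.style.haveILetI false
open scoped BigOperators
open Matrix

variable {Q : ADEQuiver} {lam : Q.I → ℂ}

/-- Cartan matrix -/
def Bm (Q : ADEQuiver) : Matrix Q.I Q.I ℤ := (2 : ℤ) • 1 - Q.C

/-- Hilbert matrix -/
noncomputable def Hm (lam : Q.I → ℂ) : Matrix Q.I Q.I ℤ := fun i a => (H lam i a : ℤ)

theorem Bm_mulVec (x : Q.I → ℤ) (i : Q.I) : (Bm Q *ᵥ x) i = 2 * x i - ∑ j, Q.C i j * x j := by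
  rw [Bm, Matrix.sub_mulVec, Matrix.smul_mulVec, Matrix.one_mulVec, Pi.sub_apply, Pi.smul_apply]
  rfl

theorem Bm_T : (Bm Q)ᵀ = Bm Q := by
  ext i j
  rw [Bm, Matrix.transpose_apply, Matrix.sub_apply, Matrix.sub_apply, Matrix.smul_apply, Matrix.smul_apply,
    Matrix.one_apply, Matrix.one_apply, C_symm i j]
  simp only [eq_comm (a := i)]

theorem Hm_T (hADE : Q.IsADE) : (Hm lam)ᵀ = Hm lam := by
  ext i j
  simp [Hm, Matrix.transpose_apply, H_symm hADE i j]

theorem Hm_quad (hADE : Q.IsADE) : Hm lam * Bm Q * Hm lam = (2 : ℤ) • Hm lam := by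
  ext a b
  have := H_quad (lam := lam) hADE a b
  rw [Matrix.mul_assoc, Matrix.mul_apply]
  have e : ∀ i, (Bm Q * Hm lam) i b = 2 * (H lam i b : ℤ) - ∑ j, Q.C i j * (H lam j b : ℤ) := by
    intro i
    have := Bm_mulVec (Q := Q) (fun j => (H lam j b : ℤ)) i
    exact this
  simp only [e, Matrix.smul_apply, smul_eq_mul]
  simp only [Hm]
  rw [← this]
  simp only [mul_sub, Finset.sum_sub_distrib, Finset.mul_sum]
  congr 1
  · refine Finset.sum_congr rfl fun i _ => ?_
    rw [H_symm hADE a i]; ring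
  · refine Finset.sum_congr rfl fun i _ => Finset.sum_congr rfl fun j _ => ?_
    rw [H_symm hADE a i]; ring

/-- the reflection -/
noncomputable def Rm (lam : Q.I → ℂ) : Matrix Q.I Q.I ℤ := Hm lam * Bm Q - 1

theorem Rm_isom (hADE : Q.IsADE) : (Rm lam)ᵀ * Bm Q * Rm lam = Bm Q := by
  have h := Hm_quad (lam := lam) hADE
  rw [Rm, Matrix.transpose_sub, Matrix.transpose_mul, Bm_T, Hm_T hADE, Matrix.transpose_one]
  have : (Bm Q * Hm lam - 1) * Bm Q * (Hm lam * Bm Q - 1) =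
    Bm Q * (Hm lam * Bm Q * Hm lam) * Bm Q - 2 • (Bm Q * Hm lam * Bm Q) + Bm Q := by noncomm_ring
  rw [this, h]
  noncomm_ring

theorem Rm_norm (hADE : Q.IsADE) (x : Q.I → ℤ) :
    (Rm lam *ᵥ x) ⬝ᵥ (Bm Q *ᵥ (Rm lam *ᵥ x)) = x ⬝ᵥ (Bm Q *ᵥ x) := by
  conv_rhs => rw [← Rm_isom (lam := lam) hADE]
  rw [← Matrix.mulVec_mulVec, ← Matrix.mulVec_mulVec, Matrix.dotProduct_mulVec x,
    Matrix.vecMul_transpose]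

/-- indicator vector -/
def ind (S : Finset Q.I) : Q.I → ℤ := fun i => if i ∈ S then 1 else 0

theorem Rm_ind_nonneg (hADE : Q.IsADE) (S : Finset Q.I) (w : Q.I → Q.I → ℂ)
    (hw : ∀ i j, w i j = - w j i)
    (h : ∀ i ∈ S, ∑ j ∈ S, (Q.C i j : ℂ) * w i j = lam i) (a : Q.I) :
    0 ≤ (Rm lam *ᵥ ind S) a := by
  have := thin_ge (lam := lam) hADE S w hw h a
  rw [Rm, Matrix.sub_mulVec, Matrix.one_mulVec, Pi.sub_apply, sub_nonneg]
  refine this.trans (le_of_eq ?_)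
  have e : Hm lam * Bm Q = (Bm Q * Hm lam)ᵀ := by
    rw [Matrix.transpose_mul, Bm_T, Hm_T hADE]
  rw [e, Matrix.mulVec, dotProduct]
  simp only [ind, mul_ite, mul_one, mul_zero, Finset.sum_ite_mem, Finset.univ_inter]
  refine Finset.sum_congr rfl fun j _ => ?_
  rw [Matrix.transpose_apply]
  have := Bm_mulVec (Q := Q) (fun i => (H lam i a : ℤ)) j
  refine Eq.trans ?_ this.symm
  simp only [C_symm j]

/-- upper bound and lower bound for the total dimension -/
theorem total_eq (hADE : Q.IsADE) (ρ : Q.I → ℝ) (hρ : ∀ i, 2 * ρ i - ∑ j, (Q.C i j : ℝ) * ρ j = 1)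
    {J : Type} (s : Finset J) (t : J → Q.I → ℤ) (c : J → ℝ)
    (ht : ∀ i, ρ i = ∑ j ∈ s, c j * (t j i : ℝ))
    (hle : ∑ i, ρ i ≤ ∑ j ∈ s, c j * ((∑ a, (Rm lam *ᵥ t j) a : ℤ) : ℝ)) :
    (Module.finrank ℂ (Q.Deformed lam) : ℝ) = 2 * ∑ i, ρ i := by
  set B : Matrix Q.I Q.I ℝ := (Bm Q).map (Int.cast : ℤ → ℝ) with hB
  set M : Matrix Q.I Q.I ℝ := (Hm lam).map (Int.cast : ℤ → ℝ) with hM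
  have hBv : ∀ (x : Q.I → ℝ) i, (B *ᵥ x) i = 2 * x i - ∑ j, (Q.C i j : ℝ) * x j := by
    intro x i
    simp only [hB, Matrix.mulVec, dotProduct, Matrix.map_apply, Bm, Matrix.sub_apply, Matrix.smul_apply,
      Matrix.one_apply, Int.cast_sub, sub_mul, Finset.sum_sub_distrib]
    simp
  have hBρ : B *ᵥ ρ = 1 := by
    ext i; rw [hBv, hρ]; rfl
  have hq : M * B * M = (2 : ℝ) • M := by
    have := congrArg (fun X => X.map (Int.castRingHom ℝ)) (Hm_quad (lam := lam) hADE)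
    simp only [Matrix.map_mul] at this
    rw [hM, hB]
    refine this.trans ?_
    ext i j
    rw [Matrix.map_apply, Matrix.smul_apply, Matrix.smul_apply]
    simp
  have hMT : Mᵀ = M := by
    rw [hM, ← Matrix.transpose_map, Hm_T hADE]
  have hBT : Bᵀ = B := by
    rw [hB, ← Matrix.transpose_map, Bm_T]
  have hD : (Module.finrank ℂ (Q.Deformed lam) : ℝ) = 1 ⬝ᵥ (M *ᵥ 1) := by
    rw [H_total hADE]
    push_cast
    rw [Finset.sum_comm]
    simp [dotProduct, Matrix.mulVec, hM, Hm]
  have hpos : 0 ≤ (M *ᵥ 1 - (2 : ℝ) • ρ) ⬝ᵥ (B *ᵥ (M *ᵥ 1 - (2 : ℝ) • ρ)) := by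
    refine (form_nonneg hADE (M *ᵥ 1 - (2 : ℝ) • ρ)).trans (le_of_eq ?_)
    simp only [dotProduct, hBv, mul_sub, Finset.sum_sub_distrib, Finset.mul_sum]
    congr 1
    · exact Finset.sum_congr rfl fun i _ => by ring
    · exact Finset.sum_congr rfl fun i _ => Finset.sum_congr rfl fun j _ => by ring
  have e1 : (M *ᵥ 1) ⬝ᵥ (B *ᵥ (M *ᵥ 1)) = 2 * (1 ⬝ᵥ (M *ᵥ 1)) := by
    have : (M *ᵥ 1) ⬝ᵥ (B *ᵥ (M *ᵥ 1)) = 1 ⬝ᵥ ((M * B * M) *ᵥ 1) := by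
      rw [← Matrix.mulVec_mulVec, ← Matrix.mulVec_mulVec, Matrix.dotProduct_mulVec 1 M,
        ← Matrix.mulVec_transpose, hMT]
    rw [this, hq, Matrix.smul_mulVec, dotProduct_smul, smul_eq_mul]
  have e2 : ∀ x, ρ ⬝ᵥ (B *ᵥ x) = 1 ⬝ᵥ x := by
    intro x
    rw [Matrix.dotProduct_mulVec, ← Matrix.mulVec_transpose, hBT, hBρ]
  rw [Matrix.mulVec_sub, Matrix.mulVec_smul, hBρ, sub_dotProduct, dotProduct_sub, dotProduct_sub,
    smul_dotProduct, smul_dotProduct, e1, e2, dotProduct_smul, dotProduct_smul,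
    dotProduct_comm (M *ᵥ 1) 1, dotProduct_comm ρ 1] at hpos
  simp only [smul_eq_mul] at hpos
  have e3 : (1 : Q.I → ℝ) ⬝ᵥ ρ = ∑ i, ρ i := by simp [dotProduct]
  rw [e3] at hpos
  have e4 : ∑ j ∈ s, c j * ((∑ a, (Rm lam *ᵥ t j) a : ℤ) : ℝ) = 1 ⬝ᵥ (M *ᵥ 1) - ∑ i, ρ i := by
    have hRr : ∀ j a, ((Rm lam *ᵥ t j) a : ℝ) = ((M * B - 1) *ᵥ (fun i => (t j i : ℝ))) a := by
      intro j a
      rw [Rm, Matrix.sub_mulVec, Matrix.sub_mulVec, Matrix.one_mulVec, Matrix.one_mulVec, Pi.sub_apply,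
        Pi.sub_apply]
      push_cast
      congr 1
      have : M * B = (Hm lam * Bm Q).map (Int.castRingHom ℝ) := by
        rw [Matrix.map_mul]; rfl
      rw [this]
      simp [Matrix.mulVec, dotProduct]
    have hρ' : ρ = ∑ j ∈ s, c j • (fun i => (t j i : ℝ)) := by
      ext i; rw [ht]; simp
    have : (M * B - 1) *ᵥ ρ = ∑ j ∈ s, c j • ((M * B - 1) *ᵥ (fun i => (t j i : ℝ))) := by
      conv_lhs => rw [hρ']
      rw [Matrix.mulVec_sum]
      simp only [Matrix.mulVec_smul]
    have h2 := congrArg (fun v => (1 : Q.I → ℝ) ⬝ᵥ v) this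
    simp only [dotProduct_sum, dotProduct_smul, smul_eq_mul] at h2
    rw [Matrix.sub_mulVec, Matrix.one_mulVec, ← Matrix.mulVec_mulVec, hBρ, dotProduct_sub, e3] at h2
    rw [h2]
    refine Finset.sum_congr rfl fun j _ => ?_
    congr 1
    push_cast
    simp only [hRr, dotProduct, Pi.one_apply, one_mul]
  rw [e4] at hle
  rw [hD]
  linarith

end DPA

namespace DPA
set_option linter.unusedSimpArgs false
set_option linter.unusedVariables false
set_option linter.style.haveILetI false
open scoped BigOperators
open Matrix

variable {Q : ADEQuiver} {lam : Q.I → ℂ}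

theorem sing_nonneg (hADE : Q.IsADE) (i : Q.I) (hi : lam i = 0) (a : Q.I) :
    0 ≤ (Rm lam *ᵥ ind {i}) a := by
  refine Rm_ind_nonneg hADE {i} (fun _ _ => 0) (by simp) ?_ a
  intro j hj
  rw [Finset.mem_singleton] at hj
  subst hj
  simp [hi]

theorem path_nonneg (hADE : Q.IsADE) (n : ℕ) (p : ℕ → Q.I)
    (hinj : ∀ a b, a < n → b < n → p a = p b → a = b)
    (hC : ∀ a b, a < n → b < n → Q.C (p a) (p b) = if a + 1 = b ∨ b + 1 = a then 1 else 0)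
    (hl : ∑ a ∈ Finset.range n, lam (p a) = 0) (x : Q.I) :
    0 ≤ (Rm lam *ᵥ ind ((Finset.range n).image p)) x := by
  classical
  have hsurj : ∃ q : Q.I → ℕ, ∀ a < n, q (p a) = a := by
    refine ⟨fun i => if h : ∃ a, a < n ∧ p a = i then h.choose else 0, fun a ha => ?_⟩
    have h : ∃ b, b < n ∧ p b = p a := ⟨a, ha, rfl⟩
    simp only [h, dif_pos]
    exact hinj _ _ h.choose_spec.1 ha h.choose_spec.2
  obtain ⟨q, hq⟩ := hsurj
  let P : ℕ → ℂ := fun a => ∑ k ∈ Finset.range a, lam (p k)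
  refine Rm_ind_nonneg hADE _ (fun i j => if q i + 1 = q j then P (q j) else
    if q j + 1 = q i then - P (q i) else 0) ?_ ?_ x
  · intro i j
    by_cases h1 : q i + 1 = q j
    · have h2 : ¬ (q j + 1 = q i) := by omega
      simp [h1, h2]
    · by_cases h2 : q j + 1 = q i
      · simp [h1, h2]
      · simp [h1, h2]
  · intro i hi
    obtain ⟨a, ha, rfl⟩ := Finset.mem_image.1 hi
    rw [Finset.mem_range] at ha
    rw [Finset.sum_image (fun b hb c hc h => hinj b c (by simpa using hb) (by simpa using hc) h)]
    have e : ∀ b ∈ Finset.range n, (Q.C (p a) (p b) : ℂ) * (if q (p a) + 1 = q (p b) then P (q (p b)) else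
        if q (p b) + 1 = q (p a) then - P (q (p a)) else 0) =
        (if b = a + 1 then P (a + 1) else 0) + (if b + 1 = a then - P a else 0) := by
      intro b hb
      rw [Finset.mem_range] at hb
      rw [hq a ha, hq b hb, hC a b ha hb]
      by_cases h1 : a + 1 = b
      · have h2 : ¬ (b + 1 = a) := by omega
        have h3 : b = a + 1 := h1.symm
        subst h3
        simp [h2]
      · have h3 : ¬ b = a + 1 := fun h => h1 h.symm
        by_cases h2 : b + 1 = a
        · simp [h1, h2, h3]
        · simp [h1, h2, h3]
    rw [Finset.sum_congr rfl e, Finset.sum_add_distrib, Finset.sum_ite_eq']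
    have e1 : (if a + 1 ∈ Finset.range n then P (a + 1) else 0) = P (a + 1) := by
      split_ifs with h
      · rfl
      · have : a + 1 = n := by rw [Finset.mem_range] at h; omega
        rw [this]; exact hl.symm
    have e2 : ∑ b ∈ Finset.range n, (if b + 1 = a then - P a else 0) = - P a := by
      rcases Nat.eq_zero_or_pos a with h0 | h0
      · subst h0; simp [P]
      · rw [Finset.sum_eq_single (a - 1)]
        · rw [if_pos (by omega)]
        · intro b _ hb; rw [if_neg (by omega)]
        · intro h; rw [Finset.mem_range] at h; omega
    rw [e1, e2]
    simp [P, Finset.sum_range_succ]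

theorem Bm_pos (hADE : Q.IsADE) (x : Q.I → ℤ) (hx : x ≠ 0) : 0 < x ⬝ᵥ (Bm Q *ᵥ x) := by
  have hx' : (fun i => (x i : ℝ)) ≠ 0 := by
    intro h; apply hx; ext i; have := congrFun h i; simpa using this
  have := form_pos hADE _ hx'
  have e : ((x ⬝ᵥ (Bm Q *ᵥ x) : ℤ) : ℝ) = 2 * ∑ i, (x i : ℝ) * x i - ∑ i, ∑ j, (Q.C i j : ℝ) * (x i * x j) := by
    simp only [dotProduct, Bm_mulVec, mul_sub, Finset.sum_sub_distrib, Finset.mul_sum]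
    push_cast
    congr 1
    · exact Finset.sum_congr rfl fun i _ => by ring
    · exact Finset.sum_congr rfl fun i _ => Finset.sum_congr rfl fun j _ => by ring
  rw [← e] at this
  exact_mod_cast this

theorem R_sum_pos (hADE : Q.IsADE) (x : Q.I → ℤ) (hx : x ≠ 0) (hn : ∀ a, 0 ≤ (Rm lam *ᵥ x) a) :
    1 ≤ ∑ a, (Rm lam *ᵥ x) a := by
  by_contra hcon
  have h0 : ∑ a, (Rm lam *ᵥ x) a = 0 :=
    le_antisymm (by omega) (Finset.sum_nonneg fun a _ => hn a)
  rw [Finset.sum_eq_zero_iff_of_nonneg (fun a _ => hn a)] at h0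
  have : Rm lam *ᵥ x = 0 := by ext a; exact h0 a (Finset.mem_univ _)
  have h1 := Rm_norm (lam := lam) hADE x
  rw [this] at h1
  have h2 := Bm_pos hADE x hx
  simp at h1
  omega

theorem ind_ne (S : Finset Q.I) (i : Q.I) (hi : i ∈ S) : ind S ≠ 0 := by
  intro h; have := congrFun h i; simp [ind, hi] at this

theorem sing_sum (hADE : Q.IsADE) (i : Q.I) (hi : lam i = 0) : 1 ≤ ∑ a, (Rm lam *ᵥ ind {i}) a :=
  R_sum_pos hADE _ (ind_ne _ i (by simp)) (sing_nonneg hADE i hi)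

/-- B is injective, so solutions are invariant -/
theorem rho_unique (hADE : Q.IsADE) (x y : Q.I → ℝ)
    (h : ∀ i, 2 * x i - ∑ j, (Q.C i j : ℝ) * x j = 2 * y i - ∑ j, (Q.C i j : ℝ) * y j) : x = y := by
  by_contra hne
  have := form_pos hADE (x - y) (sub_ne_zero.2 hne)
  have e : 2 * ∑ i, (x - y) i * (x - y) i - ∑ i, ∑ j, (Q.C i j : ℝ) * ((x - y) i * (x - y) j) =
      ∑ i, (x - y) i * (2 * (x - y) i - ∑ j, (Q.C i j : ℝ) * (x - y) j) := by
    simp only [mul_sub, Finset.sum_sub_distrib, Finset.mul_sum]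
    congr 1
    · exact Finset.sum_congr rfl fun i _ => by ring
    · exact Finset.sum_congr rfl fun i _ => Finset.sum_congr rfl fun j _ => by ring
  rw [e, Finset.sum_eq_zero] at this
  · exact lt_irrefl _ this
  · intro i _
    have := h i
    simp only [Pi.sub_apply, mul_sub, Finset.sum_sub_distrib]
    have e : 2 * x i - 2 * y i - (∑ j, (Q.C i j : ℝ) * x j - ∑ j, (Q.C i j : ℝ) * y j) = 0 := by linarith
    linear_combination (x i - y i) * e

theorem rho_pos (hADE : Q.IsADE) (ρ : Q.I → ℝ) (hρ : ∀ i, 2 * ρ i - ∑ j, (Q.C i j : ℝ) * ρ j = 1) :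
    ∀ i, 0 ≤ ρ i := by
  -- x = negative part
  let x : Q.I → ℝ := fun i => max (- ρ i) 0
  by_contra hcon
  push Not at hcon
  obtain ⟨k, hk⟩ := hcon
  have hx : x ≠ 0 := by
    intro h; have := congrFun h k; simp only [x, Pi.zero_apply, max_eq_right_iff] at this; linarith
  have hp := form_pos hADE x hx
  have hC : ∀ i j, (0 : ℝ) ≤ Q.C i j := by
    intro i j; rw [C]; exact_mod_cast (by positivity)
  have key : 2 * ∑ i, x i * x i - ∑ i, ∑ j, (Q.C i j : ℝ) * (x i * x j) ≤ - ∑ i, x i := by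
    have e : 2 * ∑ i, x i * x i - ∑ i, ∑ j, (Q.C i j : ℝ) * (x i * x j) =
      ∑ i, x i * (2 * x i - ∑ j, (Q.C i j : ℝ) * x j) := by
      simp only [mul_sub, Finset.sum_sub_distrib, Finset.mul_sum]
      congr 1
      · exact Finset.sum_congr rfl fun i _ => by ring
      · exact Finset.sum_congr rfl fun i _ => Finset.sum_congr rfl fun j _ => by ring
    rw [e, ← Finset.sum_neg_distrib]
    refine Finset.sum_le_sum fun i _ => ?_
    by_cases hi : 0 ≤ ρ i
    · have : x i = 0 := by simp [x, hi]
      simp [this]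
    · push Not at hi
      have h1 : x i = - ρ i := by simp [x, hi.le]
      have h2 : ∑ j, (Q.C i j : ℝ) * (- ρ j) ≤ ∑ j, (Q.C i j : ℝ) * x j :=
        Finset.sum_le_sum fun j _ => mul_le_mul_of_nonneg_left (le_max_left _ _) (hC i j)
      have h3 := hρ i
      simp only [mul_neg, Finset.sum_neg_distrib] at h2
      have h4 : 0 < x i := by rw [h1]; linarith
      nlinarith
  have : 0 ≤ ∑ i, x i := Finset.sum_nonneg fun i _ => le_max_right _ _
  linarith

theorem dim_zero (hADE : Q.IsADE) (ρ : Q.I → ℝ) (hρ : ∀ i, 2 * ρ i - ∑ j, (Q.C i j : ℝ) * ρ j = 1) :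
    (Module.finrank ℂ (Q.Deformed 0) : ℝ) = 2 * ∑ i, ρ i := by
  refine total_eq hADE ρ hρ Finset.univ (fun j => ind {j}) ρ ?_ ?_
  · intro i; simp [ind]
  · refine Finset.sum_le_sum fun i _ => ?_
    have h1 := sing_sum (lam := 0) hADE i rfl
    have h2 := rho_pos hADE ρ hρ i
    have h3 : (1 : ℝ) ≤ ((∑ a, (Rm (0 : Q.I → ℂ) *ᵥ ind {i}) a : ℤ) : ℝ) := by exact_mod_cast h1
    nlinarith

theorem R_even (hADE : Q.IsADE) (τ : Q.I → Q.I) (hτ : ∀ i, τ (τ i) = i)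
    (hs : ∀ i a, H lam (τ i) a = H lam i a) (x : Q.I → ℤ)
    (hx : ∀ i, (Bm Q *ᵥ x) (τ i) = (Bm Q *ᵥ x) i) (hf : ∀ i, τ i = i → Even ((Bm Q *ᵥ x) i)) (a : Q.I) :
    Even ((Rm lam *ᵥ x) a - x a) := by
  have e : Even ((Rm lam *ᵥ x) a + x a) := by
    rw [Rm, Matrix.sub_mulVec, Matrix.one_mulVec, Pi.sub_apply, sub_add_cancel, ← Matrix.mulVec_mulVec]
    rw [← ZMod.intCast_eq_zero_iff_even, Matrix.mulVec, dotProduct]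
    push_cast
    refine Finset.sum_involution (fun i _ => τ i) ?_ ?_ (fun i _ => Finset.mem_univ _) (fun i _ => hτ i)
    · intro i _
      have h1 : Hm lam a (τ i) = Hm lam a i := by
        simp only [Hm]; rw [H_symm hADE, hs, H_symm hADE]
      rw [h1, hx]
      exact CharTwo.add_self_eq_zero _
    · intro i _ hne h
      apply hne
      have := hf i h
      rw [← ZMod.intCast_eq_zero_iff_even] at this
      push_cast at this
      rw [this, mul_zero]
  have : (Rm lam *ᵥ x) a - x a = (Rm lam *ᵥ x) a + x a - 2 * x a := by ring
  rw [this]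
  exact e.sub (even_two_mul _)

/-- reduction to generic weights -/
theorem generic (hADE : Q.IsADE) (τ : Q.I → Q.I) (hτ : ∀ i, τ (τ i) = i) (hl : ∀ i, lam (τ i) = - lam i)
    (hgen : ∀ mu : Q.I → ℂ, (∀ i, mu (τ i) = - mu i) → (∀ i a, H mu (τ i) a = H mu i a) →
      Module.finrank ℂ (Q.Deformed mu) = Module.finrank ℂ (Q.Deformed 0)) :
    Module.finrank ℂ (Q.Deformed lam) = Module.finrank ℂ (Q.Deformed 0) := by
  classical
  let e : Q.I ≃ Fin (Fintype.card Q.I) := Fintype.equivFin Q.I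
  let L : Q.I → Polynomial ℂ := fun i => Polynomial.C (lam i) +
    Polynomial.X ^ ((e i : ℕ) + 1) - Polynomial.X ^ ((e (τ i) : ℕ) + 1)
  have h0 : (fun i => (L i).eval 0) = lam := by
    ext i; simp [L]
  have hco : ∀ (x : Q.I → ℤ) (i : Q.I), (∑ j, L j * Polynomial.C (x j : ℂ)).coeff ((e i : ℕ) + 1) =
      x i - x (τ i) := by
    intro x i
    rw [Polynomial.finsetSum_coeff]
    simp only [Polynomial.coeff_mul_C, L, Polynomial.coeff_sub, Polynomial.coeff_add,
      Polynomial.coeff_C_succ, Polynomial.coeff_X_pow, zero_add, sub_mul, ite_mul, one_mul, zero_mul,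
      Finset.sum_sub_distrib, Nat.add_right_cancel_iff, Fin.val_inj, e.injective.eq_iff]
    congr 1
    · simp
    · rw [Finset.sum_eq_single (τ i)]
      · simp [hτ]
      · intro b _ hb
        rw [if_neg]; intro h; apply hb; rw [h, hτ]
      · simp
  let bad : (Q.I → ℤ) → Set ℂ := fun x => if x ∘ τ = x then ∅ else
    {s | (∑ j, L j * Polynomial.C (x j : ℂ)).IsRoot s}
  have hbad : ∀ x, (bad x).Countable := by
    intro x
    simp only [bad]
    split_ifs with h
    · exact Set.countable_empty
    · apply Set.Finite.countable
      apply Polynomial.finite_setOfPred_isRoot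
      intro hz
      apply h
      ext i
      have := hco x i
      rw [hz, Polynomial.coeff_zero] at this
      have h2 : (x i : ℂ) = x (τ i) := (sub_eq_zero.1 this.symm)
      exact_mod_cast h2.symm
  have hU : (⋃ x, bad x).Countable := Set.countable_iUnion hbad
  have hinf : (⋃ x, bad x)ᶜ.Infinite := by
    intro hfin
    have : (Set.univ : Set ℂ).Countable := by
      rw [← Set.union_compl_self (⋃ x, bad x)]
      exact hU.union hfin.countable
    exact not_countable_complex this
  have := semicont (Q := Q) L hADE (hinf.mono ?_)
  · rw [h0] at this; exact this
  · intro s hs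
    refine hgen _ ?_ ?_
    · intro i; simp [L, hl, hτ]; ring
    · intro i a
      have h1 := H_lam (lam := fun i => (L i).eval s) hADE a
      by_contra hne
      apply hs
      rw [Set.mem_iUnion]
      refine ⟨fun i => (H (fun i => (L i).eval s) i a : ℤ), ?_⟩
      simp only [bad]
      rw [if_neg]
      · change Polynomial.eval s _ = 0
        rw [Polynomial.eval_finsetSum]
        simpa using h1
      · intro h
        have := congrFun h i
        simp only [Function.comp] at this
        exact hne (by exact_mod_cast this)

/-- antisymmetry transported from `ν` to a given involution -/
theorem anti_of {X : Type} (φ : Q.I → X) (hinv : Function.Involutive Q.nu) (hφ : ∀ i, φ (Q.nu i) = φ i)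
    (hanti : ∀ i, lam (Q.nu i) = - lam i) (τ : Q.I → Q.I) (hτ : ∀ i, τ (τ i) = i)
    (hf : ∀ i j, φ j = φ i → j = i ∨ j = τ i) (i : Q.I) : lam (τ i) = - lam i := by
  rcases hf i (Q.nu i) (hφ i) with h | h
  · have h0 : lam i = 0 := self_eq_neg.1 (by rw [← hanti, h])
    rcases hf (τ i) (Q.nu (τ i)) (hφ _) with h' | h'
    · have h1 : lam (τ i) = 0 := self_eq_neg.1 (by rw [← hanti, h'])
      rw [h0, h1, neg_zero]
    · rw [hτ] at h'
      have : τ i = i := hinv.injective (h'.trans h.symm)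
      rw [this, h0, neg_zero]
  · rw [← h, hanti]

end DPA

namespace DPA
set_option linter.unusedSimpArgs false
set_option linter.unusedVariables false
set_option linter.style.haveILetI false
open scoped BigOperators

open scoped Classical in
/-- positivity of a graph -/
def PosG {V : Type} [Fintype V] (G : SimpleGraph V) : Prop :=
  ∀ f : V → ℤ, (∀ u, 0 ≤ f u) → (∃ u, f u ≠ 0) →
    ∃ u, f u ≠ 0 ∧ ∑ b ∈ Finset.univ.filter (fun b => G.Adj u b), f b < 2 * f u

/-- labelling -/
def Lb {V : Type} (G : SimpleGraph V) (n : ℕ) (E : ℕ → ℕ → Prop) : Prop :=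
  ∃ (l : V → ℕ) (g : ℕ → V), (∀ u, l u < n) ∧ (∀ u, g (l u) = u) ∧ (∀ a < n, l (g a) = a) ∧
    ∀ u v, G.Adj u v ↔ E (l u) (l v)

/-- attach a vertex -/
def att (n : ℕ) (E : ℕ → ℕ → Prop) (p a b : ℕ) : Prop :=
  (a < n ∧ b < n ∧ E a b) ∨ (a = n ∧ b = p) ∨ (a = p ∧ b = n)

/-- path -/
def EP (a b : ℕ) : Prop := a + 1 = b ∨ b + 1 = a

/-- path with a pendant vertex -/
def ET (m k a b : ℕ) : Prop := att m EP k a b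

variable {V : Type} {G : SimpleGraph V}

theorem Lb.relabel {n : ℕ} {E E' : ℕ → ℕ → Prop} (h : Lb G n E) (s s' : ℕ → ℕ)
    (h1 : ∀ a < n, s a < n ∧ s' (s a) = a) (h2 : ∀ a < n, s' a < n ∧ s (s' a) = a)
    (hE : ∀ a b, a < n → b < n → (E a b ↔ E' (s a) (s b))) : Lb G n E' := by
  obtain ⟨l, g, hl, hgl, hlg, hA⟩ := h
  refine ⟨fun u => s (l u), fun a => g (s' a), fun u => (h1 _ (hl u)).1, fun u => ?_, fun a ha => ?_,
    fun u v => ?_⟩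
  · simp only [(h1 _ (hl u)).2, hgl]
  · simp only [hlg _ (h2 a ha).1, (h2 a ha).2]
  · rw [hA, hE _ _ (hl u) (hl v)]

theorem Lb.excl [Fintype V] {n : ℕ} {E : ℕ → ℕ → Prop} (hp : PosG G) (h : Lb G n E) (f : ℕ → ℤ) (hf : ∀ a, 0 ≤ f a)
    (a0 : ℕ) (ha0 : a0 < n) (hne : f a0 ≠ 0)
    (hN : ∀ a < n, f a ≠ 0 → ∃ N : Finset ℕ, (∀ b ∈ N, b < n ∧ E a b) ∧ 2 * f a ≤ ∑ b ∈ N, f b) : False := by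
  classical
  obtain ⟨l, g, hl, hgl, hlg, hA⟩ := h
  obtain ⟨u, hu, hlt⟩ := hp (fun u => f (l u)) (fun u => hf _) ⟨g a0, by simpa [hlg a0 ha0] using hne⟩
  obtain ⟨N, hN1, hN2⟩ := hN (l u) (hl u) hu
  have : ∑ b ∈ N, f b ≤ ∑ b ∈ Finset.univ.filter (fun b => G.Adj u b), f (l b) := by
    have e : ∑ b ∈ N, f b = ∑ b ∈ N.image g, f (l b) := by
      rw [Finset.sum_image]
      · exact Finset.sum_congr rfl fun b hb => by rw [hlg b (hN1 b hb).1]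
      · intro b hb c hc hbc
        have := congrArg l hbc
        rwa [hlg b (hN1 b hb).1, hlg c (hN1 c hc).1] at this
    rw [e]
    apply Finset.sum_le_sum_of_subset_of_nonneg
    · intro x hx
      obtain ⟨b, hb, rfl⟩ := Finset.mem_image.1 hx
      rw [Finset.mem_filter, hA, hlg b (hN1 b hb).1]
      exact ⟨Finset.mem_univ _, (hN1 b hb).2⟩
    · intros; exact hf _
  have h3 : ∑ b ∈ Finset.univ.filter (fun b => G.Adj u b), f (l b) < 2 * f (l u) := by
    convert hlt
  omega

theorem attach {n : ℕ} {E : ℕ → ℕ → Prop} (v u : V) (huv : u ≠ v) (hu : ∀ w, G.Adj v w ↔ w = u)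
    (h : Lb (G.induce {v}ᶜ) n E) : ∃ p < n, Lb G (n + 1) (att n E p) := by
  classical
  obtain ⟨l, g, hl, hgl, hlg, hA⟩ := h
  have hne : ∀ a, (g a).1 ≠ v := fun a => (g a).2
  have hu' : u ∈ ({v}ᶜ : Set V) := huv
  refine ⟨l ⟨u, hu'⟩, hl _, fun w => if h : w = v then n else l ⟨w, h⟩,
    fun a => if a < n then (g a).1 else v, ?_, ?_, ?_, ?_⟩
  · intro w
    beta_reduce
    split_ifs with h
    · exact Nat.lt_succ_self _
    · exact (hl _).trans (Nat.lt_succ_self _)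
  · intro w
    by_cases h : w = v
    · simp [h]
    · simp only [h, dif_neg, not_false_iff, hl, if_true, hgl]
  · intro a ha
    by_cases h : a < n
    · simp only [h, if_true, hne a, dif_neg, not_false_iff]
      exact hlg a h
    · simp only [h, if_false, dif_pos]; omega
  · intro w x
    by_cases hw : w = v
    · subst hw
      by_cases hx : x = w
      · subst hx
        have := hl ⟨u, hu'⟩
        simp only [SimpleGraph.irrefl, dif_pos, att, false_iff]
        omega
      · rw [hu]
        simp only [dif_pos, hx, dif_neg, not_false_iff, att]
        have h1 := hl ⟨x, hx⟩
        have h2 := hl ⟨u, hu'⟩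
        constructor
        · rintro rfl; right; left; exact by simp
        · rintro (h | h | h)
          · omega
          · have := congrArg g h.2
            rw [hgl, hgl] at this
            exact congrArg Subtype.val this
          · omega
    · by_cases hx : x = v
      · subst hx
        rw [G.adj_comm, hu]
        simp only [dif_pos, hw, dif_neg, not_false_iff, att]
        have h1 := hl ⟨w, hw⟩
        have h2 := hl ⟨u, hu'⟩
        constructor
        · rintro rfl; right; right; exact by simp
        · rintro (h | h | h)
          · omega
          · omega
          · have := congrArg g h.1
            rw [hgl, hgl] at this
            exact congrArg Subtype.val this
      · simp only [hw, hx, dif_neg, not_false_iff, att]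
        have h1 := hl ⟨x, hx⟩
        have h2 := hl ⟨w, hw⟩
        have := hA ⟨w, hw⟩ ⟨x, hx⟩
        rw [SimpleGraph.induce_adj] at this
        simp only at this
        rw [this]
        constructor
        · intro h; exact Or.inl ⟨h2, h1, h⟩
        · rintro (h | h | h)
          · exact h.2.2
          · omega
          · omega

/-- final forms -/
def FinG (G : SimpleGraph V) : Prop :=
  (∃ n, 1 ≤ n ∧ Lb G n EP) ∨ (∃ m, 3 ≤ m ∧ Lb G (m + 1) (ET m 1)) ∨
    (∃ m, 5 ≤ m ∧ m ≤ 7 ∧ Lb G (m + 1) (ET m 2))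

theorem normT1 [Fintype V] {M K : ℕ} (hp : PosG G) (h : Lb G (M + 1) (ET M K)) (h1 : 1 ≤ K) (h2 : 2 * K + 1 ≤ M) :
    FinG G := by
  by_cases hK1 : K = 1
  · subst hK1; exact Or.inr (Or.inl ⟨M, by omega, h⟩)
  by_cases hK2 : K = 2
  · subst hK2
    by_cases hM : M ≤ 7
    · exact Or.inr (Or.inr ⟨M, by omega, hM, h⟩)
    · exfalso
      refine h.excl hp (fun a => if a = M then 3 else if a = 0 then 2 else if a = 1 then 4 else
        if a = 2 then 6 else if a = 3 then 5 else if a = 4 then 4 else if a = 5 then 3 else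
        if a = 6 then 2 else if a = 7 then 1 else 0) (fun a => by positivity) 0 (by omega)
        (by simp; split_ifs <;> omega) ?_
      intro a ha hfa
      have hM' : 8 ≤ M := by omega
      by_cases haM : a = M
      · subst haM
        refine ⟨{2}, by simp [ET, att, EP]; omega, ?_⟩
        have : ¬ (2 = a) := by omega
        simp [this]
      · have : a ≤ 7 := by
          by_contra hc
          rw [if_neg haM] at hfa
          have : ¬ a = 0 ∧ ¬ a = 1 ∧ ¬ a = 2 ∧ ¬ a = 3 ∧ ¬ a = 4 ∧ ¬ a = 5 ∧ ¬ a = 6 ∧ ¬ a = 7 := by omega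
          simp [this] at hfa
        have g0 : ¬ (0 = M) := by omega
        have g1 : ¬ (1 = M) := by omega
        have g2 : ¬ (2 = M) := by omega
        have g3 : ¬ (3 = M) := by omega
        have g4 : ¬ (4 = M) := by omega
        have g5 : ¬ (5 = M) := by omega
        have g6 : ¬ (6 = M) := by omega
        have g7 : ¬ (7 = M) := by omega
        have g8 : ¬ (M = 1) := by omega
        have g9 : ¬ (M = 3) := by omega
        interval_cases a
        · exact ⟨{1}, by simp [ET, att, EP]; omega, by simp [*]⟩
        · exact ⟨{0, 2}, by simp [ET, att, EP]; omega, by simp [*]⟩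
        · exact ⟨{1, 3, M}, by simp [ET, att, EP]; omega,
            by
              rw [Finset.sum_insert (by simp; omega), Finset.sum_insert (by simp; omega), Finset.sum_singleton]
              simp [*]⟩
        · exact ⟨{2, 4}, by simp [ET, att, EP]; omega, by simp [*]⟩
        · exact ⟨{3, 5}, by simp [ET, att, EP]; omega, by simp [*]⟩
        · exact ⟨{4, 6}, by simp [ET, att, EP]; omega, by simp [*]⟩
        · exact ⟨{5, 7}, by simp [ET, att, EP]; omega, by simp [*]⟩
        · exact ⟨{6}, by simp [ET, att, EP]; omega, by simp [*]⟩
  · exfalso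
    obtain ⟨f, hfM, hf1, hf2, hf0, hfn⟩ : ∃ f : ℕ → ℤ, f M = 2 ∧
        (∀ b, b ≠ M → K ≤ b + 3 → b ≤ K → f b = b + 4 - K) ∧
        (∀ b, b ≠ M → K ≤ b → b ≤ K + 3 → f b = K + 4 - b) ∧
        (∀ b, b ≠ M → (b + 3 < K ∨ K + 3 < b) → f b = 0) ∧ ∀ b, 0 ≤ f b := by
      refine ⟨fun a => if a = M then 2 else if a + 3 < K then 0 else if a ≤ K then (a : ℤ) + 4 - K
        else if a ≤ K + 3 then (K : ℤ) + 4 - a else 0, ?_, ?_, ?_, ?_, ?_⟩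
      · simp
      · intro b _ _ _; beta_reduce; split_ifs <;> omega
      · intro b _ _ _; beta_reduce; split_ifs <;> omega
      · intro b _ _; beta_reduce; split_ifs <;> omega
      · intro b; beta_reduce; split_ifs <;> omega
    refine h.excl hp f hfn M (by omega) (by omega) ?_
    intro a ha hfa
    by_cases haM : a = M
    · refine ⟨{K}, by simp [ET, att, EP]; omega, ?_⟩
      have := hf1 K (by omega) (by omega) (by omega)
      rw [Finset.sum_singleton, haM]
      omega
    · have hr : K ≤ a + 3 ∧ a ≤ K + 3 := by
        by_contra hc
        exact hfa (hf0 a haM (by omega))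
      by_cases hK : a = K
      · refine ⟨{K - 1, K + 1, M}, by simp [ET, att, EP]; omega, ?_⟩
        rw [Finset.sum_insert (by simp; omega), Finset.sum_insert (by simp; omega), Finset.sum_singleton]
        have e1 := hf1 a haM (by omega) (by omega)
        have e2 := hf1 (K - 1) (by omega) (by omega) (by omega)
        have e3 := hf2 (K + 1) (by omega) (by omega) (by omega)
        omega
      · by_cases he : a + 3 = K
        · refine ⟨{a + 1}, by simp [ET, att, EP]; omega, ?_⟩
          rw [Finset.sum_singleton]
          have e1 := hf1 a haM (by omega) (by omega)
          have e2 := hf1 (a + 1) (by omega) (by omega) (by omega)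
          omega
        · by_cases he2 : a = K + 3
          · refine ⟨{a - 1}, by simp [ET, att, EP]; omega, ?_⟩
            rw [Finset.sum_singleton]
            have e1 := hf2 a haM (by omega) (by omega)
            have e2 := hf2 (a - 1) (by omega) (by omega) (by omega)
            omega
          · refine ⟨{a - 1, a + 1}, by simp [ET, att, EP]; omega, ?_⟩
            rw [Finset.sum_insert (by simp <;> omega), Finset.sum_singleton]
            by_cases hlt : a < K
            · have e1 := hf1 a haM (by omega) (by omega)
              have e2 := hf1 (a - 1) (by omega) (by omega) (by omega)
              have e3 := hf1 (a + 1) (by omega) (by omega) (by omega)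
              omega
            · have e1 := hf2 a haM (by omega) (by omega)
              have e2 := hf2 (a - 1) (by omega) (by omega) (by omega)
              have e3 := hf2 (a + 1) (by omega) (by omega) (by omega)
              omega

theorem normT [Fintype V] {M K : ℕ} (hp : PosG G) (h : Lb G (M + 1) (ET M K)) (h1 : 1 ≤ K) (h2 : K + 2 ≤ M) :
    FinG G := by
  by_cases hK : 2 * K + 1 ≤ M
  · exact normT1 hp h h1 hK
  · refine normT1 (K := M - 1 - K) hp (h.relabel (fun a => if a = M then M else M - 1 - a)
      (fun a => if a = M then M else M - 1 - a) ?_ ?_ ?_) (by omega) (by omega)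
    · intro a ha; split_ifs <;> omega
    · intro a ha; split_ifs <;> omega
    · intro a b ha hb
      simp only [ET, att, EP]
      split_ifs <;> omega

end DPA

namespace DPA
set_option linter.all false
set_option linter.unusedVariables false
set_option linter.style.haveILetI false
open scoped BigOperators

variable {V : Type} {G : SimpleGraph V}

theorem exclD [Fintype V] {m k p lo hi : ℕ} (hp : PosG G) (h : Lb G (m + 2) (att (m + 1) (ET m k) p))
    (h1 : 1 ≤ lo) (h2 : hi + 2 ≤ m) (hlh : lo ≤ hi)
    (hkp : (lo = k ∧ hi = p) ∨ (lo = p ∧ hi = k)) : False := by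
  obtain ⟨f, hfm, hfv, hf1, hf2, hf0, hfn⟩ : ∃ f : ℕ → ℤ, f m = 1 ∧ f (m + 1) = 1 ∧
      (∀ b, b < m → (b + 1 = lo ∨ b = hi + 1) → f b = 1) ∧
      (∀ b, lo ≤ b → b ≤ hi → f b = 2) ∧
      (∀ b, b < m → (b + 1 < lo ∨ hi + 1 < b) → f b = 0) ∧ ∀ b, 0 ≤ f b := by
    refine ⟨fun a => if a = m ∨ a = m + 1 ∨ a + 1 = lo ∨ a = hi + 1 then 1 else
      if lo ≤ a ∧ a ≤ hi then 2 else 0, ?_, ?_, ?_, ?_, ?_, ?_⟩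
    · simp
    · simp
    · intro b _ _; beta_reduce; split_ifs <;> omega
    · intro b _ _; beta_reduce; split_ifs <;> omega
    · intro b _ _; beta_reduce; split_ifs <;> omega
    · intro b; beta_reduce; split_ifs <;> omega
  have fk : f k = 2 := hf2 k (by omega) (by omega)
  have fp : f p = 2 := hf2 p (by omega) (by omega)
  refine h.excl hp f hfn m (by omega) (by omega) ?_
  intro a ha hfa
  by_cases ham : a = m
  · refine ⟨{k}, ?_, by rw [Finset.sum_singleton, ham]; omega⟩
    simp [att, ET, EP] <;> omega
  by_cases hav : a = m + 1
  · refine ⟨{p}, ?_, by rw [Finset.sum_singleton, hav]; omega⟩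
    simp [att, ET, EP] <;> omega
  by_cases hal : a + 1 = lo
  · refine ⟨{lo}, ?_, by rw [Finset.sum_singleton, hf1 a (by omega) (by omega), hf2 lo (by omega) hlh]; norm_num⟩
    simp [att, ET, EP] <;> omega
  by_cases hah : a = hi + 1
  · refine ⟨{hi}, ?_, by rw [Finset.sum_singleton, hf1 a (by omega) (by omega), hf2 hi hlh le_rfl]; norm_num⟩
    simp [att, ET, EP] <;> omega
  by_cases hout : a + 1 < lo ∨ hi + 1 < a
  · exact absurd (hf0 a (by omega) hout) hfa
  have ea := hf2 a (by omega) (by omega)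
  have eL : f (a - 1) = if a = lo then 1 else 2 := by
    split_ifs
    · exact hf1 _ (by omega) (by omega)
    · exact hf2 _ (by omega) (by omega)
  have eR : f (a + 1) = if a = hi then 1 else 2 := by
    split_ifs
    · exact hf1 _ (by omega) (by omega)
    · exact hf2 _ (by omega) (by omega)
  by_cases hak : a = k
  · by_cases hap : a = p
    · refine ⟨{a - 1, a + 1, m, m + 1}, ?_, ?_⟩
      · simp [att, ET, EP] <;> omega
      · rw [Finset.sum_insert (by simp <;> omega), Finset.sum_insert (by simp <;> omega), Finset.sum_insert (by simp),
          Finset.sum_singleton, ea, eL, eR, hfm, hfv]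
        split_ifs <;> omega
    · refine ⟨{a - 1, a + 1, m}, ?_, ?_⟩
      · simp [att, ET, EP] <;> omega
      · rw [Finset.sum_insert (by simp <;> omega), Finset.sum_insert (by simp <;> omega),
          Finset.sum_singleton, ea, eL, eR, hfm]
        split_ifs <;> omega
  · by_cases hap : a = p
    · refine ⟨{a - 1, a + 1, m + 1}, ?_, ?_⟩
      · simp [att, ET, EP] <;> omega
      · rw [Finset.sum_insert (by simp <;> omega), Finset.sum_insert (by simp <;> omega),
          Finset.sum_singleton, ea, eL, eR, hfv]
        split_ifs <;> omega
    · refine ⟨{a - 1, a + 1}, ?_, ?_⟩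
      · simp [att, ET, EP] <;> omega
      · rw [Finset.sum_insert (by simp <;> omega), Finset.sum_singleton, ea, eL, eR]
        split_ifs <;> omega

theorem exclE [Fintype V] {m : ℕ} (hp : PosG G) (h : Lb G (m + 2) (att (m + 1) (ET m 2) m))
    (h1 : 5 ≤ m) : False := by
  obtain ⟨f, hfm, hfv, f0, f1, f2, f3, f4, hf0, hfn⟩ : ∃ f : ℕ → ℤ, f m = 2 ∧ f (m + 1) = 1 ∧
      f 0 = 1 ∧ f 1 = 2 ∧ f 2 = 3 ∧ f 3 = 2 ∧ f 4 = 1 ∧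
      (∀ b, b < m → 5 ≤ b → f b = 0) ∧ ∀ b, 0 ≤ f b := by
    refine ⟨fun a => if a = m then 2 else if a = m + 1 then 1 else if a < 5 then
      (if a ≤ 2 then (a : ℤ) + 1 else 5 - a) else 0, ?_, ?_, ?_, ?_, ?_, ?_, ?_, ?_, ?_⟩
    · simp
    · simp
    all_goals try intro b
    all_goals try intro _ _
    all_goals beta_reduce
    all_goals split_ifs <;> omega
  refine h.excl hp f hfn m (by omega) (by omega) ?_
  intro a ha hfa
  by_cases ham : a = m
  · refine ⟨{2, m + 1}, ?_, by rw [Finset.sum_insert (by simp; omega), Finset.sum_singleton, ham]; omega⟩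
    simp [att, ET, EP] <;> omega
  by_cases hav : a = m + 1
  · refine ⟨{m}, ?_, by rw [Finset.sum_singleton, hav]; omega⟩
    simp [att, ET, EP] <;> omega
  by_cases h5 : 5 ≤ a
  · exact absurd (hf0 a (by omega) h5) hfa
  obtain rfl | rfl | rfl | rfl | rfl : a = 0 ∨ a = 1 ∨ a = 2 ∨ a = 3 ∨ a = 4 := by omega
  · refine ⟨{1}, ?_, by rw [Finset.sum_singleton]; omega⟩
    simp [att, ET, EP] <;> omega
  · refine ⟨{0, 2}, ?_, by rw [Finset.sum_insert (by simp), Finset.sum_singleton]; omega⟩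
    simp [att, ET, EP] <;> omega
  · refine ⟨{1, 3, m}, ?_, by
      rw [Finset.sum_insert (by simp; omega), Finset.sum_insert (by simp; omega), Finset.sum_singleton]; omega⟩
    simp [att, ET, EP] <;> omega
  · refine ⟨{2, 4}, ?_, by rw [Finset.sum_insert (by simp), Finset.sum_singleton]; omega⟩
    simp [att, ET, EP] <;> omega
  · refine ⟨{3}, ?_, by rw [Finset.sum_singleton]; omega⟩
    simp [att, ET, EP] <;> omega

theorem stepA [Fintype V] {n p : ℕ} (hp : PosG G) (hpn : p < n) (h : Lb G (n + 1) (att n EP p)) : FinG G := by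
  by_cases h1 : p + 1 = n
  · refine Or.inl ⟨n + 1, by omega, h.relabel id id (fun a ha => ⟨ha, rfl⟩) (fun a ha => ⟨ha, rfl⟩) ?_⟩
    intro a b ha hb
    simp only [att, EP, id]; omega
  by_cases h0 : p = 0
  · refine Or.inl ⟨n + 1, by omega, h.relabel (fun a => if a = n then 0 else a + 1)
      (fun a => if a = 0 then n else a - 1) ?_ ?_ ?_⟩
    · intro a ha; grind
    · intro a ha; grind
    · intro a b ha hb
      simp only [att, EP]; split_ifs <;> simp <;> omega
  · exact normT hp h (by omega) (by omega)

theorem extendT {m k : ℕ} (hm : 1 ≤ m) (hk : k + 1 < m) (h : Lb G (m + 2) (att (m + 1) (ET m k) (m - 1))) :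
    Lb G (m + 1 + 1) (ET (m + 1) k) := by
  refine h.relabel (fun a => if a = m then m + 1 else if a = m + 1 then m else a)
    (fun a => if a = m then m + 1 else if a = m + 1 then m else a) ?_ ?_ ?_
  · intro a ha; grind
  · intro a ha; grind
  · intro a b ha hb
    simp only [att, ET, EP]; split_ifs <;> simp <;> omega

theorem extendL {m k : ℕ} (hk : k + 1 < m) (h : Lb G (m + 2) (att (m + 1) (ET m k) 0)) :
    Lb G (m + 1 + 1) (ET (m + 1) (k + 1)) := by
  refine h.relabel (fun a => if a = m + 1 then 0 else a + 1)
    (fun a => if a = 0 then m + 1 else a - 1) ?_ ?_ ?_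
  · intro a ha; grind
  · intro a ha; grind
  · intro a b ha hb
    simp only [att, ET, EP]; split_ifs <;> simp <;> omega

theorem extendP {m : ℕ} (hm : 3 ≤ m) (h : Lb G (m + 2) (att (m + 1) (ET m 1) m)) :
    Lb G (m + 1 + 1) (ET (m + 1) 2) := by
  refine h.relabel (fun a => if a = m + 1 then 0 else if a = m then 1 else if a = 0 then m + 1 else a + 1)
    (fun a => if a = 0 then m + 1 else if a = 1 then m else if a = m + 1 then 0 else a - 1) ?_ ?_ ?_
  · intro a ha; grind
  · intro a ha; grind
  · intro a b ha hb
    simp only [att, ET, EP]; split_ifs <;> simp <;> omega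

theorem stepD [Fintype V] {m p : ℕ} (hp : PosG G) (hpn : p < m + 1) (hm : 3 ≤ m)
    (h : Lb G (m + 2) (att (m + 1) (ET m 1) p)) : FinG G := by
  by_cases h1 : p = m - 1
  · subst h1
    exact normT hp (extendT (by omega) (by omega) h) (by omega) (by omega)
  by_cases h0 : p = 0
  · subst h0
    exact normT hp (extendL (by omega) h) (by omega) (by omega)
  by_cases h2 : p = m
  · subst h2
    exact normT hp (extendP (by omega) h) (by omega) (by omega)
  exact (exclD (lo := 1) (hi := p) hp h (by omega) (by omega) (by omega) (by omega)).elim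

theorem stepE [Fintype V] {m p : ℕ} (hp : PosG G) (hpn : p < m + 1) (hm : 5 ≤ m)
    (h : Lb G (m + 2) (att (m + 1) (ET m 2) p)) : FinG G := by
  by_cases h1 : p = m - 1
  · subst h1
    exact normT hp (extendT (by omega) (by omega) h) (by omega) (by omega)
  by_cases h0 : p = 0
  · subst h0
    exact normT hp (extendL (by omega) h) (by omega) (by omega)
  by_cases h2 : p = m
  · subst h2
    exact (exclE hp h hm).elim
  by_cases h3 : p = 1
  · exact (exclD (lo := 1) (hi := 2) hp h (by omega) (by omega) (by omega) (by omega)).elim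
  · exact (exclD (lo := 2) (hi := p) hp h (by omega) (by omega) (by omega) (by omega)).elim

theorem classify : ∀ (n : ℕ) (V : Type) [Fintype V] (G : SimpleGraph V), Fintype.card V = n →
    G.Connected → PosG G → FinG G := by
  classical
  intro n
  induction n using Nat.strong_induction_on with
  | _ n ih =>
    intro V _ G hn hG hp
    haveI := hG.nonempty
    obtain ⟨v, hv0, hv⟩ := hp (fun _ => 1) (fun _ => by norm_num) ⟨Classical.arbitrary V, by norm_num⟩
    have hdeg : G.degree v ≤ 1 := by
      simp only [Finset.sum_const, smul_eq_mul, mul_one] at hv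
      have e : G.degree v = (Finset.univ.filter (fun b => G.Adj v b)).card := by
        rw [← SimpleGraph.card_neighborFinset_eq_degree]
        congr 1
        ext b; simp
      have : ((Finset.univ.filter (fun b => G.Adj v b)).card : ℤ) < 2 := by
        simpa using hv
      omega
    by_cases hone : ∀ w, w = v
    · refine Or.inl ⟨1, le_rfl, fun _ => 0, fun _ => v, by simp, fun u => (hone u).symm, ?_, ?_⟩
      · intro a ha; beta_reduce; omega
      · intro u w
        rw [hone u, hone w]
        simp [EP]
    · push Not at hone
      obtain ⟨w, hw⟩ := hone
      haveI : Nontrivial V := ⟨w, v, hw⟩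
      have hpos := hG.preconnected.degree_pos_of_nontrivial v
      have hd1 : G.degree v = 1 := by omega
      have hc := hG.induce_compl_singleton_of_degree_eq_one hd1
      obtain ⟨u, hu, huu⟩ := SimpleGraph.degree_eq_one_iff_existsUnique_adj.1 hd1
      have hu' : ∀ w, G.Adj v w ↔ w = u := fun w => ⟨fun h => huu w h, fun h => h ▸ hu⟩
      have hpos' : PosG (G.induce {v}ᶜ) := by
        intro f hf ⟨x, hx⟩
        obtain ⟨y, hy, hlt⟩ := hp (fun z => if h : z ∈ ({v}ᶜ : Set V) then f ⟨z, h⟩ else 0)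
          (fun z => by beta_reduce; split_ifs; exacts [hf _, le_rfl]) ⟨x.1, by
            have := x.2
            simp only [this, dif_pos]; exact hx⟩
        by_cases hyv : y ∈ ({v}ᶜ : Set V)
        · refine ⟨⟨y, hyv⟩, by simpa only [hyv, dif_pos] using hy, ?_⟩
          simp only [hyv, dif_pos] at hlt
          refine lt_of_le_of_lt (le_of_eq ?_) hlt
          rw [Finset.sum_filter, Finset.sum_filter]
          rw [← Finset.sum_subset (Finset.subset_univ (Finset.univ.filter (fun z => z ∈ ({v}ᶜ : Set V))))]
          · rw [Finset.sum_subtype (Finset.univ.filter (fun z => z ∈ ({v}ᶜ : Set V))) (p := fun z => z ∈ ({v}ᶜ : Set V))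
              (by simp)]
            refine Finset.sum_congr rfl fun z _ => ?_
            have := z.2
            simp only [this, dif_pos, SimpleGraph.induce_adj]
          · intro z _ hz
            have : z ∉ ({v}ᶜ : Set V) := by simpa using hz
            simp [this]
        · simp only [hyv, dif_neg, not_false_iff] at hy
          exact absurd rfl hy
      have hcard : Fintype.card ({v}ᶜ : Set V) < n := by
        rw [← hn]
        exact Fintype.card_lt_of_injective_of_notMem (b := v) Subtype.val Subtype.val_injective (by simp)
      have huv : u ≠ v := hu.ne'
      rcases ih _ hcard ({v}ᶜ : Set V) (G.induce {v}ᶜ) rfl hc hpos' with ⟨n, hn1, h⟩ | ⟨m, hm, h⟩ | ⟨m, hm, hm7, h⟩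
      · obtain ⟨p, hpn, h'⟩ := attach v u huv hu' h
        exact stepA hp hpn h'
      · obtain ⟨p, hpn, h'⟩ := attach v u huv hu' h
        exact stepD hp hpn hm h'
      · obtain ⟨p, hpn, h'⟩ := attach v u huv hu' h
        exact stepE hp hpn hm h'

end DPA

namespace DPA
set_option linter.all false
open scoped BigOperators

/-- labelled quiver -/
structure Lab (Q : ADEQuiver) (n : ℕ) (E : ℕ → ℕ → Prop) where
  l : Q.I → ℕ
  g : ℕ → Q.I
  hl : ∀ u, l u < n
  hgl : ∀ u, g (l u) = u
  hlg : ∀ a < n, l (g a) = a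
  h1 : ∀ i j, E (l i) (l j) → Q.C i j = 1
  h0 : ∀ i j, ¬ E (l i) (l j) → Q.C i j = 0

theorem C_nonneg {Q : ADEQuiver} (i j : Q.I) : 0 ≤ Q.C i j := by
  unfold ADEQuiver.C; positivity

theorem C_diag {Q : ADEQuiver} (hADE : Q.IsADE) (i : Q.I) : Q.C i i = 0 := by
  have h := form_pos hADE (Pi.single i 1) (by simp)
  simp only [Pi.single_apply, mul_ite, mul_one, mul_zero, Finset.sum_ite_eq', Finset.mem_univ, if_true,
    ite_mul, zero_mul, one_mul] at h
  simp at h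
  have h2 : Q.C i i < 2 := by exact_mod_cast h
  have h3 := C_nonneg i i
  have h4 : Even (Q.C i i) := by unfold ADEQuiver.C; exact ⟨_, rfl⟩
  obtain ⟨k, hk⟩ := h4
  omega

theorem C_le_one {Q : ADEQuiver} (hADE : Q.IsADE) (i j : Q.I) : Q.C i j ≤ 1 := by
  by_cases hij : i = j
  · subst hij; rw [C_diag hADE]; norm_num
  have h := form_pos hADE (Pi.single i 1 + Pi.single j 1) (by
    intro hc
    have := congrFun hc i
    simp [Pi.single_apply, hij] at this)
  have e1 : ∑ a, (Pi.single i 1 + Pi.single j 1 : Q.I → ℝ) a * (Pi.single i 1 + Pi.single j 1 : Q.I → ℝ) a = 2 := by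
    simp only [Pi.add_apply, Pi.single_apply, add_mul, mul_add, Finset.sum_add_distrib]
    have hji : ¬ j = i := fun h => hij h.symm
    simp [hij, hji]
    norm_num
  have e2 : ∑ a, ∑ b, (Q.C a b : ℝ) * ((Pi.single i 1 + Pi.single j 1 : Q.I → ℝ) a * (Pi.single i 1 + Pi.single j 1 : Q.I → ℝ) b)
     = 2 * Q.C i j := by
    simp only [Pi.add_apply, Pi.single_apply, add_mul, mul_add, Finset.sum_add_distrib]
    simp [C_diag hADE, C_symm j i]
    ring
  rw [e1, e2] at h
  have : Q.C i j < 2 := by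
    have : (Q.C i j : ℝ) < 2 := by linarith
    exact_mod_cast this
  omega

/-- the underlying graph -/
def gr (Q : ADEQuiver) : SimpleGraph Q.I where
  Adj i j := i ≠ j ∧ Q.C i j ≠ 0
  symm := ⟨fun i j h => ⟨h.1.symm, by rw [C_symm]; exact h.2⟩⟩
  loopless := ⟨fun i h => h.1 rfl⟩

theorem gr_adj {Q : ADEQuiver} (hADE : Q.IsADE) (i j : Q.I) : (gr Q).Adj i j ↔ Q.C i j ≠ 0 := by
  constructor
  · exact fun h => h.2
  · intro h
    refine ⟨?_, h⟩
    rintro rfl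
    exact h (C_diag hADE i)

theorem gr_conn {Q : ADEQuiver} (hADE : Q.IsADE) (hr : 1 ≤ Q.r) : (gr Q).Connected := by
  haveI : Nonempty Q.I := Fintype.card_pos_iff.1 hr
  refine ⟨?_⟩
  intro i j
  have := hADE.1 i j
  induction this with
  | refl => exact SimpleGraph.Reachable.refl _
  | @tail b c _ hbc ih =>
    refine ih.trans (SimpleGraph.Adj.reachable ?_)
    rw [gr_adj hADE]
    obtain ⟨e, he⟩ := hbc
    have : 0 < Q.C b c := by
      unfold ADEQuiver.C
      rcases he with he | he
      · have : 0 < (Finset.univ.filter fun e => Q.src e = b ∧ Q.tgt e = c).card :=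
          Finset.card_pos.2 ⟨e, by simpa using he⟩
        positivity
      · have : 0 < (Finset.univ.filter fun e => Q.src e = c ∧ Q.tgt e = b).card :=
          Finset.card_pos.2 ⟨e, by simpa using he⟩
        positivity
    omega

theorem gr_pos {Q : ADEQuiver} (hADE : Q.IsADE) : PosG (gr Q) := by
  classical
  intro f hf ⟨u, hu⟩
  by_contra hc
  push Not at hc
  have h := form_pos hADE (fun i => (f i : ℝ)) (by
    intro h
    have h' : (f u : ℝ) = 0 := congrFun h u
    exact hu (by exact_mod_cast h'))
  have h2 : 0 < 2 * ∑ i, f i * f i - ∑ i, ∑ j, Q.C i j * (f i * f j) := by exact_mod_cast h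
  have h3 : 2 * ∑ i, f i * f i - ∑ i, ∑ j, Q.C i j * (f i * f j) ≤ 0 := by
    rw [Finset.mul_sum, ← Finset.sum_sub_distrib]
    apply Finset.sum_nonpos
    intro i _
    have e : ∑ j, Q.C i j * (f i * f j) = f i * ∑ b ∈ Finset.univ.filter (fun b => (gr Q).Adj i b), f b := by
      rw [Finset.sum_filter, Finset.mul_sum]
      refine Finset.sum_congr rfl fun j _ => ?_
      have := C_le_one hADE i j
      have := C_nonneg i j
      by_cases h : (gr Q).Adj i j
      · have h' := (gr_adj hADE i j).1 h
        have : Q.C i j = 1 := by omega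
        rw [if_pos h, this, one_mul]
      · have h' : Q.C i j = 0 := by
          by_contra h'
          exact h ((gr_adj hADE i j).2 h')
        rw [if_neg h, h']; simp
    rw [e]
    by_cases hi : f i = 0
    · simp [hi]
    · have h5 := hc i hi
      have h6 : 2 * f i ≤ ∑ b ∈ Finset.univ.filter (fun b => (gr Q).Adj i b), f b := by
        convert h5
      have := mul_le_mul_of_nonneg_left h6 (hf i)
      nlinarith
  omega

theorem lab_of {Q : ADEQuiver} (hADE : Q.IsADE) {n : ℕ} {E : ℕ → ℕ → Prop} (h : Lb (gr Q) n E) :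
    Nonempty (Lab Q n E) := by
  obtain ⟨l, g, hl, hgl, hlg, hA⟩ := h
  refine ⟨⟨l, g, hl, hgl, hlg, fun i j h => ?_, fun i j h => ?_⟩⟩
  · have h' := (gr_adj hADE i j).1 ((hA i j).2 h)
    have := C_le_one hADE i j
    have := C_nonneg i j
    omega
  · by_contra hc
    exact h ((hA i j).1 ((gr_adj hADE i j).2 hc))

theorem ade_cases {Q : ADEQuiver} (hADE : Q.IsADE) (hr : 1 ≤ Q.r) :
    (∃ n, 1 ≤ n ∧ Nonempty (Lab Q n EP)) ∨ (∃ m, 3 ≤ m ∧ Nonempty (Lab Q (m + 1) (ET m 1))) ∨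
    (∃ m, 5 ≤ m ∧ m ≤ 7 ∧ Nonempty (Lab Q (m + 1) (ET m 2))) := by
  rcases classify _ Q.I (gr Q) rfl (gr_conn hADE hr) (gr_pos hADE) with ⟨n, h1, h⟩ | ⟨m, h1, h⟩ | ⟨m, h1, h2, h⟩
  · exact Or.inl ⟨n, h1, lab_of hADE h⟩
  · exact Or.inr (Or.inl ⟨m, h1, lab_of hADE h⟩)
  · exact Or.inr (Or.inr ⟨m, h1, h2, lab_of hADE h⟩)

namespace Lab
variable {Q : ADEQuiver} {n : ℕ} {E : ℕ → ℕ → Prop} (L : Lab Q n E)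

theorem linj {i j : Q.I} (h : L.l i = L.l j) : i = j := by
  rw [← L.hgl i, h, L.hgl]

theorem sum {M : Type*} [AddCommMonoid M] (f : Q.I → M) : ∑ i, f i = ∑ a ∈ Finset.range n, f (L.g a) := by
  refine Finset.sum_bij' (fun i _ => L.l i) (fun a _ => L.g a) ?_ ?_ ?_ ?_ ?_
  · intro i _; exact Finset.mem_range.2 (L.hl i)
  · intros; exact Finset.mem_univ _
  · intro i _; exact L.hgl i
  · intro a ha; exact L.hlg a (Finset.mem_range.1 ha)
  · intro i _; rw [L.hgl]

theorem sum' {M : Type*} [AddCommMonoid M] (f : ℕ → M) : ∑ i, f (L.l i) = ∑ a ∈ Finset.range n, f a := by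
  rw [L.sum]
  exact Finset.sum_congr rfl fun a ha => by rw [L.hlg a (Finset.mem_range.1 ha)]

theorem r_eq (L : Lab Q n E) : Q.r = n := by
  have := L.sum (fun _ => 1)
  simpa [ADEQuiver.r] using this

open scoped Classical in
theorem nb {R : Type*} [CommRing R] (y : ℕ → R) (i : Q.I) :
    ∑ j, (Q.C i j : R) * y (L.l j) = ∑ b ∈ Finset.range n, if E (L.l i) b then y b else 0 := by
  rw [← L.sum' (fun b => if E (L.l i) b then y b else 0)]
  refine Finset.sum_congr rfl fun j _ => ?_
  split_ifs with h
  · rw [L.h1 i j h]; simp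
  · rw [L.h0 i j h]; simp

end Lab

theorem nbP {Q : ADEQuiver} {n : ℕ} (L : Lab Q n EP) {R : Type*} [CommRing R] (y : ℕ → R) (i : Q.I) :
    ∑ j, (Q.C i j : R) * y (L.l j) =
      (if 0 < L.l i then y (L.l i - 1) else 0) + (if L.l i + 1 < n then y (L.l i + 1) else 0) := by
  classical
  rw [L.nb]
  have hi := L.hl i
  generalize L.l i = a at *
  have : ∀ b ∈ Finset.range n, (if EP a b then y b else 0) =
      (if a + 1 = b then y b else 0) + (if 0 < a then (if a - 1 = b then y b else 0) else 0) := by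
    intro b _
    unfold EP
    by_cases h1 : a + 1 = b
    · have h2 : ¬ (a - 1 = b) := by omega
      simp [h1, h2]
    · by_cases h3 : b + 1 = a
      · have h4 : a - 1 = b := by omega
        have h5 : 0 < a := by omega
        simp [h3, h4, h5]; intro h6; omega
      · by_cases h5 : 0 < a
        · have h4 : ¬ (a - 1 = b) := by omega
          simp [h1, h3, h4]
        · simp [h1, h3, h5]
  rw [Finset.sum_congr rfl this, Finset.sum_add_distrib, Finset.sum_ite_eq]
  rw [add_comm]
  congr 1
  · split_ifs with h
    · rw [Finset.sum_ite_eq, if_pos]; simp; omega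
    · simp
  · simp

theorem nbT {Q : ADEQuiver} {m k : ℕ} (L : Lab Q (m + 1) (ET m k)) (hk : k < m) {R : Type*} [CommRing R] (y : ℕ → R) (i : Q.I) :
    ∑ j, (Q.C i j : R) * y (L.l j) = if L.l i = m then y k else
      (if 0 < L.l i then y (L.l i - 1) else 0) + (if L.l i + 1 < m then y (L.l i + 1) else 0) +
       (if L.l i = k then y m else 0) := by
  classical
  rw [L.nb]
  have hi := L.hl i
  generalize L.l i = a at *
  rw [Finset.sum_range_succ]
  by_cases ham : a = m
  · subst ham
    rw [if_pos rfl, if_neg (by simp [ET, att]; omega), add_zero]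
    rw [Finset.sum_eq_single k]
    · rw [if_pos]; simp [ET, att]
    · intro b hb hbk
      rw [if_neg]; simp [ET, att]; have := Finset.mem_range.1 hb; omega
    · intro h; exact absurd (Finset.mem_range.2 hk) h
  rw [if_neg ham]
  congr 1
  · have : ∀ b ∈ Finset.range m, (if ET m k a b then y b else 0) =
      (if a + 1 = b then y b else 0) + (if 0 < a then (if a - 1 = b then y b else 0) else 0) := by
      intro b hb
      have hb' := Finset.mem_range.1 hb
      have e : ET m k a b ↔ EP a b := by
        simp only [ET, att, EP]; omega
      simp only [e]
      unfold EP
      by_cases h1 : a + 1 = b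
      · have h2 : ¬ (a - 1 = b) := by omega
        simp [h1, h2]
      · by_cases h3 : b + 1 = a
        · have h4 : a - 1 = b := by omega
          have h5 : 0 < a := by omega
          simp [h3, h4, h5]; intro h6; omega
        · by_cases h5 : 0 < a
          · have h4 : ¬ (a - 1 = b) := by omega
            simp [h1, h3, h4]
          · simp [h1, h3, h5]
    rw [Finset.sum_congr rfl this, Finset.sum_add_distrib, Finset.sum_ite_eq]
    rw [add_comm]
    congr 1
    · split_ifs with h
      · rw [Finset.sum_ite_eq, if_pos]; simp; omega
      · simp
    · simp
  · have e : ET m k a m ↔ a = k := by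
      simp only [ET, att, EP, and_true, lt_irrefl, false_and, and_false, false_or]; omega
    simp only [e]

end DPA

namespace DPA
set_option linter.all false
open scoped BigOperators
open Matrix

theorem eig_iff {Q : ADEQuiver} (hexp : Q.ExponentsSpec) (x : ℝ) :
    (∃ v : Q.I → ℝ, v ≠ 0 ∧ ∀ i, ∑ j, (Q.C i j : ℝ) * v j = x * v i) ↔
      ∃ i < Q.r, x = 2 * Real.cos (Q.m i * Real.pi / Q.h) := by
  have e1 : (∃ i < Q.r, x = 2 * Real.cos (Q.m i * Real.pi / Q.h)) ↔
      (Q.C.map (Int.cast : ℤ → ℝ)).charpoly.eval x = 0 := by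
    rw [hexp.1, Polynomial.eval_prod, Finset.prod_eq_zero_iff]
    simp only [Finset.mem_range, Polynomial.eval_sub, Polynomial.eval_X, Polynomial.eval_C, sub_eq_zero]
  rw [e1, Matrix.eval_charpoly, ← Matrix.exists_mulVec_eq_zero_iff]
  refine exists_congr fun v => and_congr_right fun _ => ?_
  rw [funext_iff]
  refine forall_congr' fun i => ?_
  rw [Matrix.sub_mulVec, Pi.sub_apply, Pi.zero_apply, sub_eq_zero]
  have e2 : (Matrix.scalar Q.I x *ᵥ v) i = x * v i := by
    simp [Matrix.scalar_apply, Matrix.mulVec_diagonal]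
  rw [e2]
  exact eq_comm

theorem cox {Q : ADEQuiver} (hexp : Q.ExponentsSpec) (h0 : ℕ) (hh0 : 2 ≤ h0) (v : Q.I → ℝ)
    (hv : ∀ i, 0 < v i) (hC : ∀ i, ∑ j, (Q.C i j : ℝ) * v j = 2 * Real.cos (Real.pi / h0) * v i) :
    Q.h = h0 := by
  obtain ⟨-, hmono, hm1, hr, hh⟩ := id hexp
  haveI : Nonempty Q.I := Fintype.card_pos_iff.1 hr
  have hh2 : 2 ≤ Q.h := by have := hm1 (Q.r - 1) (by omega); omega
  have pi := Real.pi_pos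
  have hposh : (0 : ℝ) < Q.h := by exact_mod_cast (by omega : 0 < Q.h)
  have hposh0 : (0 : ℝ) < h0 := by exact_mod_cast (by omega : 0 < h0)
  have hge : h0 ≤ Q.h := by
    obtain ⟨i, hi, he⟩ := (eig_iff hexp _).1 ⟨v, by
      intro hc
      have := hv (Classical.arbitrary _)
      rw [hc] at this
      exact lt_irrefl _ this, hC⟩
    have hmi := hm1 i hi
    have hml : Q.m i ≤ Q.h := by have := hmono i (Q.r - 1) (by omega) (by omega); omega
    have hmlR : (Q.m i : ℝ) ≤ Q.h := by exact_mod_cast hml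
    have hmiR : (1 : ℝ) ≤ Q.m i := by exact_mod_cast hmi
    have hh0R : (1 : ℝ) ≤ h0 := by exact_mod_cast (by omega : 1 ≤ h0)
    have := Real.injOn_cos (x₁ := Real.pi / h0) (x₂ := Q.m i * Real.pi / Q.h)
      ⟨by positivity, div_le_self pi.le hh0R⟩
      ⟨by positivity, by rw [div_le_iff₀ hposh]; nlinarith⟩ (by linarith)
    rw [div_eq_div_iff hposh0.ne' hposh.ne'] at this
    have h3 : (Q.h : ℝ) = Q.m i * h0 := by
      apply mul_left_cancel₀ pi.ne'
      linarith
    have h4 : Q.h = Q.m i * h0 := by exact_mod_cast h3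
    nlinarith
  have hle : Q.h ≤ h0 := by
    by_contra hlt
    push Not at hlt
    obtain ⟨u, hu, hCu⟩ := (eig_iff hexp (2 * Real.cos (Q.m (Q.r - 1) * Real.pi / Q.h))).2 ⟨Q.r - 1, by omega, rfl⟩
    have e : Real.cos (Q.m (Q.r - 1) * Real.pi / Q.h) = - Real.cos (Real.pi / Q.h) := by
      rw [← Real.cos_pi_sub]
      congr 1
      have : (Q.h : ℝ) = Q.m (Q.r - 1) + 1 := by exact_mod_cast hh
      field_simp
      rw [this]; ring
    rw [e] at hCu
    set c := Real.cos (Real.pi / Q.h) with hc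
    set c0 := Real.cos (Real.pi / h0) with hc0
    have hcc : c0 < c := by
      apply Real.strictAntiOn_cos
      · exact ⟨by positivity, by rw [div_le_iff₀ hposh]; have : (1:ℝ) ≤ Q.h := by exact_mod_cast (by omega : 1 ≤ Q.h)
                                 nlinarith⟩
      · exact ⟨by positivity, by rw [div_le_iff₀ hposh0]; have : (1:ℝ) ≤ h0 := by exact_mod_cast (by omega : 1 ≤ h0)
                                 nlinarith⟩
      · apply div_lt_div_of_pos_left pi hposh0
        exact_mod_cast hlt
    have hi : ∀ i, 2 * c * |u i| ≤ ∑ j, (Q.C i j : ℝ) * |u j| := by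
      intro i
      calc 2 * c * |u i| ≤ |2 * -c * u i| := by
            rw [abs_mul]
            apply mul_le_mul_of_nonneg_right _ (abs_nonneg _)
            have := neg_abs_le (2 * -c)
            linarith
        _ = |∑ j, (Q.C i j : ℝ) * u j| := by rw [hCu]
        _ ≤ ∑ j, |(Q.C i j : ℝ) * u j| := Finset.abs_sum_le_sum_abs _ _
        _ = _ := by
            refine Finset.sum_congr rfl fun j _ => ?_
            rw [abs_mul, abs_of_nonneg]
            exact_mod_cast C_nonneg i j
    have h1 : ∑ i, v i * (2 * c * |u i|) ≤ ∑ i, v i * ∑ j, (Q.C i j : ℝ) * |u j| :=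
      Finset.sum_le_sum fun i _ => mul_le_mul_of_nonneg_left (hi i) (hv i).le
    have h2 : ∑ i, v i * ∑ j, (Q.C i j : ℝ) * |u j| = ∑ j, (2 * c0 * v j) * |u j| := by
      simp_rw [Finset.mul_sum]
      rw [Finset.sum_comm]
      refine Finset.sum_congr rfl fun j _ => ?_
      rw [← hC j, Finset.sum_mul]
      refine Finset.sum_congr rfl fun i _ => ?_
      rw [C_symm]; ring
    obtain ⟨a, ha⟩ := Function.ne_iff.1 hu
    have h3 : 0 < ∑ i, v i * |u i| :=
      Finset.sum_pos' (fun i _ => mul_nonneg (hv i).le (abs_nonneg _)) ⟨a, Finset.mem_univ _, mul_pos (hv a) (abs_pos.2 ha)⟩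
    have h4 : ∑ i, v i * (2 * c * |u i|) = 2 * c * ∑ i, v i * |u i| := by
      rw [Finset.mul_sum]; exact Finset.sum_congr rfl fun i _ => by ring
    have h5 : ∑ i, (2 * c0 * v i) * |u i| = 2 * c0 * ∑ i, v i * |u i| := by
      rw [Finset.mul_sum]; exact Finset.sum_congr rfl fun i _ => by ring
    rw [h2, h4, h5] at h1
    nlinarith
  omega

end DPA

namespace DPA
set_option linter.all false
open scoped BigOperators
open Real

theorem sin_pos' {t : ℝ} {a : ℕ} {h : ℕ} (ha : 0 < a) (hah : a < h) (ht : t = π / h) : 0 < sin (a * t) := by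
  have hh : (0 : ℝ) < h := by exact_mod_cast (by omega : 0 < h)
  have ha' : (0 : ℝ) < a := by exact_mod_cast ha
  have hlt : (a : ℝ) < h := by exact_mod_cast hah
  have := pi_pos
  subst ht
  apply sin_pos_of_pos_of_lt_pi
  · positivity
  · rw [mul_div_assoc', div_lt_iff₀ hh]; nlinarith

theorem sin_rec (t x : ℝ) : sin (x * t - t) + sin (x * t + t) = 2 * cos t * sin (x * t) := by
  rw [sin_sub, sin_add]; ring

theorem coxA {Q : ADEQuiver} (hexp : Q.ExponentsSpec) {n : ℕ} (hn : 1 ≤ n) (L : Lab Q n EP) : Q.h = n + 1 := by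
  obtain ⟨t, ht⟩ : ∃ t : ℝ, t = π / ((n + 1 : ℕ) : ℝ) := ⟨_, rfl⟩
  refine cox hexp (n + 1) (by omega) (fun i => sin (((L.l i + 1 : ℕ) : ℝ) * t))
    (fun i => sin_pos' (Nat.succ_pos _) (by have := L.hl i; omega) ht) ?_
  intro i
  rw [nbP L (fun a => sin (((a + 1 : ℕ) : ℝ) * t)) i]
  have hi := L.hl i
  rw [← ht, ← sin_rec]
  generalize L.l i = a at *
  congr 1
  · split_ifs with h
    · congr 1
      rw [show a - 1 + 1 = a by omega]; push_cast; ring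
    · have : a = 0 := by omega
      subst this; simp
  · split_ifs with h
    · congr 1; push_cast; ring
    · have : a + 1 = n := by omega
      have e : (((a + 1 : ℕ) : ℝ) * t + t) = π := by
        rw [this, ht]; push_cast
        have : (n : ℝ) + 1 ≠ 0 := by positivity
        field_simp
      rw [e, sin_pi]

theorem coxT {Q : ADEQuiver} (hexp : Q.ExponentsSpec) {m k h0 : ℕ} (hk : 1 ≤ k) (hkm : k + 1 < m) (hm : m ≤ h0)
    (L : Lab Q (m + 1) (ET m k)) (t : ℝ) (ht : t = π / h0)
    (hcond : sin (k * t) / sin ((k + 1 : ℕ) * t) + sin ((m - k - 1 : ℕ) * t) / sin ((m - k : ℕ) * t) + sin t / sin (2 * t)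
      = 2 * cos t) : Q.h = h0 := by
  have p1 : 0 < sin ((k + 1 : ℕ) * t) := sin_pos' (by omega) (by omega) ht
  have p2 : 0 < sin ((m - k : ℕ) * t) := sin_pos' (by omega) (by omega) ht
  have p3 : 0 < sin (2 * t) := by exact_mod_cast sin_pos' (a := 2) (by omega) (by omega) ht
  have p4 : 0 < sin t := by simpa using sin_pos' (a := 1) (by omega) (by omega) ht
  obtain ⟨y, hym, hyl, hyr⟩ : ∃ y : ℕ → ℝ, y m = sin t / sin (2 * t) ∧
      (∀ a, a ≤ k → y a = sin ((a + 1 : ℕ) * t) / sin ((k + 1 : ℕ) * t)) ∧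
      (∀ a, k ≤ a → a < m → y a = sin ((m - a : ℕ) * t) / sin ((m - k : ℕ) * t)) := by
    refine ⟨fun a => if a = m then sin t / sin (2 * t) else if a ≤ k then sin ((a + 1 : ℕ) * t) / sin ((k + 1 : ℕ) * t)
      else sin ((m - a : ℕ) * t) / sin ((m - k : ℕ) * t), by simp, ?_, ?_⟩
    · intro a ha
      have : a ≠ m := by omega
      simp [this, ha]
    · intro a ha ham
      have : a ≠ m := by omega
      by_cases hak : a = k
      · subst hak
        simp only [this, if_false, le_refl, if_true]
        rw [div_self p1.ne', div_self p2.ne']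
      · have : ¬ a ≤ k := by omega
        simp [*]
  refine cox hexp h0 (by omega) (fun i => y (L.l i)) ?_ ?_
  · intro i
    have hi := L.hl i
    beta_reduce
    generalize L.l i = a at *
    by_cases ham : a = m
    · rw [ham, hym]; exact div_pos p4 p3
    · by_cases hak : a ≤ k
      · rw [hyl a hak]; exact div_pos (sin_pos' (by omega) (by omega) ht) p1
      · rw [hyr a (by omega) (by omega)]; exact div_pos (sin_pos' (by omega) (by omega) ht) p2
  · intro i
    rw [nbT L (by omega) y i, ← ht]
    have hi := L.hl i
    generalize L.l i = a at *
    by_cases ham : a = m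
    · rw [if_pos ham, ham, hym, hyl k le_rfl, div_self p1.ne', sin_two_mul]
      have : cos t ≠ 0 := by
        intro h; rw [sin_two_mul, h] at p3; simp at p3
      field_simp
    rw [if_neg ham]
    by_cases hak : a = k
    · subst hak
      rw [if_pos (by omega), if_pos (by omega), if_pos rfl, hym, hyl (a - 1) (by omega), hyr (a + 1) (by omega) (by omega),
        hyl a le_rfl, div_self p1.ne', mul_one, ← hcond, show a - 1 + 1 = a by omega, show m - (a + 1) = m - a - 1 by omega]
    · rw [if_neg hak, add_zero]
      by_cases hlt : a < k
      · rw [if_pos (by omega : a + 1 < m), hyl a hlt.le, hyl (a + 1) (by omega)]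
        have e : (if 0 < a then y (a - 1) else 0) = sin ((a : ℝ) * t) / sin ((k + 1 : ℕ) * t) := by
          split_ifs with h
          · rw [hyl _ (by omega), show a - 1 + 1 = a by omega]
          · have : a = 0 := by omega
            subst this; simp
        rw [e, ← add_div, mul_div_assoc', ← sin_rec]
        congr 3 <;> (push_cast; ring)
      · rw [if_pos (by omega : 0 < a), hyr a (by omega) (by omega), hyr (a - 1) (by omega) (by omega)]
        obtain ⟨b, hb⟩ : ∃ b, m = a + b + 1 := ⟨m - a - 1, by omega⟩
        have e : (if a + 1 < m then y (a + 1) else 0) = sin ((b : ℝ) * t) / sin ((m - k : ℕ) * t) := by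
          split_ifs with h
          · rw [hyr _ (by omega) (by omega), show m - (a + 1) = b by omega]
          · have : b = 0 := by omega
            subst this; simp
        rw [e, ← add_div, mul_div_assoc', ← sin_rec, add_comm, show m - a = b + 1 by omega, show m - (a - 1) = b + 2 by omega]
        congr 3 <;> (push_cast; ring)

theorem coxD {Q : ADEQuiver} (hexp : Q.ExponentsSpec) {m : ℕ} (hm : 3 ≤ m) (L : Lab Q (m + 1) (ET m 1)) : Q.h = 2 * m := by
  obtain ⟨t, ht⟩ : ∃ t : ℝ, t = π / ((2 * m : ℕ) : ℝ) := ⟨_, rfl⟩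
  refine coxT hexp le_rfl (by omega) (by omega) L t ht ?_
  have p3 : 0 < sin (2 * t) := by exact_mod_cast sin_pos' (a := 2) (by omega) (by omega) ht
  have p4 : 0 < sin t := by simpa using sin_pos' (a := 1) (by omega) (by omega) ht
  have hmt : (m : ℝ) * t = π / 2 := by
    rw [ht]; push_cast
    have : (m : ℝ) ≠ 0 := by positivity
    field_simp
  have e1 : ((m - 1 : ℕ) : ℝ) * t = π / 2 - t := by
    rw [Nat.cast_sub (by omega), sub_mul, hmt]; simp
  have e2 : ((m - 1 - 1 : ℕ) : ℝ) * t = π / 2 - 2 * t := by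
    rw [Nat.cast_sub (by omega), sub_mul, e1]; push_cast; ring
  rw [e1, e2, sin_pi_div_two_sub, sin_pi_div_two_sub]
  have hc : cos t ≠ 0 := by
    intro h; rw [sin_two_mul, h] at p3; simp at p3
  norm_num
  rw [sin_two_mul, cos_two_mul]
  field_simp
  ring

theorem sin3 (t : ℝ) : sin (3 * t) = sin t * (4 * cos t ^ 2 - 1) := by
  rw [sin_three_mul]
  have : sin t ^ 3 = sin t * (1 - cos t ^ 2) := by rw [← sin_sq]; ring
  rw [this]; ring

theorem sin4 (t : ℝ) : sin (4 * t) = sin t * (2 * cos t * (4 * cos t ^ 2 - 2)) := by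
  rw [show 4 * t = 2 * (2 * t) by ring, sin_two_mul, sin_two_mul, cos_two_mul]; ring

theorem sin5 (t : ℝ) : sin (5 * t) = sin t * (16 * cos t ^ 4 - 12 * cos t ^ 2 + 1) := by
  have := sin_rec t 4
  rw [show 4 * t - t = 3 * t by ring, show 4 * t + t = 5 * t by ring, sin3, sin4] at this
  linear_combination this

theorem absE (s c A X Y : ℝ) (hs : s ≠ 0) (hc : c ≠ 0) (hA : A ≠ 0) (hY : Y ≠ 0)
    (h : 4 * c ^ 2 * Y + 2 * c * X * A + A * Y = 4 * c ^ 2 * A * Y) :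
    2 * s * c / (s * A) + s * X / (s * Y) + s / (2 * s * c) = 2 * c := by
  field_simp
  linear_combination h

theorem cox6 {Q : ADEQuiver} (hexp : Q.ExponentsSpec) (L : Lab Q (5 + 1) (ET 5 2)) : Q.h = 12 := by
  obtain ⟨t, ht⟩ : ∃ t : ℝ, t = π / ((12 : ℕ) : ℝ) := ⟨_, rfl⟩
  refine coxT hexp (by norm_num) (by omega) (by omega) L t ht ?_
  have p2 : 0 < sin (2 * t) := by exact_mod_cast sin_pos' (a := 2) (by omega) (by omega) ht
  have p3 : 0 < sin (3 * t) := by exact_mod_cast sin_pos' (a := 3) (by omega) (by omega) ht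
  have p1 : 0 < sin t := by simpa using sin_pos' (a := 1) (by omega) (by omega) ht
  norm_num
  have hd : cos (2 * t) ^ 2 = 3 / 4 := by
    rw [ht, show 2 * (π / ((12 : ℕ) : ℝ)) = π / 6 by push_cast; ring, cos_pi_div_six, div_pow, sq_sqrt] <;> norm_num
  rw [cos_two_mul] at hd
  rw [sin3] at *
  rw [sin_two_mul] at *
  have h2 : cos t ≠ 0 := by intro h; rw [h] at p2; simp at p2
  have h3 : 4 * cos t ^ 2 - 1 ≠ 0 := by intro h; rw [h] at p3; simp at p3
  rw [show 2 * sin t * cos t / (sin t * (4 * cos t ^ 2 - 1)) + 2 * sin t * cos t / (sin t * (4 * cos t ^ 2 - 1)) =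
    2 * sin t * cos t / (sin t * (4 * cos t ^ 2 - 1)) + sin t * (2 * cos t) / (sin t * (4 * cos t ^ 2 - 1)) by ring]
  apply absE _ _ _ _ _ p1.ne' h2 h3 h3
  linear_combination (-4) * (4 * cos t ^ 2 - 1) * hd

theorem cox7 {Q : ADEQuiver} (hexp : Q.ExponentsSpec) (L : Lab Q (6 + 1) (ET 6 2)) : Q.h = 18 := by
  obtain ⟨t, ht⟩ : ∃ t : ℝ, t = π / ((18 : ℕ) : ℝ) := ⟨_, rfl⟩
  refine coxT hexp (by norm_num) (by omega) (by omega) L t ht ?_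
  have p2 : 0 < sin (2 * t) := by exact_mod_cast sin_pos' (a := 2) (by omega) (by omega) ht
  have p3 : 0 < sin (3 * t) := by exact_mod_cast sin_pos' (a := 3) (by omega) (by omega) ht
  have p4 : 0 < sin (4 * t) := by exact_mod_cast sin_pos' (a := 4) (by omega) (by omega) ht
  have p1 : 0 < sin t := by simpa using sin_pos' (a := 1) (by omega) (by omega) ht
  norm_num
  have hd : 4 * cos (2 * t) ^ 3 - 3 * cos (2 * t) = 1 / 2 := by
    rw [← cos_three_mul, ht, show 3 * (2 * (π / ((18 : ℕ) : ℝ))) = π / 3 by push_cast; ring, cos_pi_div_three]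
  rw [cos_two_mul] at hd
  rw [sin3, sin4] at *
  rw [sin_two_mul] at *
  have h2 : cos t ≠ 0 := by intro h; rw [h] at p2; simp at p2
  have h3 : 4 * cos t ^ 2 - 1 ≠ 0 := by intro h; rw [h] at p3; simp at p3
  have h4 : 4 * cos t ^ 2 - 2 ≠ 0 := by intro h; rw [h] at p4; simp at p4
  apply absE _ _ _ _ _ p1.ne' h2 h3 (mul_ne_zero (mul_ne_zero two_ne_zero h2) h4)
  linear_combination (-4) * cos t * hd

theorem cox8 {Q : ADEQuiver} (hexp : Q.ExponentsSpec) (L : Lab Q (7 + 1) (ET 7 2)) : Q.h = 30 := by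
  obtain ⟨t, ht⟩ : ∃ t : ℝ, t = π / ((30 : ℕ) : ℝ) := ⟨_, rfl⟩
  refine coxT hexp (by norm_num) (by omega) (by omega) L t ht ?_
  have p2 : 0 < sin (2 * t) := by exact_mod_cast sin_pos' (a := 2) (by omega) (by omega) ht
  have p3 : 0 < sin (3 * t) := by exact_mod_cast sin_pos' (a := 3) (by omega) (by omega) ht
  have p4 : 0 < sin (5 * t) := by exact_mod_cast sin_pos' (a := 5) (by omega) (by omega) ht
  have p1 : 0 < sin t := by simpa using sin_pos' (a := 1) (by omega) (by omega) ht
  norm_num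
  have hd : (2 * cos (2 * t)) ^ 4 + (2 * cos (2 * t)) ^ 3 - 4 * (2 * cos (2 * t)) ^ 2 - 4 * (2 * cos (2 * t)) + 1 = 0 := by
    obtain ⟨u, hu⟩ : ∃ u, u = 2 * t := ⟨_, rfl⟩
    rw [← hu]
    have c3 := cos_three_mul u
    have c4 : cos (4 * u) = 2 * (2 * cos u ^ 2 - 1) ^ 2 - 1 := by
      rw [show 4 * u = 2 * (2 * u) by ring, cos_two_mul, cos_two_mul]
    have e3 : 3 * u = π / 5 := by rw [hu, ht]; push_cast; ring
    have e4 : 4 * u = π / 6 + 3 * (π / 30) := by rw [hu, ht]; push_cast; ring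
    have e1 : u = π / 6 - 3 * (π / 30) := by rw [hu, ht]; push_cast; ring
    have h1 : cos (4 * u) - cos u = - sin (3 * (π / 30)) := by
      rw [e4, show cos u = cos (π / 6 - 3 * (π / 30)) by rw [← e1]]
      rw [cos_add, cos_sub, sin_pi_div_six]; ring
    have h2 : sin (3 * (π / 30)) = 2 * cos (π / 5) ^ 2 - 1 := by
      rw [← cos_two_mul, ← cos_pi_div_two_sub]; congr 1; ring
    have h5 : cos (π / 5) ^ 2 = (cos (π / 5)) / 2 + 1 / 4 := by
      rw [cos_pi_div_five]
      have : √5 ^ 2 = (5 : ℝ) := sq_sqrt (by norm_num)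
      linear_combination this / 16
    rw [e3] at c3
    linear_combination (-2) * c4 - 2 * c3 + 2 * h1 - 2 * h2 - 4 * h5
  rw [cos_two_mul] at hd
  rw [sin3, sin4, sin5] at *
  rw [sin_two_mul] at *
  have h2 : cos t ≠ 0 := by intro h; rw [h] at p2; simp at p2
  have h3 : 4 * cos t ^ 2 - 1 ≠ 0 := by intro h; rw [h] at p3; simp at p3
  have h4 : 16 * cos t ^ 4 - 12 * cos t ^ 2 + 1 ≠ 0 := by intro h; rw [h] at p4; simp at p4
  apply absE _ _ _ _ _ p1.ne' h2 h3 h4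
  linear_combination (-1) * hd

end DPA

namespace DPA
set_option linter.all false
open scoped BigOperators

/-- rho values type A -/
noncomputable def yA (n a : ℕ) : ℝ := ((a : ℝ) + 1) * ((n : ℝ) - a) / 2

theorem rhoA {Q : ADEQuiver} {n : ℕ} (L : Lab Q n EP) (i : Q.I) :
    2 * yA n (L.l i) - ∑ j, (Q.C i j : ℝ) * yA n (L.l j) = 1 := by
  rw [nbP L (yA n) i]
  have hi := L.hl i
  generalize L.l i = a at *
  have e1 : (if 0 < a then yA n (a - 1) else 0) = (a : ℝ) * ((n : ℝ) - a + 1) / 2 := by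
    split_ifs with h
    · obtain ⟨b, rfl⟩ : ∃ b, a = b + 1 := ⟨a - 1, by omega⟩
      simp only [yA, Nat.add_sub_cancel]; push_cast; ring
    · have : a = 0 := by omega
      simp [this]
  have e2 : (if a + 1 < n then yA n (a + 1) else 0) = ((a : ℝ) + 2) * ((n : ℝ) - a - 1) / 2 := by
    split_ifs with h
    · simp only [yA]; push_cast; ring
    · have : n = a + 1 := by omega
      subst this; push_cast; ring
  rw [e1, e2, yA]; ring

theorem sumA (n N : ℕ) : ∑ a ∈ Finset.range n, ((a : ℝ) + 1) * ((N : ℝ) - a) / 2 =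
    (N : ℝ) * n * (n + 1) / 4 - ((n : ℝ) - 1) * n * (n + 1) / 6 := by
  induction n with
  | zero => simp
  | succ n ih => rw [Finset.sum_range_succ, ih]; push_cast; ring

theorem dim_of {Q : ADEQuiver} (hADE : Q.IsADE) {n h : ℕ} {E : ℕ → ℕ → Prop} (L : Lab Q n E) (hh : Q.h = h) (y : ℕ → ℝ)
    (hy : ∀ i, 2 * y (L.l i) - ∑ j, (Q.C i j : ℝ) * y (L.l j) = 1)
    (hs : 12 * ∑ a ∈ Finset.range n, y a = n * h * (h + 1)) :
    6 * Module.finrank ℂ (Q.Deformed 0) = Q.r * Q.h * (Q.h + 1) := by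
  have h1 := dim_zero hADE (fun i => y (L.l i)) hy
  rw [L.sum' y] at h1
  rw [hh, L.r_eq]
  have : (6 * Module.finrank ℂ (Q.Deformed 0) : ℝ) = n * h * (h + 1) := by
    rw [h1, ← hs]; ring
  exact_mod_cast this

theorem dimA {Q : ADEQuiver} (hADE : Q.IsADE) (hexp : Q.ExponentsSpec) {n : ℕ} (hn : 1 ≤ n) (L : Lab Q n EP) :
    6 * Module.finrank ℂ (Q.Deformed 0) = Q.r * Q.h * (Q.h + 1) := by
  refine dim_of hADE L (coxA hexp hn L) (yA n) (rhoA L) ?_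
  have := sumA n n
  simp only [yA]
  rw [this]; push_cast; ring

/-- rho values type D -/
noncomputable def yD (m a : ℕ) : ℝ := if a = 0 ∨ a = m then (m : ℝ) * (m + 1) / 4 else ((m : ℝ) - a) * (m + 1 + a) / 2

theorem rhoD {Q : ADEQuiver} {m : ℕ} (hm : 3 ≤ m) (L : Lab Q (m + 1) (ET m 1)) (i : Q.I) :
    2 * yD m (L.l i) - ∑ j, (Q.C i j : ℝ) * yD m (L.l j) = 1 := by
  rw [nbT L (by omega) (yD m) i]
  have hi := L.hl i
  generalize L.l i = a at *
  by_cases h0 : a = 0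
  · subst h0
    have h1 : ¬ (0 = m) := by omega
    have h2 : ¬ (1 = m) := by omega
    have h3 : 1 < m := by omega
    simp [yD, h1, h2, h3]; ring
  by_cases hm' : a = m
  · subst hm'
    have h2 : ¬ (1 = a) := by omega
    simp [yD, h2]; ring
  by_cases h1 : a = 1
  · subst h1
    have h3 : 2 < m := by omega
    have h4 : ¬ (2 = m) := by omega
    simp [yD, hm', h3, h4]; ring
  have e0 : ¬ (a - 1 = 0 ∨ a - 1 = m) := by omega
  have e1 : (if a + 1 < m then yD m (a + 1) else 0) = ((m : ℝ) - a - 1) * (m + 2 + a) / 2 := by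
    split_ifs with h
    · rw [yD, if_neg (by omega)]; push_cast; ring
    · have : m = a + 1 := by omega
      subst this; push_cast; ring
  rw [if_neg hm', if_pos (by omega), if_neg h1, e1, yD, yD, if_neg e0, if_neg (by omega), Nat.cast_sub (by omega)]
  push_cast; ring

theorem sumD (n m : ℕ) : ∑ a ∈ Finset.range n, ((m : ℝ) - ((a + 1 : ℕ) : ℝ)) * (m + 1 + ((a + 1 : ℕ) : ℝ)) / 2 =
    (m : ℝ) * (m + 1) * n / 2 - (n : ℝ) * (n + 1) * (2 * n + 1) / 12 - (n : ℝ) * (n + 1) / 4 := by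
  induction n with
  | zero => simp
  | succ n ih => rw [Finset.sum_range_succ, ih]; push_cast; ring

theorem dimD {Q : ADEQuiver} (hADE : Q.IsADE) (hexp : Q.ExponentsSpec) {m : ℕ} (hm : 3 ≤ m) (L : Lab Q (m + 1) (ET m 1)) :
    6 * Module.finrank ℂ (Q.Deformed 0) = Q.r * Q.h * (Q.h + 1) := by
  refine dim_of hADE L (coxD hexp hm L) (yD m) (rhoD hm L) ?_
  obtain ⟨n, rfl⟩ : ∃ n, m = n + 1 := ⟨m - 1, by omega⟩
  rw [Finset.sum_range_succ, Finset.sum_range_succ']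
  have e : ∑ a ∈ Finset.range n, yD (n + 1) (a + 1) =
      ∑ a ∈ Finset.range n, (((n + 1 : ℕ) : ℝ) - ((a + 1 : ℕ) : ℝ)) * (((n + 1 : ℕ) : ℝ) + 1 + ((a + 1 : ℕ) : ℝ)) / 2 := by
    refine Finset.sum_congr rfl fun a ha => ?_
    have := Finset.mem_range.1 ha
    rw [yD, if_neg (by omega)]
  rw [e, sumD, yD, yD, if_pos (by simp), if_pos (by simp)]
  push_cast; ring

/-- rho values from lists -/
noncomputable def yL (l : List ℕ) (a : ℕ) : ℝ := (l.getD a 0 : ℕ) / 2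

theorem rho6 {Q : ADEQuiver} (L : Lab Q (5 + 1) (ET 5 2)) (i : Q.I) :
    2 * yL [16, 30, 42, 30, 16, 22] (L.l i) - ∑ j, (Q.C i j : ℝ) * yL [16, 30, 42, 30, 16, 22] (L.l j) = 1 := by
  rw [nbT L (by omega) (yL [16, 30, 42, 30, 16, 22]) i]
  have hi := L.hl i
  generalize L.l i = a at *
  interval_cases a <;> norm_num [yL]

theorem rho7 {Q : ADEQuiver} (L : Lab Q (6 + 1) (ET 6 2)) (i : Q.I) :
    2 * yL [34, 66, 96, 75, 52, 27, 49] (L.l i) - ∑ j, (Q.C i j : ℝ) * yL [34, 66, 96, 75, 52, 27, 49] (L.l j) = 1 := by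
  rw [nbT L (by omega) (yL [34, 66, 96, 75, 52, 27, 49]) i]
  have hi := L.hl i
  generalize L.l i = a at *
  interval_cases a <;> norm_num [yL]

theorem rho8 {Q : ADEQuiver} (L : Lab Q (7 + 1) (ET 7 2)) (i : Q.I) :
    2 * yL [92, 182, 270, 220, 168, 114, 58, 136] (L.l i) - ∑ j, (Q.C i j : ℝ) * yL [92, 182, 270, 220, 168, 114, 58, 136] (L.l j) = 1 := by
  rw [nbT L (by omega) (yL [92, 182, 270, 220, 168, 114, 58, 136]) i]
  have hi := L.hl i
  generalize L.l i = a at *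
  interval_cases a <;> norm_num [yL]

theorem dim6 {Q : ADEQuiver} (hADE : Q.IsADE) (hexp : Q.ExponentsSpec) (L : Lab Q (5 + 1) (ET 5 2)) :
    6 * Module.finrank ℂ (Q.Deformed 0) = Q.r * Q.h * (Q.h + 1) := by
  refine dim_of hADE L (cox6 hexp L) _ (rho6 L) ?_
  norm_num [yL, Finset.sum_range_succ]

theorem dim7 {Q : ADEQuiver} (hADE : Q.IsADE) (hexp : Q.ExponentsSpec) (L : Lab Q (6 + 1) (ET 6 2)) :
    6 * Module.finrank ℂ (Q.Deformed 0) = Q.r * Q.h * (Q.h + 1) := by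
  refine dim_of hADE L (cox7 hexp L) _ (rho7 L) ?_
  norm_num [yL, Finset.sum_range_succ]

theorem dim8 {Q : ADEQuiver} (hADE : Q.IsADE) (hexp : Q.ExponentsSpec) (L : Lab Q (7 + 1) (ET 7 2)) :
    6 * Module.finrank ℂ (Q.Deformed 0) = Q.r * Q.h * (Q.h + 1) := by
  refine dim_of hADE L (cox8 hexp L) _ (rho8 L) ?_
  norm_num [yL, Finset.sum_range_succ]

/-- invariance of rho -/
theorem rho_nu {Q : ADEQuiver} (hADE : Q.IsADE) (hnu : Q.NuSpec) (ρ : Q.I → ℝ)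
    (hρ : ∀ i, 2 * ρ i - ∑ j, (Q.C i j : ℝ) * ρ j = 1) (i : Q.I) : ρ (Q.nu i) = ρ i := by
  have := rho_unique hADE (fun i => ρ (Q.nu i)) ρ (by
    intro i
    rw [hρ i, ← hρ (Q.nu i)]
    congr 1
    rw [← (Function.Involutive.bijective hnu.1).sum_comp (fun j => (Q.C (Q.nu i) j : ℝ) * ρ j)]
    refine Finset.sum_congr rfl fun j _ => ?_
    rw [hnu.2.1])
  exact congrFun this i

theorem lam_zero {Q : ADEQuiver} {lam : Q.I → ℂ} (h : ∀ i, Q.nu i = i) (hanti : ∀ i, lam (Q.nu i) = -lam i) : lam = 0 := by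
  funext i
  have := hanti i
  rw [h i] at this
  have h2 : (2 : ℂ) * lam i = 0 := by linear_combination this
  simpa using h2

theorem eq78 {Q : ADEQuiver} {lam : Q.I → ℂ} (hADE : Q.IsADE) (hnu : Q.NuSpec) {n : ℕ} {E : ℕ → ℕ → Prop} (L : Lab Q n E)
    (hanti : ∀ i, lam (Q.nu i) = -lam i) (y : ℕ → ℝ) (hy : ∀ i, 2 * y (L.l i) - ∑ j, (Q.C i j : ℝ) * y (L.l j) = 1)
    (hinj : ∀ a b, a < n → b < n → y a = y b → a = b) : lam = 0 := by
  refine lam_zero (fun i => L.linj (hinj _ _ (L.hl _) (L.hl _) ?_)) hanti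
  exact rho_nu hADE hnu (fun i => y (L.l i)) hy i

theorem eq7 {Q : ADEQuiver} {lam : Q.I → ℂ} (hADE : Q.IsADE) (hnu : Q.NuSpec) (L : Lab Q (6 + 1) (ET 6 2))
    (hanti : ∀ i, lam (Q.nu i) = -lam i) : lam = 0 := by
  refine eq78 hADE hnu L hanti _ (rho7 L) ?_
  intro a b ha hb h
  rw [yL, yL, div_left_inj' two_ne_zero, Nat.cast_inj] at h
  revert h; revert b; revert a
  decide

theorem eq8 {Q : ADEQuiver} {lam : Q.I → ℂ} (hADE : Q.IsADE) (hnu : Q.NuSpec) (L : Lab Q (7 + 1) (ET 7 2))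
    (hanti : ∀ i, lam (Q.nu i) = -lam i) : lam = 0 := by
  refine eq78 hADE hnu L hanti _ (rho8 L) ?_
  intro a b ha hb h
  rw [yL, yL, div_left_inj' two_ne_zero, Nat.cast_inj] at h
  interval_cases a <;> interval_cases b <;> first | rfl | (exfalso; revert h; decide)

end DPA

namespace DPA
set_option linter.all false
open scoped BigOperators
open Matrix

theorem eq_of_ge {Q : ADEQuiver} {lam : Q.I → ℂ} (hADE : Q.IsADE) (ρ : Q.I → ℝ)
    (hρ : ∀ i, 2 * ρ i - ∑ j, (Q.C i j : ℝ) * ρ j = 1) {J : Type} (s : Finset J) (t : J → Q.I → ℤ) (c : J → ℝ)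
    (ht : ∀ i, ρ i = ∑ j ∈ s, c j * (t j i : ℝ))
    (hle : ∑ i, ρ i ≤ ∑ j ∈ s, c j * ((∑ a, (Rm lam *ᵥ t j) a : ℤ) : ℝ)) :
    Module.finrank ℂ (Q.Deformed lam) = Module.finrank ℂ (Q.Deformed 0) := by
  have h1 := total_eq hADE ρ hρ s t c ht hle
  have h2 := dim_zero hADE ρ hρ
  exact_mod_cast h1.trans h2.symm

def fA (n a b : ℕ) : ℤ := 2 * (if a ≤ b ∧ b + a < n then 1 else 0) -
        ((if 0 < b then (if a ≤ b - 1 ∧ b - 1 + a < n then 1 else 0) else 0) +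
         (if b + 1 < n then (if a ≤ b + 1 ∧ b + 1 + a < n then 1 else 0) else 0))
theorem fA1 (n a b : ℕ) (h : b < n) : fA n a (n - 1 - b) = fA n a b := by
  unfold fA
  have e1 : (a ≤ n-1-b ∧ n-1-b + a < n) ↔ (a ≤ b ∧ b + a < n) := by omega
  have e2 : (0 < n-1-b) ↔ b + 1 < n := by omega
  have e3 : n - 1 - b + 1 < n ↔ 0 < b := by omega
  simp only [e1, e2, e3]
  by_cases h1 : 0 < b <;> by_cases h2 : b + 1 < n <;> simp only [h1, h2, if_true, if_false]
  · have e4 : (a ≤ n-1-b-1 ∧ n-1-b-1 + a < n) ↔ (a ≤ b+1 ∧ b+1 + a < n) := by omega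
    have e5 : (a ≤ n-1-b+1 ∧ n-1-b+1 + a < n) ↔ (a ≤ b-1 ∧ b-1 + a < n) := by omega
    simp only [e4, e5]; ring
  · have e5 : (a ≤ n-1-b+1 ∧ n-1-b+1 + a < n) ↔ (a ≤ b-1 ∧ b-1 + a < n) := by omega
    simp only [e5]; ring
  · have e4 : (a ≤ n-1-b-1 ∧ n-1-b-1 + a < n) ↔ (a ≤ b+1 ∧ b+1 + a < n) := by omega
    simp only [e4]; ring
theorem fA2 (n a b : ℕ) (h : b < n) (h4 : n - 1 - b = b) : fA n a b % 2 = 0 := by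
  unfold fA
  split_ifs <;> omega

theorem eqA {Q : ADEQuiver} {lam : Q.I → ℂ} (hADE : Q.IsADE) (hnu : Q.NuSpec) {n : ℕ} (L : Lab Q n EP)
    (hanti : ∀ i, lam (Q.nu i) = -lam i) :
    Module.finrank ℂ (Q.Deformed lam) = Module.finrank ℂ (Q.Deformed 0) := by
  have hlτ : ∀ i, L.l (L.g (n - 1 - L.l i)) = n - 1 - L.l i := fun i => L.hlg _ (by have := L.hl i; omega)
  have hτ : ∀ i, (fun i => L.g (n - 1 - L.l i)) ((fun i => L.g (n - 1 - L.l i)) i) = i := by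
    intro i
    have := L.hl i
    apply L.linj
    simp only [hlτ]
    rw [L.hlg _ (by omega)]
    omega
  have hl : ∀ i, lam (L.g (n - 1 - L.l i)) = -lam i := by
    refine anti_of (fun i => yA n (L.l i)) hnu.1 (rho_nu hADE hnu _ (rhoA L)) hanti (fun i => L.g (n - 1 - L.l i)) hτ ?_
    intro i j h
    have h1 := L.hl i
    have h2 := L.hl j
    have h3 : ((L.l i : ℝ) - L.l j) * ((n : ℝ) - 1 - L.l i - L.l j) = 0 := by
      simp only [yA] at h
      linear_combination 2 * (-h)
    rcases mul_eq_zero.1 h3 with h4 | h4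
    · left
      apply L.linj
      have : (L.l j : ℝ) = L.l i := by linarith
      exact_mod_cast this
    · right
      apply L.linj
      rw [hlτ]
      have : ((L.l j + L.l i + 1 : ℕ) : ℝ) = n := by push_cast; linarith
      have : L.l j + L.l i + 1 = n := by exact_mod_cast this
      omega
  refine generic hADE _ hτ hl ?_
  intro mu hmu hH
  set t : ℕ → Q.I → ℤ := fun a => ind ((Finset.range (n - 2 * a)).image (fun b => L.g (a + b))) with ht
  have htv : ∀ a i, t a i = if a ≤ L.l i ∧ L.l i + a < n then 1 else 0 := by
    intro a i
    simp only [ht, ind]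
    have : (i ∈ (Finset.range (n - 2 * a)).image (fun b => L.g (a + b))) ↔ (a ≤ L.l i ∧ L.l i + a < n) := by
      simp only [Finset.mem_image, Finset.mem_range]
      constructor
      · rintro ⟨b, hb, rfl⟩
        rw [L.hlg _ (by omega)]; omega
      · intro h
        refine ⟨L.l i - a, by omega, ?_⟩
        rw [show a + (L.l i - a) = L.l i by omega, L.hgl]
    simp only [this]
  have hge : ∀ a, ∀ x, t a x ≤ (Rm mu *ᵥ t a) x := by
    intro a x
    have h1 : 0 ≤ (Rm mu *ᵥ t a) x := by
      refine path_nonneg hADE (n - 2 * a) (fun b => L.g (a + b)) ?_ ?_ ?_ x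
      · intro b c hb hc h
        have : L.l (L.g (a + b)) = L.l (L.g (a + c)) := congrArg L.l h
        rw [L.hlg _ (by omega), L.hlg _ (by omega)] at this
        omega
      · intro b c hb hc
        split_ifs with h
        · apply L.h1
          rw [L.hlg _ (by omega), L.hlg _ (by omega), EP]; omega
        · apply L.h0
          rw [L.hlg _ (by omega), L.hlg _ (by omega), EP]; omega
      · have h1 := Finset.sum_range_reflect (fun b => mu (L.g (a + b))) (n - 2 * a)
        have h2 : ∑ b ∈ Finset.range (n - 2 * a), mu (L.g (a + (n - 2 * a - 1 - b))) =
            ∑ b ∈ Finset.range (n - 2 * a), - mu (L.g (a + b)) := by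
          refine Finset.sum_congr rfl fun b hb => ?_
          have hb := Finset.mem_range.1 hb
          rw [← hmu, L.hlg _ (by omega)]
          congr 2; omega
        rw [h2, Finset.sum_neg_distrib] at h1
        have h3 : (2 : ℂ) * ∑ b ∈ Finset.range (n - 2 * a), mu (L.g (a + b)) = 0 := by linear_combination -h1
        simpa using h3
    have hB : ∀ i, (Bm Q *ᵥ t a) i = fA n a (L.l i) := by
      intro i
      rw [Bm_mulVec, htv, fA]
      congr 1
      have := nbP L (R := ℤ) (fun b => if a ≤ b ∧ b + a < n then 1 else 0) i
      simp only [Int.cast_id] at this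
      rw [← this]
      exact Finset.sum_congr rfl fun j _ => by rw [htv]
    have h2 : Even ((Rm mu *ᵥ t a) x - t a x) := by
      refine R_even hADE _ hτ hH (t a) ?_ ?_ x
      · intro i
        rw [hB, hB]
        simp only [hlτ]
        exact fA1 n a _ (L.hl i)
      · intro i hi
        rw [hB]
        have h4 := congrArg L.l hi
        simp only [hlτ] at h4
        rw [Int.even_iff]
        exact fA2 n a _ (L.hl i) h4
    have h3 := htv a x
    obtain ⟨k, hk⟩ := h2
    split_ifs at h3 <;> omega
  have hρt : ∀ i, yA n (L.l i) = ∑ a ∈ Finset.range ((n + 1) / 2), ((n : ℝ) - 2 * a) / 2 * (t a i : ℝ) := by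
    intro i
    simp only [htv]
    have hi := L.hl i
    generalize L.l i = b at *
    have key : ∀ N : ℕ, ∑ a ∈ Finset.range N, ((n : ℝ) - 2 * a) / 2 = (N : ℝ) * (n - N + 1) / 2 := by
      intro N
      induction N with
      | zero => simp
      | succ N ih => rw [Finset.sum_range_succ, ih]; push_cast; ring
    have e : ∑ a ∈ Finset.range ((n + 1) / 2), ((n : ℝ) - 2 * a) / 2 * ((if a ≤ b ∧ b + a < n then 1 else 0 : ℤ) : ℝ) =
        ∑ a ∈ Finset.range (min (b + 1) (n - b)), ((n : ℝ) - 2 * a) / 2 := by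
      symm
      have hsub : Finset.range (min (b + 1) (n - b)) ⊆ Finset.range ((n + 1) / 2) := by
        intro a ha
        rw [Finset.mem_range] at *
        omega
      rw [← Finset.sum_subset hsub]
      · refine Finset.sum_congr rfl fun a ha => ?_
        have := Finset.mem_range.1 ha
        rw [if_pos (by omega)]; simp
      · intro a _ ha
        rw [Finset.mem_range] at ha
        rw [if_neg (by omega)]; simp
    rw [e, key, yA]
    rcases le_total (b + 1) (n - b) with h | h
    · rw [min_eq_left h]; push_cast; ring
    · rw [min_eq_right h, Nat.cast_sub (by omega)]; ring
  refine eq_of_ge hADE (fun i => yA n (L.l i)) (rhoA L) (Finset.range ((n + 1) / 2)) t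
    (fun a => ((n : ℝ) - 2 * a) / 2) hρt ?_
  calc ∑ i, yA n (L.l i) = ∑ a ∈ Finset.range ((n + 1) / 2), ((n : ℝ) - 2 * a) / 2 * ((∑ i, t a i : ℤ) : ℝ) := by
        simp_rw [hρt]
        rw [Finset.sum_comm]
        refine Finset.sum_congr rfl fun a _ => ?_
        rw [← Finset.mul_sum]; push_cast; rfl
    _ ≤ _ := by
        refine Finset.sum_le_sum fun a ha => ?_
        apply mul_le_mul_of_nonneg_left
        · exact_mod_cast Finset.sum_le_sum fun i _ => hge a i
        · have := Finset.mem_range.1 ha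
          have : 2 * a ≤ n := by omega
          have : (2 * a : ℝ) ≤ n := by exact_mod_cast this
          linarith

end DPA

namespace DPA
set_option linter.all false
open scoped BigOperators
open Matrix

theorem Rm_apply {Q : ADEQuiver} {lam : Q.I → ℂ} (t : Q.I → ℤ) (a : Q.I) :
    (Rm lam *ᵥ t) a = ∑ i, (H lam a i : ℤ) * (Bm Q *ᵥ t) i - t a := by
  unfold Rm
  rw [Matrix.sub_mulVec, ← Matrix.mulVec_mulVec, Matrix.one_mulVec]
  rfl

theorem R_sym {Q : ADEQuiver} {lam : Q.I → ℂ} (τ : Q.I → Q.I)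
    (hs : ∀ i a, H lam (τ i) a = H lam i a) (t : Q.I → ℤ) (ht : ∀ i, t (τ i) = t i) (a : Q.I) :
    (Rm lam *ᵥ t) (τ a) = (Rm lam *ᵥ t) a := by
  rw [Rm_apply, Rm_apply, ht]
  simp only [hs]

def SE : List (ℕ × ℕ × ℕ × ℕ) := [(0,0,1,0),(0,1,1,0),(1,1,1,0),(0,0,0,1),(0,0,1,1),(0,1,1,1),(1,1,1,1),(0,1,2,1),
  (1,1,2,1),(1,2,2,1),(1,2,3,1),(1,2,3,2)]
theorem chkS0 : ((List.range 2).all fun a => (List.range 3).all fun b => (List.range 4).all fun c => (List.range 3).all fun d =>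
    !(Nat.beq (2 * a * a + 2 * b * b + c * c + d * d) (1 + 2 * a * b + 2 * b * c + c * d)) ||
    SE.any fun x => Nat.beq a x.1 && Nat.beq b x.2.1 && Nat.beq c x.2.2.1 && Nat.beq d x.2.2.2) = true := by
  decide +kernel

theorem chkS (a b c d : ℕ) (ha : a < 2) (hb : b < 3) (hc : c < 4) (hd : d < 3)
    (h : 2 * a * a + 2 * b * b + c * c + d * d = 1 + 2 * a * b + 2 * b * c + c * d) :
    ∃ x ∈ SE, a = x.1 ∧ b = x.2.1 ∧ c = x.2.2.1 ∧ d = x.2.2.2 := by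
  have := chkS0
  simp only [List.all_eq_true, List.mem_range, Bool.or_eq_true, Bool.not_eq_true', List.any_eq_true, Bool.and_eq_true, Nat.beq_eq_true_eq] at this
  rcases this a ha b hb c hc d hd with h1 | ⟨x, hx, ⟨⟨h1, h2⟩, h3⟩, h4⟩
  · rw [h] at h1; simp at h1
  · exact ⟨x, hx, Nat.eq_of_beq_eq_true h1, Nat.eq_of_beq_eq_true h2, Nat.eq_of_beq_eq_true h3, Nat.eq_of_beq_eq_true h4⟩

theorem solE (a b c d : ℤ) (ha : 0 ≤ a) (hb : 0 ≤ b) (hc : 0 ≤ c) (hd : 0 ≤ d)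
    (h : 2 * a * a + 2 * b * b + c * c + d * d = 1 + 2 * a * b + 2 * b * c + c * d) :
    ∃ x ∈ SE, a = x.1 ∧ b = x.2.1 ∧ c = x.2.2.1 ∧ d = x.2.2.2 := by
  have hc4 : c < 4 := by nlinarith [sq_nonneg (2 * a - b), sq_nonneg (3 * b - 2 * c), sq_nonneg (2 * d - c)]
  have hb3 : b < 3 := by nlinarith [sq_nonneg (2 * a - b), sq_nonneg (3 * b - 2 * c), sq_nonneg (2 * d - c)]
  have hd3 : d < 3 := by nlinarith [sq_nonneg (2 * a - b), sq_nonneg (3 * b - 2 * c), sq_nonneg (2 * d - c)]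
  have ha2 : a < 2 := by nlinarith [sq_nonneg (2 * a - b), sq_nonneg (3 * b - 2 * c), sq_nonneg (2 * d - c)]
  lift a to ℕ using ha
  lift b to ℕ using hb
  lift c to ℕ using hc
  lift d to ℕ using hd
  obtain ⟨x, hx, h1, h2, h3, h4⟩ := chkS a b c d (by omega) (by omega) (by omega) (by omega) (by exact_mod_cast h)
  exact ⟨x, hx, by omega, by omega, by omega, by omega⟩

theorem chkE0 : (SE.all fun x => SE.all fun y =>
    !(Nat.beq ((x.1 + y.1) % 2) 0 && Nat.beq ((x.2.1 + y.2.1) % 2) 1 && Nat.beq ((x.2.2.1 + y.2.2.1) % 2) 0 && Nat.beq ((x.2.2.2 + y.2.2.2) % 2) 0) ||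
    SE.all fun u =>
    !(Nat.beq ((x.1 + u.1) % 2) 1 && Nat.beq ((x.2.1 + u.2.1) % 2) 1 && Nat.beq ((x.2.2.1 + u.2.2.1) % 2) 0 && Nat.beq ((x.2.2.2 + u.2.2.2) % 2) 0) ||
    Nat.ble 67 (6 * (2 * x.1 + 2 * x.2.1 + x.2.2.1 + x.2.2.2) + 7 * (2 * y.1 + 2 * y.2.1 + y.2.2.1 + y.2.2.2)
     + 8 * (2 * u.1 + 2 * u.2.1 + u.2.2.1 + u.2.2.2))) = true := by
  decide +kernel

theorem chkE (x) (hx : x ∈ SE) (y) (hy : y ∈ SE)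
    (h1 : (x.1 + y.1) % 2 = 0 ∧ (x.2.1 + y.2.1) % 2 = 1 ∧ (x.2.2.1 + y.2.2.1) % 2 = 0 ∧ (x.2.2.2 + y.2.2.2) % 2 = 0) (u)
    (hu : u ∈ SE)
    (h2 : (x.1 + u.1) % 2 = 1 ∧ (x.2.1 + u.2.1) % 2 = 1 ∧ (x.2.2.1 + u.2.2.1) % 2 = 0 ∧ (x.2.2.2 + u.2.2.2) % 2 = 0) :
    67 ≤ 6 * (2 * x.1 + 2 * x.2.1 + x.2.2.1 + x.2.2.2) + 7 * (2 * y.1 + 2 * y.2.1 + y.2.2.1 + y.2.2.2)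
     + 8 * (2 * u.1 + 2 * u.2.1 + u.2.2.1 + u.2.2.2) := by
  have := List.all_eq_true.1 (List.all_eq_true.1 chkE0 x hx) y hy
  rw [h1.1, h1.2.1, h1.2.2.1, h1.2.2.2, Bool.or_eq_true] at this
  have := List.all_eq_true.1 (this.resolve_left (by decide)) u hu
  rw [h2.1, h2.2.1, h2.2.2.1, h2.2.2.2, Bool.or_eq_true] at this
  exact Nat.le_of_ble_eq_true (this.resolve_left (by decide))
theorem chkE' (a1 b1 c1 d1 a2 b2 c2 d2 a3 b3 c3 d3 : ℤ)
    (p1 : 0 ≤ a1 ∧ 0 ≤ b1 ∧ 0 ≤ c1 ∧ 0 ≤ d1) (p2 : 0 ≤ a2 ∧ 0 ≤ b2 ∧ 0 ≤ c2 ∧ 0 ≤ d2)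
    (p3 : 0 ≤ a3 ∧ 0 ≤ b3 ∧ 0 ≤ c3 ∧ 0 ≤ d3)
    (h1 : 2 * a1 * a1 + 2 * b1 * b1 + c1 * c1 + d1 * d1 = 1 + 2 * a1 * b1 + 2 * b1 * c1 + c1 * d1)
    (h2 : 2 * a2 * a2 + 2 * b2 * b2 + c2 * c2 + d2 * d2 = 1 + 2 * a2 * b2 + 2 * b2 * c2 + c2 * d2)
    (h3 : 2 * a3 * a3 + 2 * b3 * b3 + c3 * c3 + d3 * d3 = 1 + 2 * a3 * b3 + 2 * b3 * c3 + c3 * d3)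
    (q2 : (a1 + a2) % 2 = 0 ∧ (b1 + b2) % 2 = 1 ∧ (c1 + c2) % 2 = 0 ∧ (d1 + d2) % 2 = 0)
    (q3 : (a1 + a3) % 2 = 1 ∧ (b1 + b3) % 2 = 1 ∧ (c1 + c3) % 2 = 0 ∧ (d1 + d3) % 2 = 0) :
    67 ≤ 6 * (2 * a1 + 2 * b1 + c1 + d1) + 7 * (2 * a2 + 2 * b2 + c2 + d2) + 8 * (2 * a3 + 2 * b3 + c3 + d3) := by
  obtain ⟨x, hx, rfl, rfl, rfl, rfl⟩ := solE _ _ _ _ p1.1 p1.2.1 p1.2.2.1 p1.2.2.2 h1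
  obtain ⟨y, hy, rfl, rfl, rfl, rfl⟩ := solE _ _ _ _ p2.1 p2.2.1 p2.2.2.1 p2.2.2.2 h2
  obtain ⟨u, hu, rfl, rfl, rfl, rfl⟩ := solE _ _ _ _ p3.1 p3.2.1 p3.2.2.1 p3.2.2.2 h3
  have := chkE x hx y hy (by omega) u hu (by omega)
  omega

theorem BT {Q : ADEQuiver} {m k : ℕ} (L : Lab Q (m + 1) (ET m k)) (hk : k < m) (t : Q.I → ℤ) (y : ℕ → ℤ)
    (hy : ∀ i, t i = y (L.l i)) (i : Q.I) : (Bm Q *ᵥ t) i = 2 * y (L.l i) - if L.l i = m then y k else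
      (if 0 < L.l i then y (L.l i - 1) else 0) + (if L.l i + 1 < m then y (L.l i + 1) else 0) +
       (if L.l i = k then y m else 0) := by
  rw [Bm_mulVec, hy, ← nbT L hk y i]
  simp only [Int.cast_id, hy]

theorem eq6 {Q : ADEQuiver} {lam : Q.I → ℂ} (hADE : Q.IsADE) (hnu : Q.NuSpec) (L : Lab Q (5 + 1) (ET 5 2))
    (hanti : ∀ i, lam (Q.nu i) = -lam i) :
    Module.finrank ℂ (Q.Deformed lam) = Module.finrank ℂ (Q.Deformed 0) := by
  obtain ⟨τ, hτl⟩ : ∃ τ : Q.I → Q.I, ∀ i, L.l (τ i) = if L.l i = 5 then 5 else 4 - L.l i :=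
    ⟨fun i => L.g (if L.l i = 5 then 5 else 4 - L.l i), fun i => L.hlg _ (by split_ifs <;> omega)⟩
  have hτ : ∀ i, τ (τ i) = i := by
    intro i
    have := L.hl i
    apply L.linj
    rw [hτl, hτl]
    split_ifs <;> omega
  have hl : ∀ i, lam (τ i) = -lam i := by
    refine anti_of _ hnu.1 (rho_nu hADE hnu _ (rho6 L)) hanti τ hτ ?_
    intro i j h
    have h1 := L.hl i
    have h2 := L.hl j
    have h3 : L.l j = L.l i ∨ L.l j = L.l (τ i) := by
      rw [hτl]
      rw [yL, yL, div_left_inj' two_ne_zero, Nat.cast_inj] at h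
      generalize L.l i = a at *
      generalize L.l j = b at *
      interval_cases a <;> interval_cases b <;> first | decide | (exfalso; revert h; decide)
    rcases h3 with h3 | h3
    · exact Or.inl (L.linj h3)
    · exact Or.inr (L.linj h3)
  refine generic hADE τ hτ hl ?_
  intro mu hmu hH
  have hgτ : ∀ a, a < 6 → τ (L.g a) = L.g (if a = 5 then 5 else 4 - a) := by
    intro a ha
    apply L.linj
    rw [hτl, L.hlg a ha, L.hlg]
    split_ifs <;> omega
  have hmg : ∀ a, a < 6 → mu (L.g (if a = 5 then 5 else 4 - a)) = - mu (L.g a) := by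
    intro a ha
    rw [← hgτ a ha, hmu]
  have m2 : mu (L.g 2) = 0 := by
    have := hmg 2 (by norm_num)
    norm_num at this
    have h2 : (2 : ℂ) * mu (L.g 2) = 0 := by linear_combination this
    simpa using h2
  have m5 : mu (L.g 5) = 0 := by
    have := hmg 5 (by norm_num)
    norm_num at this
    have h2 : (2 : ℂ) * mu (L.g 5) = 0 := by linear_combination this
    simpa using h2
  have m1 : mu (L.g 3) = - mu (L.g 1) := by simpa using hmg 1 (by norm_num)
  have m0 : mu (L.g 4) = - mu (L.g 0) := by simpa using hmg 0 (by norm_num)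
  -- the vectors
  set P : ℕ → Q.I → ℤ := fun s => ind ((Finset.range (5 - 2 * s)).image (fun b => L.g (s + b))) with hP
  have hPv : ∀ s i, P s i = (fun b => if s ≤ b ∧ b + s < 5 then (1 : ℤ) else 0) (L.l i) := by
    intro s i
    simp only [hP, ind]
    have : (i ∈ (Finset.range (5 - 2 * s)).image (fun b => L.g (s + b))) ↔ (s ≤ L.l i ∧ L.l i + s < 5) := by
      simp only [Finset.mem_image, Finset.mem_range]
      constructor
      · rintro ⟨b, hb, rfl⟩
        rw [L.hlg _ (by omega)]; omega
      · intro h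
        refine ⟨L.l i - s, by omega, ?_⟩
        rw [show s + (L.l i - s) = L.l i by omega, L.hgl]
    simp only [this]
  have hpos : ∀ s, s < 3 → ∀ x, 0 ≤ (Rm mu *ᵥ P s) x := by
    intro s hs x
    refine path_nonneg hADE (5 - 2 * s) (fun b => L.g (s + b)) ?_ ?_ ?_ x
    · intro b c hb hc h
      have : L.l (L.g (s + b)) = L.l (L.g (s + c)) := congrArg L.l h
      rw [L.hlg _ (by omega), L.hlg _ (by omega)] at this
      omega
    · intro b c hb hc
      split_ifs with h
      · apply L.h1
        rw [L.hlg _ (by omega), L.hlg _ (by omega)]; simp only [ET, att, EP]; omega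
      · apply L.h0
        rw [L.hlg _ (by omega), L.hlg _ (by omega)]; simp only [ET, att, EP]; omega
    · interval_cases s
      · simp [Finset.sum_range_succ, m0, m1, m2]
      · simp [Finset.sum_range_succ, m0, m1, m2]
      · simp [Finset.sum_range_succ, m0, m1, m2]
  have hsymP : ∀ s i, P s (τ i) = P s i := by
    intro s i
    rw [hPv, hPv, hτl]
    have := L.hl i
    generalize L.l i = a at *
    beta_reduce
    split_ifs <;> omega
  have hsymR : ∀ s i, (Rm mu *ᵥ P s) (τ i) = (Rm mu *ᵥ P s) i := fun s i => R_sym τ hH (P s) (hsymP s) i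
  have hsR : ∀ s a, a < 6 → (Rm mu *ᵥ P s) (L.g (if a = 5 then 5 else 4 - a)) = (Rm mu *ᵥ P s) (L.g a) := by
    intro s a ha
    rw [← hgτ a ha, hsymR]
  have hs4 : ∀ s, (Rm mu *ᵥ P s) (L.g 4) = (Rm mu *ᵥ P s) (L.g 0) := fun s => by simpa using hsR s 0 (by norm_num)
  have hs3 : ∀ s, (Rm mu *ᵥ P s) (L.g 3) = (Rm mu *ᵥ P s) (L.g 1) := fun s => by simpa using hsR s 1 (by norm_num)
  have hsum : ∀ z : Q.I → ℤ, ∑ i, z i = z (L.g 0) + z (L.g 1) + z (L.g 2) + z (L.g 3) + z (L.g 4) + z (L.g 5) := by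
    intro z
    rw [L.sum]; simp [Finset.sum_range_succ]
  have hform : ∀ z : Q.I → ℤ, z ⬝ᵥ (Bm Q *ᵥ z) = 2 * (z (L.g 0) * z (L.g 0) + z (L.g 1) * z (L.g 1) + z (L.g 2) * z (L.g 2)
      + z (L.g 3) * z (L.g 3) + z (L.g 4) * z (L.g 4) + z (L.g 5) * z (L.g 5) - z (L.g 0) * z (L.g 1) - z (L.g 1) * z (L.g 2)
      - z (L.g 2) * z (L.g 3) - z (L.g 3) * z (L.g 4) - z (L.g 2) * z (L.g 5)) := by
    intro z
    have hB := BT L (by norm_num) z (fun a => z (L.g a)) (fun i => by rw [L.hgl])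
    unfold dotProduct
    rw [hsum]
    simp only [hB, L.hlg 0 (by norm_num), L.hlg 1 (by norm_num), L.hlg 2 (by norm_num), L.hlg 3 (by norm_num),
      L.hlg 4 (by norm_num), L.hlg 5 (by norm_num)]
    norm_num
    ring
  have hPg : ∀ s a, a < 6 → P s (L.g a) = if s ≤ a ∧ a + s < 5 then 1 else 0 := by
    intro s a ha
    rw [hPv, L.hlg a ha]
  have hnorm : ∀ s, s < 3 → (Rm mu *ᵥ P s) ⬝ᵥ (Bm Q *ᵥ (Rm mu *ᵥ P s)) = 2 := by
    intro s hs
    rw [Rm_norm hADE, hform]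
    rw [hPg s 0 (by norm_num), hPg s 1 (by norm_num), hPg s 2 (by norm_num), hPg s 3 (by norm_num), hPg s 4 (by norm_num),
      hPg s 5 (by norm_num)]
    interval_cases s <;> norm_num
  have hev : ∀ s, s < 2 → ∀ x, Even ((Rm mu *ᵥ P 2) x + (Rm mu *ᵥ P s) x - (P 2 x + P s x)) := by
    intro s hs x
    have h := R_even hADE τ hτ hH (P 2 + P s) ?_ ?_ x
    · rw [Matrix.mulVec_add] at h; exact h
    · intro i
      have hB := BT L (by norm_num) (P 2 + P s) (fun b => (if 2 ≤ b ∧ b + 2 < 5 then (1 : ℤ) else 0) + (if s ≤ b ∧ b + s < 5 then (1 : ℤ) else 0))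
        (fun i => by rw [Pi.add_apply, hPv, hPv])
      rw [hB, hB, hτl]
      have := L.hl i
      generalize L.l i = a at *
      interval_cases s <;> interval_cases a <;> norm_num
    · intro i hi
      have hB := BT L (by norm_num) (P 2 + P s) (fun b => (if 2 ≤ b ∧ b + 2 < 5 then (1 : ℤ) else 0) + (if s ≤ b ∧ b + s < 5 then (1 : ℤ) else 0))
        (fun i => by rw [Pi.add_apply, hPv, hPv])
      have hi' := congrArg L.l hi
      rw [hτl] at hi'
      rw [hB]
      have := L.hl i
      generalize L.l i = a at *
      interval_cases s <;> interval_cases a <;> first | (norm_num at hi'; done) | (norm_num; done) | (norm_num; decide)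
  have hev' : ∀ s, s < 2 → ∀ a, a < 6 → ((Rm mu *ᵥ P 2) (L.g a) + (Rm mu *ᵥ P s) (L.g a)) % 2 = 
      ((if 2 ≤ a ∧ a + 2 < 5 then (1 : ℤ) else 0) + (if s ≤ a ∧ a + s < 5 then (1 : ℤ) else 0)) % 2 := by
    intro s hs a ha
    have h := hev s hs (L.g a)
    rw [hPg 2 a ha, hPg s a ha, Int.even_iff] at h
    omega
  have N2 := hnorm 2 (by norm_num)
  have N1 := hnorm 1 (by norm_num)
  have N0 := hnorm 0 (by norm_num)
  rw [hform, hs3, hs4] at N2 N1 N0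
  have key := chkE' _ _ _ _ _ _ _ _ _ _ _ _
    ⟨hpos 2 (by norm_num) (L.g 0), hpos 2 (by norm_num) (L.g 1), hpos 2 (by norm_num) (L.g 2), hpos 2 (by norm_num) (L.g 5)⟩
    ⟨hpos 1 (by norm_num) (L.g 0), hpos 1 (by norm_num) (L.g 1), hpos 1 (by norm_num) (L.g 2), hpos 1 (by norm_num) (L.g 5)⟩
    ⟨hpos 0 (by norm_num) (L.g 0), hpos 0 (by norm_num) (L.g 1), hpos 0 (by norm_num) (L.g 2), hpos 0 (by norm_num) (L.g 5)⟩
    (by linarith) (by linarith) (by linarith)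
    ⟨by simpa using hev' 1 (by norm_num) 0 (by norm_num), by simpa using hev' 1 (by norm_num) 1 (by norm_num),
     by simpa using hev' 1 (by norm_num) 2 (by norm_num), by simpa using hev' 1 (by norm_num) 5 (by norm_num)⟩
    ⟨by simpa using hev' 0 (by norm_num) 0 (by norm_num), by simpa using hev' 0 (by norm_num) 1 (by norm_num),
     by simpa using hev' 0 (by norm_num) 2 (by norm_num), by simpa using hev' 0 (by norm_num) 5 (by norm_num)⟩
  have key5 := sing_sum hADE (L.g 5) m5
  have S : ∀ s, ∑ x, (Rm mu *ᵥ P s) x = 2 * (Rm mu *ᵥ P s) (L.g 0) + 2 * (Rm mu *ᵥ P s) (L.g 1) + (Rm mu *ᵥ P s) (L.g 2)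
      + (Rm mu *ᵥ P s) (L.g 5) := by
    intro s
    rw [hsum, hs3, hs4]; ring
  have tot : (67 : ℤ) + 11 ≤ 8 * ∑ x, (Rm mu *ᵥ P 0) x + 7 * ∑ x, (Rm mu *ᵥ P 1) x + 6 * ∑ x, (Rm mu *ᵥ P 2) x
      + 11 * ∑ x, (Rm mu *ᵥ ind {L.g 5}) x := by
    rw [S, S, S]; linarith
  refine eq_of_ge hADE _ (rho6 L) (Finset.range 4) (fun s => if s = 3 then ind {L.g 5} else P s)
    (fun s => if s = 0 then 8 else if s = 1 then 7 else if s = 2 then 6 else 11) ?_ ?_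
  · intro i
    have h5 : ind {L.g 5} i = if L.l i = 5 then 1 else 0 := by
      have : i ∈ ({L.g 5} : Finset Q.I) ↔ L.l i = 5 := by
        rw [Finset.mem_singleton]
        constructor
        · rintro rfl; exact L.hlg 5 (by norm_num)
        · intro h; exact (L.hgl i).symm.trans (congrArg L.g h)
      simp only [ind, this]
    simp only [Finset.sum_range_succ, Finset.sum_range_zero]
    norm_num
    rw [h5, hPv, hPv, hPv]
    have := L.hl i
    generalize L.l i = a at *
    interval_cases a <;> norm_num [yL]
  · rw [L.sum' (yL [16, 30, 42, 30, 16, 22])]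
    have e : ∑ a ∈ Finset.range (5 + 1), yL [16, 30, 42, 30, 16, 22] a = 78 := by
      norm_num [yL, Finset.sum_range_succ]
    rw [e]
    have tot' : ((67 : ℤ) + 11 : ℝ) ≤ ((8 * ∑ x, (Rm mu *ᵥ P 0) x + 7 * ∑ x, (Rm mu *ᵥ P 1) x + 6 * ∑ x, (Rm mu *ᵥ P 2) x
      + 11 * ∑ x, (Rm mu *ᵥ ind {L.g 5}) x : ℤ) : ℝ) := by exact_mod_cast tot
    simp only [Finset.sum_range_succ, Finset.sum_range_zero]
    push_cast at tot' ⊢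
    norm_num at tot' ⊢
    linarith

end DPA

namespace DPA
set_option linter.all false
open scoped BigOperators
open Real

theorem no_even {Q : ADEQuiver} (hexp : Q.ExponentsSpec) {m : ℕ} (hm : 3 ≤ m) (ho : Odd m) (L : Lab Q (m + 1) (ET m 1))
    (i : ℕ) (hi : i < Q.r) : ¬ Even (Q.m i) := by
  rintro ⟨q, hq⟩
  have hh := coxD hexp hm L
  have hk1 := hexp.2.2.1 i hi
  have hk2 : Q.m i < Q.h := by
    have h1 := hexp.2.1 i (Q.r - 1) (by omega) (by omega)
    have h2 := hexp.2.2.2.2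
    omega
  obtain ⟨v, hv0, hv⟩ := (eig_iff hexp (2 * cos (Q.m i * π / Q.h))).2 ⟨i, hi, rfl⟩
  obtain ⟨t, ht⟩ : ∃ t : ℝ, t = Q.m i * π / Q.h := ⟨_, rfl⟩
  rw [← ht] at hv
  have hm0 : (0 : ℝ) < m := by exact_mod_cast (by omega : 0 < m)
  have hmt : (m : ℝ) * t = q * π := by
    rw [ht, hh, hq]; push_cast; field_simp; ring
  have ht0 : 0 < t := by
    rw [ht]
    have : (0 : ℝ) < Q.m i := by exact_mod_cast hk1
    have : (0 : ℝ) < Q.h := by exact_mod_cast (by omega : 0 < Q.h)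
    positivity
  have htp : t < π := by
    rw [ht, div_lt_iff₀ (by exact_mod_cast (by omega : 0 < Q.h)), mul_comm]
    exact mul_lt_mul_of_pos_left (by exact_mod_cast hk2) pi_pos
  have hs : sin t ≠ 0 := (sin_pos_of_pos_of_lt_pi ht0 htp).ne'
  have hsm : sin ((m : ℝ) * t) = 0 := by rw [hmt]; exact sin_nat_mul_pi q
  have hcm : cos ((m : ℝ) * t) ≠ 0 := by
    intro h
    have := sin_sq_add_cos_sq ((m : ℝ) * t)
    rw [hsm, h] at this; norm_num at this
  obtain ⟨y, hy⟩ : ∃ y : ℕ → ℝ, ∀ a, y a = v (L.g a) := ⟨_, fun _ => rfl⟩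
  have hyl : ∀ j, v j = y (L.l j) := fun j => by rw [hy, L.hgl]
  have E : ∀ a, a < m + 1 → (if a = m then y 1 else
      (if 0 < a then y (a - 1) else 0) + (if a + 1 < m then y (a + 1) else 0) +
       (if a = 1 then y m else 0)) = 2 * cos t * y a := by
    intro a ha
    have h1 := nbT L (by omega) y (L.g a)
    rw [L.hlg a ha] at h1
    rw [← h1, hy, ← hv]
    exact Finset.sum_congr rfl fun j _ => by rw [hyl j]
  have chain : ∀ d : ℕ, d + 1 ≤ m - 1 → y (m - (d + 1)) * sin t = y (m - 1) * sin (((d + 1 : ℕ) : ℝ) * t) := by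
    intro d
    induction d using Nat.strong_induction_on with
    | _ d ih =>
      intro hd
      match d, ih, hd with
      | 0, _, _ => simp
      | 1, _, hd =>
        have e := E (m - 1) (by omega)
        rw [if_neg (by omega), if_pos (by omega), if_neg (by omega), if_neg (by omega)] at e
        rw [show m - 1 - 1 = m - (1 + 1) by omega] at e
        have : sin (((1 + 1 : ℕ) : ℝ) * t) = 2 * sin t * cos t := by
          rw [← sin_two_mul]; norm_num
        rw [this]
        linear_combination sin t * e
      | d + 2, ih, hd =>
        have e := E (m - (d + 2)) (by omega)
        rw [if_neg (by omega), if_pos (by omega), if_pos (by omega), if_neg (by omega)] at e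
        rw [show m - (d + 2) - 1 = m - (d + 2 + 1) by omega, show m - (d + 2) + 1 = m - (d + 1) by omega] at e
        have h1 := ih d (by omega) (by omega)
        have h2 := ih (d + 1) (by omega) (by omega)
        rw [show d + 1 + 1 = d + 2 by omega] at h2
        have h3 := sin_rec t ((d + 2 : ℕ) : ℝ)
        rw [show ((d + 2 : ℕ) : ℝ) * t - t = ((d + 1 : ℕ) : ℝ) * t by push_cast; ring,
          show ((d + 2 : ℕ) : ℝ) * t + t = ((d + 2 + 1 : ℕ) : ℝ) * t by push_cast; ring] at h3
        linear_combination sin t * e - h1 + 2 * cos t * h2 - y (m - 1) * h3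
  have c1 := chain (m - 2) (by omega)
  rw [show m - (m - 2 + 1) = 1 by omega] at c1
  have c2 := chain (m - 3) (by omega)
  rw [show m - (m - 3 + 1) = 2 by omega] at c2
  have h3 := sin_rec t ((m - 2 + 1 : ℕ) : ℝ)
  rw [show ((m - 2 + 1 : ℕ) : ℝ) * t - t = ((m - 3 + 1 : ℕ) : ℝ) * t by
      rw [show m - 2 + 1 = m - 3 + 1 + 1 by omega]; push_cast; ring,
    show ((m - 2 + 1 : ℕ) : ℝ) * t + t = (m : ℝ) * t by
      rw [show (m : ℝ) = ((m - 2 + 1 + 1 : ℕ) : ℝ) by congr 1; omega]; push_cast; ring, hsm] at h3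
  have e0 := E 0 (by omega)
  rw [if_neg (by omega), if_neg (by omega), if_pos (by omega), if_neg (by omega)] at e0
  have em := E m (by omega)
  rw [if_pos rfl] at em
  have e1 := E 1 (by omega)
  rw [if_neg (by omega), if_pos (by omega), if_pos (by omega), if_pos rfl] at e1
  norm_num at e0 e1
  have k1 : (y 0 + y m) * sin t = 0 := by
    linear_combination sin t * e1 - c2 + 2 * cos t * c1 - y (m - 1) * h3
  have k2 : y 0 + y m = 0 := by simpa [hs] using k1
  have k3 : y 1 = 0 := by linear_combination (e0 + em) / 2 + cos t * k2
  have k4 : sin (((m - 2 + 1 : ℕ) : ℝ) * t) = - cos (m * t) * sin t := by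
    rw [show ((m - 2 + 1 : ℕ) : ℝ) * t = m * t - t by
      rw [show (m : ℝ) = ((m - 2 + 1 + 1 : ℕ) : ℝ) by congr 1; omega]; push_cast; ring, sin_sub, hsm]
    ring
  rw [k3, k4, zero_mul, eq_comm, mul_eq_zero] at c1
  have k5 : y (m - 1) = 0 := by
    rcases c1 with h | h
    · exact h
    · exfalso
      rcases mul_eq_zero.1 h with h | h
      · exact hcm (by linarith)
      · exact hs h
  have kall : ∀ a, 1 ≤ a → a < m → y a = 0 := by
    intro a h1 h2
    have := chain (m - a - 1) (by omega)
    rw [show m - (m - a - 1 + 1) = a by omega, k5, zero_mul] at this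
    simpa [hs] using this
  by_cases hc : cos t = 0
  · have : t = π / 2 := by
      apply injOn_cos ⟨ht0.le, htp.le⟩ ⟨by positivity, by linarith [pi_pos]⟩
      rw [hc, cos_pi_div_two]
    rw [this] at hmt
    have h1 : (m : ℝ) = 2 * q := by
      have := pi_ne_zero
      field_simp at hmt
      linarith
    have h2 : m = 2 * q := by exact_mod_cast h1
    rcases ho with ⟨s, hs⟩
    omega
  · apply hv0
    funext j
    have hyo : y 0 = 0 := by
      rw [k3] at e0
      simpa [hc] using e0.symm
    rw [hyl]
    have hj := L.hl j
    by_cases h0 : L.l j = 0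
    · rw [h0, hyo]; rfl
    by_cases h1 : L.l j = m
    · rw [h1, Pi.zero_apply]; linarith
    · exact kall _ (by omega) (by omega)

theorem eqDodd {Q : ADEQuiver} {lam : Q.I → ℂ} (hexp : Q.ExponentsSpec) (hnu : Q.NuSpec) {m : ℕ} (hm : 3 ≤ m) (ho : Odd m)
    (L : Lab Q (m + 1) (ET m 1)) (hanti : ∀ i, lam (Q.nu i) = -lam i) : lam = 0 := by
  refine lam_zero (fun i => ?_) hanti
  have h := hnu.2.2
  rw [show (Finset.range Q.r).filter (fun i => Even (Q.m i)) = ∅ from Finset.filter_eq_empty_iff.2 fun i hi =>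
    no_even hexp hm ho L i (Finset.mem_range.1 hi)] at h
  rw [Finset.card_empty, mul_zero, Finset.card_eq_zero, Finset.filter_eq_empty_iff] at h
  simpa using h (Finset.mem_univ i)

end DPA

namespace DPA
set_option linter.all false
open scoped BigOperators
open Matrix

/-- label functions in type D -/
def VD (m a b : ℕ) : ℤ := if a = 0 then (if b = 0 ∨ b = 1 ∨ b = m then 1 else 0) else if b = a then 1 else 0

theorem VD_sum (m a : ℕ) (hm : 3 ≤ m) (ha : a < m) : ∑ b ∈ Finset.range (m + 1), VD m a b = if a = 0 then 3 else 1 := by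
  by_cases h : a = 0
  · subst h
    have e : ∀ b ∈ Finset.range (m + 1), VD m 0 b = (if b = 0 then 1 else 0) + (if b = 1 then 1 else 0) + (if b = m then 1 else 0) := by
      intro b _
      unfold VD
      split_ifs <;> omega
    rw [Finset.sum_congr rfl e, Finset.sum_add_distrib, Finset.sum_add_distrib, Finset.sum_ite_eq', Finset.sum_ite_eq',
      Finset.sum_ite_eq', if_pos (by simp), if_pos (by simp; omega), if_pos (by simp)]
    rfl
  · have e : ∀ b ∈ Finset.range (m + 1), VD m a b = (if b = a then 1 else 0) := by
      intro b _
      unfold VD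
      rw [if_neg h]
    rw [Finset.sum_congr rfl e, Finset.sum_ite_eq', if_pos (by simp; omega), if_neg h]

theorem sum2 (m : ℕ) (hm : 3 ≤ m) (c : ℤ) : ∑ b ∈ Finset.range (m + 1), (if b = 0 ∨ b = m then c else 0) = 2 * c := by
  have e : ∀ b ∈ Finset.range (m + 1), (if b = 0 ∨ b = m then c else 0) = (if b = 0 then c else 0) + (if b = m then c else 0) := by
    intro b _
    split_ifs <;> omega
  rw [Finset.sum_congr rfl e, Finset.sum_add_distrib, Finset.sum_ite_eq',
      Finset.sum_ite_eq', if_pos (by simp), if_pos (by simp)]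
  ring

theorem dotL {Q : ADEQuiver} {m : ℕ} (hm : 3 ≤ m) (L : Lab Q (m + 1) (ET m 1)) (t : Q.I → ℤ) (y : ℕ → ℤ)
    (hy : ∀ i, t i = y (L.l i)) : t ⬝ᵥ (Bm Q *ᵥ t) = ∑ a ∈ Finset.range (m + 1), y a * (2 * y a - if a = m then y 1 else
      (if 0 < a then y (a - 1) else 0) + (if a + 1 < m then y (a + 1) else 0) +
       (if a = 1 then y m else 0)) := by
  rw [← L.sum']
  unfold dotProduct
  refine Finset.sum_congr rfl fun i _ => ?_
  rw [BT L (by omega) t y hy, hy]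

theorem normD {Q : ADEQuiver} {m : ℕ} (hm : 3 ≤ m) (L : Lab Q (m + 1) (ET m 1)) (a : ℕ) (ha : a < m) (t : Q.I → ℤ)
    (hy : ∀ i, t i = VD m a (L.l i)) : t ⬝ᵥ (Bm Q *ᵥ t) = 2 := by
  rw [dotL hm L t _ hy]
  by_cases h : a = 0
  · subst h
    refine Eq.trans ?_ ((sum2 m hm 1).trans (by norm_num))
    refine Finset.sum_congr rfl fun b hb => ?_
    have hb := Finset.mem_range.1 hb
    unfold VD
    simp only [if_true]
    by_cases h0 : b = 0
    · subst h0; norm_num; rw [if_neg (by omega), if_pos (by omega)]; norm_num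
    by_cases h1 : b = m
    · subst h1; norm_num
    by_cases h2 : b = 1
    · subst h2
      have : ¬ (2 = m) := by omega
      norm_num [h1, this]
    rw [if_neg (by omega : ¬ (b = 0 ∨ b = 1 ∨ b = m)), if_neg (by omega : ¬ (b = 0 ∨ b = m))]
    ring
  · have e : ∀ b ∈ Finset.range (m + 1), VD m a b * (2 * VD m a b - if b = m then VD m a 1 else
      (if 0 < b then VD m a (b - 1) else 0) + (if b + 1 < m then VD m a (b + 1) else 0) +
       (if b = 1 then VD m a m else 0)) = if b = a then 2 else 0 := by
      intro b _
      unfold VD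
      by_cases hb : b = a
      · subst hb
        simp only [h, if_false, if_true]
        rw [if_neg (by omega : ¬ b = m), if_neg (by omega : ¬ b - 1 = b), if_neg (by omega : ¬ b + 1 = b),
          if_neg (by omega : ¬ m = b)]
        simp
      · simp only [h, if_false, if_neg hb, zero_mul]
    rw [Finset.sum_congr rfl e, Finset.sum_ite_eq', if_pos (by simp; omega)]

theorem three_le {Q : ADEQuiver} {m : ℕ} (hm : 3 ≤ m) (L : Lab Q (m + 1) (ET m 1)) (z : Q.I → ℤ) (hz : ∀ i, 0 ≤ z i)
    (hs : z (L.g m) = z (L.g 0)) (hn : z ⬝ᵥ (Bm Q *ᵥ z) = 2) (h0 : 1 ≤ z (L.g 0)) : 3 ≤ ∑ i, z i := by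
  by_contra hcon
  have hsum : ∑ i, z i = z (L.g 0) + z (L.g m) + ∑ a ∈ Finset.range (m - 1), z (L.g (a + 1)) := by
    rw [L.sum, Finset.sum_range_succ]
    obtain ⟨n, rfl⟩ : ∃ n, m = n + 1 := ⟨m - 1, by omega⟩
    rw [Finset.sum_range_succ', Nat.add_sub_cancel]; ring
  have hnn : 0 ≤ ∑ a ∈ Finset.range (m - 1), z (L.g (a + 1)) := Finset.sum_nonneg fun a _ => hz _
  have hz0 : ∑ a ∈ Finset.range (m - 1), z (L.g (a + 1)) = 0 := by omega
  rw [Finset.sum_eq_zero_iff_of_nonneg (fun a _ => hz _)] at hz0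
  have h01 : z (L.g 0) = 1 := by omega
  have hv : ∀ i, z i = (fun b => if b = 0 ∨ b = m then (1 : ℤ) else 0) (L.l i) := by
    intro i
    have hi := L.hl i
    beta_reduce
    by_cases h1 : L.l i = 0
    · rw [if_pos (Or.inl h1), ← h01, ← h1, L.hgl]
    by_cases h2 : L.l i = m
    · rw [if_pos (Or.inr h2), ← h01, ← hs]
      exact congrArg z ((L.hgl i).symm.trans (congrArg L.g h2))
    · rw [if_neg (by omega), ← hz0 (L.l i - 1) (by rw [Finset.mem_range]; omega), show L.l i - 1 + 1 = L.l i by omega, L.hgl]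
  rw [dotL hm L z (fun b => if b = 0 ∨ b = m then (1 : ℤ) else 0) hv] at hn
  have e : ∀ b ∈ Finset.range (m + 1), (if b = 0 ∨ b = m then (1 : ℤ) else 0) * (2 * (if b = 0 ∨ b = m then (1 : ℤ) else 0) -
     if b = m then (if 1 = 0 ∨ 1 = m then (1 : ℤ) else 0) else
      (if 0 < b then (if b - 1 = 0 ∨ b - 1 = m then (1 : ℤ) else 0) else 0) + (if b + 1 < m then (if b + 1 = 0 ∨ b + 1 = m then (1 : ℤ) else 0) else 0) +
       (if b = 1 then (if m = 0 ∨ m = m then (1 : ℤ) else 0) else 0)) = if b = 0 ∨ b = m then 2 else 0 := by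
    intro b hb
    have hb := Finset.mem_range.1 hb
    by_cases h0 : b = 0
    · subst h0; norm_num; omega
    by_cases h1 : b = m
    · subst h1; norm_num; omega
    rw [if_neg (by omega : ¬ (b = 0 ∨ b = m)), zero_mul, if_neg (by omega : ¬ (b = 0 ∨ b = m))]
  beta_reduce at hn
  rw [Finset.sum_congr rfl e, sum2 m hm] at hn
  norm_num at hn

end DPA

namespace DPA
set_option linter.all false
open scoped BigOperators
open Matrix

theorem antiD {Q : ADEQuiver} {lam : Q.I → ℂ} (hADE : Q.IsADE) (hnu : Q.NuSpec) {m : ℕ} (hm : 4 ≤ m)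
    (L : Lab Q (m + 1) (ET m 1)) (hanti : ∀ i, lam (Q.nu i) = -lam i) (τ : Q.I → Q.I) (hτ : ∀ i, τ (τ i) = i)
    (hτl : ∀ i, L.l (τ i) = if L.l i = 0 then m else if L.l i = m then 0 else L.l i) :
    ∀ i, lam (τ i) = -lam i := by
  have hdeg : ∀ i, ∑ j, Q.C i j = if L.l i = m then 1 else
      (if 0 < L.l i then 1 else 0) + (if L.l i + 1 < m then 1 else 0) + (if L.l i = 1 then 1 else 0) := by
    intro i
    have := nbT L (by omega) (fun _ => (1 : ℤ)) i
    simpa using this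
  refine anti_of (fun i => ((∑ j, Q.C i j, yD m (L.l i)) : ℤ × ℝ)) hnu.1 ?_ hanti τ hτ ?_
  · intro i
    have h1 := rho_nu hADE hnu _ (rhoD (by omega) L) i
    have h2 : ∑ j, Q.C (Q.nu i) j = ∑ j, Q.C i j := by
      rw [← (Function.Involutive.bijective hnu.1).sum_comp (fun j => Q.C (Q.nu i) j)]
      exact Finset.sum_congr rfl fun j _ => hnu.2.1 _ _
    exact Prod.ext h2 h1
  · intro i j h
    have hd : ∑ k, Q.C j k = ∑ k, Q.C i k := congrArg Prod.fst h
    have hy : yD m (L.l j) = yD m (L.l i) := congrArg Prod.snd h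
    rw [hdeg, hdeg] at hd
    have h1 := L.hl i
    have h2 := L.hl j
    have h3 : L.l j = L.l i ∨ L.l j = L.l (τ i) := by
      rw [hτl]
      have hmm : (4 : ℝ) ≤ m := by exact_mod_cast hm
      have tail : ∀ a : ℕ, a < m → 0 < a → a + 1 = m → yD m a ≠ (m : ℝ) * (m + 1) / 4 := by
        intro a h1 h2 h3 h4
        rw [yD, if_neg (by omega)] at h4
        have : (m : ℝ) = a + 1 := by exact_mod_cast h3.symm
        rw [this] at h4 hmm
        nlinarith
      have t0 : ∀ a : ℕ, a = 0 ∨ a = m → yD m a = (m : ℝ) * (m + 1) / 4 := fun a h => by rw [yD, if_pos h]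
      generalize L.l i = a at *
      generalize L.l j = b at *
      by_cases ha : a = 0 ∨ a = m
      · by_cases hb : b = 0 ∨ b = m
        · split_ifs <;> omega
        · exfalso
          refine tail b (by omega) (by omega) ?_ (hy.trans (t0 a ha))
          split_ifs at hd <;> omega
      · by_cases hb : b = 0 ∨ b = m
        · exfalso
          refine tail a (by omega) (by omega) ?_ (hy.symm.trans (t0 b hb))
          split_ifs at hd <;> omega
        · left
          rw [yD, if_neg hb, yD, if_neg ha] at hy
          have h5 : ((a : ℝ) - b) * (a + b + 1) = 0 := by linear_combination 2 * hy
          rcases mul_eq_zero.1 h5 with h6 | h6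
          · have : (b : ℝ) = a := by linarith
            exact_mod_cast this
          · exfalso
            have : (0 : ℝ) < a + b + 1 := by positivity
            linarith
    rcases h3 with h3 | h3
    · exact Or.inl (L.linj h3)
    · exact Or.inr (L.linj h3)

theorem sum_c (m b : ℕ) (hm : 3 ≤ m) (hb : b < m + 1) :
    yD m b = ∑ a ∈ Finset.range m, (if a = 1 then yD m 1 - yD m 0 else yD m a) * (VD m a b : ℝ) := by
  obtain ⟨n, rfl⟩ : ∃ n, m = n + 1 := ⟨m - 1, by omega⟩
  have h0 : yD (n + 1) (n + 1) = yD (n + 1) 0 := by rw [yD, yD, if_pos (by simp), if_pos (by simp)]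
  rw [Finset.sum_range_succ']
  have e : ∀ a ∈ Finset.range n, (if a + 1 = 1 then yD (n + 1) 1 - yD (n + 1) 0 else yD (n + 1) (a + 1)) * (VD (n + 1) (a + 1) b : ℝ)
     = if a = b - 1 then (if b = 0 then 0 else if b = 1 then yD (n + 1) 1 - yD (n + 1) 0 else yD (n + 1) b) else 0 := by
    intro a _
    unfold VD
    rw [if_neg (by omega : ¬ a + 1 = 0)]
    by_cases hb : b = a + 1
    · subst hb
      rw [if_pos rfl, if_pos (show a = a + 1 - 1 by omega), if_neg (by omega : ¬ a + 1 = 0)]; simp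
    · rw [if_neg hb]
      by_cases h : a = b - 1
      · rw [if_pos h, if_pos (show b = 0 by omega)]; simp
      · rw [if_neg h]; simp
  rw [Finset.sum_congr rfl e, Finset.sum_ite_eq']
  unfold VD
  simp only [Finset.mem_range, if_true]
  by_cases hb0 : b = 0
  · subst hb0; simp
  by_cases hb1 : b = 1
  · subst hb1; simp; rw [if_pos (by omega)]; ring
  by_cases hb2 : b = n + 1
  · subst hb2; rw [h0]; simp
  · rw [if_pos (by omega), if_neg hb0, if_neg hb1, if_neg (by omega : ¬ (b = 0 ∨ b = 1 ∨ b = n + 1))]; simp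

theorem pD1 (m a : ℕ) (hm : 4 ≤ m) (he : m % 2 = 0) (h1 : 1 ≤ a) (h2 : a < m) (y : ℕ → ℤ)
    (hy : ∀ b, y b = if b = 1 then 2 else if b = 0 ∨ b = m then 1 else 0) :
    (2 * y a - ((if 0 < a then y (a - 1) else 0) + (if a + 1 < m then y (a + 1) else 0) +
       (if a = 1 then y m else 0))) % 2 = 0 := by
  have e0 : y 0 = 1 := by rw [hy]; simp
  have e1 : y 1 = 2 := by rw [hy]; simp
  have em : y m = 1 := by rw [hy, if_neg (by omega), if_pos (by omega)]
  have e2 : ∀ b, 2 ≤ b → b < m → y b = 0 := fun b h h' => by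
    rw [hy, if_neg (by omega), if_neg (by omega)]
  rw [if_pos (by omega)]
  by_cases c1 : a = 1
  · subst c1
    rw [if_pos (by omega), if_pos rfl, e2 (1 + 1) (by omega) (by omega), e1, em]
    simp [e0]
  rw [if_neg c1, e2 a (by omega) h2]
  have : (if a + 1 < m then y (a + 1) else 0) = 0 := by
    split_ifs with h
    · exact e2 _ (by omega) h
    · rfl
  rw [this]
  by_cases c2 : a = 2
  · subst c2; simp [e1]
  · rw [e2 (a - 1) (by omega) (by omega)]; simp
theorem pD2 (m a : ℕ) (hm : 4 ≤ m) (he : m % 2 = 0) (h1 : 1 ≤ a) (h2 : a < m) (y : ℕ → ℤ)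
    (hy : ∀ b, y b = if b = 0 ∨ b = m ∨ b % 2 = 1 then 1 else 0) :
    (2 * y a - ((if 0 < a then y (a - 1) else 0) + (if a + 1 < m then y (a + 1) else 0) +
       (if a = 1 then y m else 0))) % 2 = 0 := by
  have e0 : y 0 = 1 := by rw [hy]; simp
  have em : y m = 1 := by rw [hy]; simp
  have e1 : ∀ b, b % 2 = 1 → y b = 1 := fun b h => by
    rw [hy, if_pos (by omega)]
  have e2 : ∀ b, b % 2 = 0 → 0 < b → b < m → y b = 0 := fun b h h' h'' => by
    rw [hy, if_neg (by omega)]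
  rw [if_pos (by omega)]
  by_cases c1 : a = 1
  · subst c1
    rw [if_pos (by omega), if_pos rfl, e2 (1 + 1) (by omega) (by omega) (by omega), e1 1 (by omega), em]
    simp [e0]
  rw [if_neg c1]
  by_cases c2 : a % 2 = 1
  · have : (if a + 1 < m then y (a + 1) else 0) = 0 := by
      split_ifs with h
      · exact e2 _ (by omega) (by omega) h
      · rfl
    rw [this, e2 (a - 1) (by omega) (by omega) (by omega), e1 a c2]; simp
  · rw [if_pos (by omega), e1 (a + 1) (by omega), e1 (a - 1) (by omega), e2 a (by omega) (by omega) h2]; simp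

theorem eqDeven {Q : ADEQuiver} {lam : Q.I → ℂ} (hADE : Q.IsADE) (hnu : Q.NuSpec) {m : ℕ} (hm : 4 ≤ m) (he : Even m)
    (L : Lab Q (m + 1) (ET m 1)) (hanti : ∀ i, lam (Q.nu i) = -lam i) :
    Module.finrank ℂ (Q.Deformed lam) = Module.finrank ℂ (Q.Deformed 0) := by
  rw [Nat.even_iff] at he
  obtain ⟨τ, hτl⟩ : ∃ τ : Q.I → Q.I, ∀ i, L.l (τ i) = if L.l i = 0 then m else if L.l i = m then 0 else L.l i :=
    ⟨fun i => L.g (if L.l i = 0 then m else if L.l i = m then 0 else L.l i), fun i => L.hlg _ (by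
      have := L.hl i
      split_ifs <;> omega)⟩
  have hτ : ∀ i, τ (τ i) = i := by
    intro i
    apply L.linj
    rw [hτl, hτl]
    split_ifs <;> omega
  refine generic hADE τ hτ (antiD hADE hnu hm L hanti τ hτ hτl) ?_
  intro mu hmu hH
  have hg0 : τ (L.g 0) = L.g m := by
    apply L.linj
    rw [hτl, L.hlg 0 (by omega), L.hlg m (by omega), if_pos rfl]
  have hga : ∀ a, 1 ≤ a → a < m → mu (L.g a) = 0 := by
    intro a h1 h2
    have : τ (L.g a) = L.g a := by
      apply L.linj
      rw [hτl, L.hlg a (by omega), if_neg (by omega), if_neg (by omega)]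
    have h3 := hmu (L.g a)
    rw [this] at h3
    exact self_eq_neg.1 h3
  have hmm : mu (L.g m) = - mu (L.g 0) := by rw [← hg0, hmu]
  obtain ⟨t, htd⟩ : ∃ t : ℕ → Q.I → ℤ, ∀ a i, t a i = VD m a (L.l i) := ⟨fun a i => VD m a (L.l i), fun _ _ => rfl⟩
  have htp : ∀ a, 1 ≤ a → a < m → t a = ind {L.g a} := by
    intro a h1 h2
    funext i
    have : i ∈ ({L.g a} : Finset Q.I) ↔ L.l i = a := by
      rw [Finset.mem_singleton]
      constructor
      · rintro rfl; exact L.hlg a (by omega)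
      · intro h; exact (L.hgl i).symm.trans (congrArg L.g h)
    rw [htd]
    simp only [ind, this, VD]
    rw [if_neg (by omega)]
  obtain ⟨p, hp⟩ : ∃ p : ℕ → ℕ, ∀ b, p b = if b = 0 then 0 else if b = 1 then 1 else m := ⟨_, fun _ => rfl⟩
  have ht0 : t 0 = ind ((Finset.range 3).image (fun b => L.g (p b))) := by
    funext i
    have : i ∈ (Finset.range 3).image (fun b => L.g (p b)) ↔ (L.l i = 0 ∨ L.l i = 1 ∨ L.l i = m) := by
      simp only [Finset.mem_image, Finset.mem_range]
      constructor
      · rintro ⟨b, hb, rfl⟩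
        rw [L.hlg _ (by rw [hp]; split_ifs <;> omega), hp]; split_ifs <;> omega
      · rintro (h | h | h)
        · exact ⟨0, by norm_num, by rw [hp, if_pos rfl, ← h, L.hgl]⟩
        · exact ⟨1, by norm_num, by
            rw [hp, if_neg (by norm_num), if_pos rfl]
            exact (congrArg L.g h).symm.trans (L.hgl i)⟩
        · exact ⟨2, by norm_num, by
            rw [hp, if_neg (by norm_num), if_neg (by norm_num)]
            exact (congrArg L.g h).symm.trans (L.hgl i)⟩
    rw [htd]
    simp only [ind, this, VD, if_true]
  have hnn : ∀ a, a < m → ∀ x, 0 ≤ (Rm mu *ᵥ t a) x := by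
    intro a ha x
    by_cases h : a = 0
    · subst h
      rw [ht0]
      refine path_nonneg hADE 3 (fun b => L.g (p b)) ?_ ?_ ?_ x
      · intro b c hb hc h
        have : L.l (L.g (p b)) = L.l (L.g (p c)) := congrArg L.l h
        rw [L.hlg _ (by rw [hp]; split_ifs <;> omega), L.hlg _ (by rw [hp]; split_ifs <;> omega), hp, hp] at this
        split_ifs at this <;> omega
      · intro b c hb hc
        have l1 := L.hlg (p b) (by rw [hp]; split_ifs <;> omega)
        have l2 := L.hlg (p c) (by rw [hp]; split_ifs <;> omega)
        have q1 : (b = 0 ∧ p b = 0) ∨ (b = 1 ∧ p b = 1) ∨ (b = 2 ∧ p b = m) := by rw [hp]; split_ifs <;> omega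
        have q2 : (c = 0 ∧ p c = 0) ∨ (c = 1 ∧ p c = 1) ∨ (c = 2 ∧ p c = m) := by rw [hp]; split_ifs <;> omega
        split_ifs with h
        · apply L.h1
          rw [l1, l2]; simp only [ET, att, EP]; omega
        · apply L.h0
          rw [l1, l2]; simp only [ET, att, EP]; omega
      · simp [Finset.sum_range_succ, hp, hmm, hga 1 le_rfl (by omega)]
    · rw [htp a (by omega) ha]
      exact sing_nonneg hADE _ (hga a (by omega) ha) x
  have htne : ∀ a, a < m → t a ≠ 0 := by
    intro a ha h
    have := congrFun h (L.g a)
    rw [htd, L.hlg a (by omega), VD] at this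
    by_cases h0 : a = 0
    · simp [h0] at this
    · simp [h0] at this
  have hN1 : ∀ a, a < m → 1 ≤ ∑ x, (Rm mu *ᵥ t a) x := fun a ha => R_sum_pos hADE _ (htne a ha) (hnn a ha)
  have hN3 : ∀ a, a < m → 1 ≤ (Rm mu *ᵥ t a) (L.g 0) → 3 ≤ ∑ x, (Rm mu *ᵥ t a) x := by
    intro a ha h
    refine three_le (by omega) L _ (hnn a ha) ?_ ?_ h
    · rw [← hg0]
      refine R_sym τ hH _ ?_ _
      intro i
      rw [htd, htd, hτl]
      have := L.hl i
      generalize L.l i = b at *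
      unfold VD
      split_ifs <;> omega
    · rw [Rm_norm hADE, normD (by omega) L a ha _ (htd a)]
  -- parity
  have par : ∀ (z : Q.I → ℤ) (y : ℕ → ℤ), (∀ i, z i = y (L.l i)) → y 0 = 1 → y m = 1 →
      (∀ a, 1 ≤ a → a < m → Even (2 * y a - ((if 0 < a then y (a - 1) else 0) + (if a + 1 < m then y (a + 1) else 0) +
       (if a = 1 then y m else 0)))) → (Rm mu *ᵥ z) (L.g 0) ≠ 0 := by
    intro z y hz h0 h1 hev hcon
    have hB := BT L (by omega) z y hz
    have := R_even hADE τ hτ hH z ?_ ?_ (L.g 0)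
    · rw [hcon, hz, L.hlg 0 (by omega), h0] at this
      revert this; decide
    · intro i
      rw [hB, hB, hτl]
      have := L.hl i
      generalize L.l i = b at *
      by_cases hb0 : b = 0
      · subst hb0
        rw [if_pos rfl, if_pos rfl, if_neg (by omega : ¬ 0 = m), if_neg (by omega), if_pos (by omega), if_neg (by omega), h0, h1]
        norm_num
      · by_cases hbm : b = m
        · subst hbm
          rw [if_neg hb0, if_pos rfl, if_neg (by omega : ¬ 0 = b), if_neg (by omega), if_pos (by omega), if_neg (by omega), if_pos rfl, h0, h1]
          norm_num
        · rw [if_neg hb0, if_neg hbm]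
    · intro i hi
      have hi' := congrArg L.l hi
      rw [hτl] at hi'
      rw [hB]
      have := L.hl i
      generalize L.l i = b at *
      have hb0 : b ≠ 0 := by intro h; rw [if_pos h] at hi'; omega
      have hbm : b ≠ m := by intro h; rw [if_neg hb0, if_pos h] at hi'; omega
      rw [if_neg hbm]
      exact hev b (by omega) (by omega)
  have par1 : (Rm mu *ᵥ t 0) (L.g 0) + (Rm mu *ᵥ t 1) (L.g 0) ≠ 0 := by
    have := par (t 0 + t 1) (fun b => if b = 1 then 2 else if b = 0 ∨ b = m then 1 else 0) ?_ ?_ ?_ ?_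
    · rw [Matrix.mulVec_add] at this; exact this
    · intro i
      rw [Pi.add_apply, htd, htd]
      unfold VD
      beta_reduce
      split_ifs <;> first | omega | (simp only [false_or, or_false, false_and, not_true, if_false, one_ne_zero] at * <;> omega)
    · simp
    · beta_reduce
      rw [if_neg (by omega), if_pos (by simp)]
    · intro a h1 h2
      rw [Int.even_iff]
      exact pD1 m a hm he h1 h2 _ (fun _ => rfl)
  obtain ⟨S, hS⟩ : ∃ S : Finset ℕ, ∀ a, a ∈ S ↔ (a < m ∧ a % 2 = 1 ∧ 3 ≤ a) :=
    ⟨(Finset.range m).filter (fun a => a % 2 = 1 ∧ 3 ≤ a), fun a => by simp⟩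
  have par2 : (Rm mu *ᵥ t 0) (L.g 0) + ∑ a ∈ S, (Rm mu *ᵥ t a) (L.g 0) ≠ 0 := by
    have := par (t 0 + ∑ a ∈ S, t a) (fun b => if b = 0 ∨ b = m ∨ b % 2 = 1 then 1 else 0) ?_ ?_ ?_ ?_
    · rw [Matrix.mulVec_add, Matrix.mulVec_sum, Pi.add_apply, Finset.sum_apply] at this; exact this
    · intro i
      rw [Pi.add_apply, Finset.sum_apply, htd]
      have e : ∀ a ∈ S, t a i = if L.l i = a then 1 else 0 := by
        intro a ha
        rw [hS] at ha
        rw [htd]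
        unfold VD
        rw [if_neg (by omega)]
      rw [Finset.sum_congr rfl e, Finset.sum_ite_eq]
      have := L.hl i
      unfold VD
      simp only [hS, if_true]
      generalize L.l i = b at *
      split_ifs <;> omega
    · simp
    · simp
    · intro a h1 h2
      rw [Int.even_iff]
      exact pD2 m a hm he h1 h2 _ (fun _ => rfl)
  have hw : ∀ a, a < m → ∑ i, t a i = if a = 0 then 3 else 1 := by
    intro a ha
    rw [← VD_sum m a (by omega) ha, ← L.sum']
    exact Finset.sum_congr rfl fun i _ => htd a i
  have hρt : ∀ i, yD m (L.l i) = ∑ a ∈ Finset.range m, (if a = 1 then yD m 1 - yD m 0 else yD m a) * (t a i : ℝ) := by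
    intro i
    rw [sum_c m _ (by omega) (L.hl i)]
    simp only [htd]
  refine eq_of_ge hADE _ (rhoD (by omega) L) (Finset.range m) t (fun a => if a = 1 then yD m 1 - yD m 0 else yD m a) hρt ?_
  have hmR : (4 : ℝ) ≤ m := by exact_mod_cast hm
  have y0 : yD m 0 = (m : ℝ) * (m + 1) / 4 := by rw [yD, if_pos (Or.inl rfl)]
  have y1 : yD m 1 = 2 * yD m 0 - 1 := by
    rw [y0, yD, if_neg (by omega)]; push_cast; ring
  have ya : ∀ a, a < m → 1 ≤ yD m a := by
    intro a ha
    by_cases h : a = 0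
    · subst h; rw [y0]; nlinarith
    · rw [yD, if_neg (by omega)]
      have h1 : (a : ℝ) + 1 ≤ m := by exact_mod_cast ha
      have h2 : (1 : ℝ) ≤ a := by exact_mod_cast (by omega : 1 ≤ a)
      nlinarith
  obtain ⟨c, hc⟩ : ∃ c : ℕ → ℝ, ∀ a, c a = if a = 1 then yD m 1 - yD m 0 else yD m a := ⟨_, fun _ => rfl⟩
  have hc0 : c 0 = yD m 0 := by rw [hc, if_neg (by norm_num)]
  have hc1 : c 1 = yD m 0 - 1 := by rw [hc, if_pos rfl, y1]; ring
  have hcn : ∀ a, a < m → 0 ≤ c a := by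
    intro a ha
    by_cases h : a = 1
    · subst h; rw [hc1]; have := ya 0 (by omega); linarith
    · rw [hc, if_neg h]; have := ya a ha; linarith
  have hlhs : ∑ i, yD m (L.l i) = ∑ a ∈ Finset.range m, c a * ((∑ i, t a i : ℤ) : ℝ) := by
    simp_rw [hρt]
    rw [Finset.sum_comm]
    refine Finset.sum_congr rfl fun a _ => ?_
    rw [← Finset.mul_sum, hc]; push_cast; rfl
  rw [hlhs]
  simp only [← hc]
  by_cases hA : 1 ≤ (Rm mu *ᵥ t 0) (L.g 0)
  · refine Finset.sum_le_sum fun a ha => ?_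
    have ha := Finset.mem_range.1 ha
    refine mul_le_mul_of_nonneg_left ?_ (hcn a ha)
    rw [hw a ha]
    by_cases h : a = 0
    · subst h
      rw [if_pos rfl]; exact_mod_cast hN3 0 ha hA
    · rw [if_neg h]; exact_mod_cast hN1 a ha
  · have hz := hnn 0 (by omega) (L.g 0)
    have hz0 : (Rm mu *ᵥ t 0) (L.g 0) = 0 := by omega
    rw [hz0, zero_add] at par1 par2
    have h1 := hnn 1 (by omega) (L.g 0)
    have n1 := hN3 1 (by omega) (by omega)
    obtain ⟨s, hsS, hs⟩ := Finset.exists_ne_zero_of_sum_ne_zero par2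
    rw [hS] at hsS
    have h2 := hnn s hsS.1 (L.g 0)
    have ns := hN3 s hsS.1 (by omega)
    have term : ∀ a ∈ Finset.range m, c a * ((∑ i, t a i : ℤ) : ℝ) + ((if a = 0 then - 2 * c 0 else 0) + (if a = 1 then 2 * c 1 else 0) +
        (if a = s then 2 * c s else 0)) ≤ c a * ((∑ x, (Rm mu *ᵥ t a) x : ℤ) : ℝ) := by
      intro a ha
      have ha := Finset.mem_range.1 ha
      have hca := hcn a ha
      rw [hw a ha]
      have hn : (1 : ℝ) ≤ ((∑ x, (Rm mu *ᵥ t a) x : ℤ) : ℝ) := by exact_mod_cast hN1 a ha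
      by_cases e0 : a = 0
      · subst e0
        rw [if_pos rfl, if_pos rfl, if_neg (by norm_num), if_neg (by omega)]
        push_cast at hn ⊢
        nlinarith
      by_cases e1 : a = 1
      · subst e1
        have hn : (3 : ℝ) ≤ ((∑ x, (Rm mu *ᵥ t 1) x : ℤ) : ℝ) := by exact_mod_cast n1
        rw [if_neg e0, if_neg e0, if_pos rfl, if_neg (by omega)]
        push_cast at hn ⊢
        nlinarith
      by_cases e2 : a = s
      · subst e2
        have hn : (3 : ℝ) ≤ ((∑ x, (Rm mu *ᵥ t a) x : ℤ) : ℝ) := by exact_mod_cast ns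
        rw [if_neg e0, if_neg e0, if_neg e1, if_pos rfl]
        push_cast at hn ⊢
        nlinarith
      · rw [if_neg e0, if_neg e0, if_neg e1, if_neg e2]
        push_cast at hn ⊢
        nlinarith
    have tot := Finset.sum_le_sum term
    rw [Finset.sum_add_distrib, Finset.sum_add_distrib, Finset.sum_add_distrib, Finset.sum_ite_eq', Finset.sum_ite_eq',
      Finset.sum_ite_eq', if_pos (by simp; omega), if_pos (by simp; omega), if_pos (by simp; omega)] at tot
    have hcs : 1 ≤ c s := by rw [hc, if_neg (by omega)]; exact ya s hsS.1
    rw [hc0, hc1] at tot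
    linarith

theorem eqD {Q : ADEQuiver} {lam : Q.I → ℂ} (hADE : Q.IsADE) (hexp : Q.ExponentsSpec) (hnu : Q.NuSpec) {m : ℕ} (hm : 3 ≤ m)
    (L : Lab Q (m + 1) (ET m 1)) (hanti : ∀ i, lam (Q.nu i) = -lam i) :
    Module.finrank ℂ (Q.Deformed lam) = Module.finrank ℂ (Q.Deformed 0) := by
  rcases Nat.even_or_odd m with h | h
  · refine eqDeven hADE hnu ?_ h L hanti
    rw [Nat.even_iff] at h
    omega
  · rw [eqDodd hexp hnu hm h L hanti]

end DPA

/-!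
STATEMENT 12: let `Q` be a quiver of ADE type with Coxeter number `h`, and let
`λ : I → ℂ` be a weight with `ν λ = -λ` (i.e. `λ_{ν i} = -λ_i` for all `i`).  Let `A_λ`
be the quotient of the path algebra `ℂQ̄` by the relation `∑_{a ∈ Q} [a, a*] = ∑_i λ_i e_i`.
Then the associated graded algebra of `A_λ` under the filtration by length of paths is
the preprojective algebra `A = Π_Q`; in particular `dim A_λ = dim A = r·h·(h+1)/6`.

`A = Π_Q` is the algebra `A_0` (the same quotient with `λ = 0`), whose path-length
filtration is the filtration associated with its path-length grading.  The statement
`gr A_λ = A` is rendered by the equality `dim filt(A_λ, n) = dim filt(A, n)` of the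
dimensions of all filtration steps (which, together with the canonical surjection
`A = gr A_0 → gr A_λ` coming from the homogenized relations, is equivalent to it);
the dimension statement is rendered without natural-number division as
`6 · dim A_λ = r·h·(h+1)`.
-/
theorem associated_graded_of_deformed_preprojective_algebra
    (Q : ADEQuiver) (hADE : Q.IsADE) (hexp : Q.ExponentsSpec) (hnu : Q.NuSpec)
    (lam : Q.I → ℂ) (hanti : ∀ i, lam (Q.nu i) = -lam i) :
    (∀ n : ℕ, Module.finrank ℂ (Q.filt lam n) = Module.finrank ℂ (Q.filt 0 n)) ∧
    Module.finrank ℂ (Q.Deformed lam) = Module.finrank ℂ (Q.Deformed 0) ∧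
    6 * Module.finrank ℂ (Q.Deformed lam) = Q.r * Q.h * (Q.h + 1) := by
  have hr := hexp.2.2.2.1
  have key : Module.finrank ℂ (Q.Deformed lam) = Module.finrank ℂ (Q.Deformed 0) ∧
      6 * Module.finrank ℂ (Q.Deformed 0) = Q.r * Q.h * (Q.h + 1) := by
    rcases DPA.ade_cases hADE hr with ⟨n, hn, ⟨L⟩⟩ | ⟨m, hm, ⟨L⟩⟩ | ⟨m, hm, hm', ⟨L⟩⟩
    · exact ⟨DPA.eqA hADE hnu L hanti, DPA.dimA hADE hexp hn L⟩
    · exact ⟨DPA.eqD hADE hexp hnu hm L hanti, DPA.dimD hADE hexp hm L⟩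
    · obtain rfl | rfl | rfl : m = 5 ∨ m = 6 ∨ m = 7 := by omega
      · exact ⟨DPA.eq6 hADE hnu L hanti, DPA.dim6 hADE hexp L⟩
      · exact ⟨by rw [DPA.eq7 hADE hnu L hanti], DPA.dim7 hADE hexp L⟩
      · exact ⟨by rw [DPA.eq8 hADE hnu L hanti], DPA.dim8 hADE hexp L⟩
  refine ⟨fun n => DPA.filt_eq_of_dim hADE lam key.1 n, key.1, ?_⟩
  rw [key.1, key.2]
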